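/- arXiv:2305.03543 — 2 statements merged into one kernel-verified Lean document; each statement's English description precedes it below -/
import Mathlib

section
/- For every ε > 0, the probability that the random graph G ∼ G(n,1/2) admits a (γ_crit/√2 + ε)·√n-friendly equipartition tends to 0 as n → ∞. -/
open MeasureTheory ProbabilityTheory

/-- `P[Z ≥ t]` for a standard Gaussian `Z`. -/
noncomputable def gaussTail (t : ℝ) : ℝ :=
  ((gaussianReal 0 1) {x | t ≤ x}).toReal

/-- The law of a pair of independent standard Gaussians. -/
noncomputable def gauss2 : Measure (ℝ × ℝ) :=
  (gaussianReal 0 1).prod (gaussianReal 0 1)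

/-- `F₁(α) = log 2 − α² + log P[Z ≥ (γ+α)√2]`. -/
noncomputable def F1 (γ α : ℝ) : ℝ :=
  Real.log 2 - α ^ 2 + Real.log (gaussTail ((γ + α) * Real.sqrt 2))

/-- `f(β,α) = P[√(β/2)Z₁ + √((1−β)/2)Z₂ ≥ γ+α ∧ √(β/2)Z₁ − √((1−β)/2)Z₂ ≥ γ+α]`. -/
noncomputable def fB (γ β α : ℝ) : ℝ :=
  (gauss2 {p : ℝ × ℝ |
      γ + α ≤ Real.sqrt (β / 2) * p.1 + Real.sqrt ((1 - β) / 2) * p.2 ∧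
      γ + α ≤ Real.sqrt (β / 2) * p.1 - Real.sqrt ((1 - β) / 2) * p.2}).toReal

/-- The two-partition exponent function `F₂`. -/
noncomputable def F2 (γ β α₁ α₂ : ℝ) : ℝ :=
  2 * Real.log 2 - 2 * β * Real.log β - 2 * (1 - β) * Real.log (1 - β)
    - 2 * α₁ ^ 2 - 2 * α₂ ^ 2
    + 2 * β * Real.log (fB γ β α₁) + 2 * (1 - β) * Real.log (fB γ (1 - β) α₂)

/-- `γ` is the critical constant: `γ > 0` and
`log 2 + sup_α (−α² + log P[Z ≥ (γ+α)√2]) = 0`. -/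
def IsGammaCrit (γ : ℝ) : Prop :=
  0 < γ ∧
    Real.log 2 +
      (⨆ α : ℝ, (-α ^ 2 + Real.log (gaussTail ((γ + α) * Real.sqrt 2)))) = 0

/-- The probability, under the uniform measure on labeled graphs on `Fin n`
(equivalently under `G(n,1/2)`), of a graph property `P`. -/
noncomputable def graphProb (n : ℕ) (P : SimpleGraph (Fin n) → Prop) : ℝ :=
  (Nat.card {G : SimpleGraph (Fin n) // P G} : ℝ) / 2 ^ n.choose 2

/-- `deg(v,S)`: the number of neighbors of `v` inside the vertex set `S`. -/
noncomputable def degIn {n : ℕ} (G : SimpleGraph (Fin n)) (v : Fin n)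
    (S : Finset (Fin n)) : ℕ :=
  Nat.card {w : Fin n // w ∈ S ∧ G.Adj v w}

/-- `G` has an `H`-friendly equipartition: a partition `A ∪ Aᶜ` of the vertex set with
`||A| − |Aᶜ|| ≤ 1` such that every vertex has at least `H` more neighbours in its own
part than in the other part. -/
def HasFriendlyEquipartition {n : ℕ} (G : SimpleGraph (Fin n)) (H : ℝ) : Prop :=
  ∃ A : Finset (Fin n),
    |(A.card : ℤ) - ((Aᶜ : Finset (Fin n)).card : ℤ)| ≤ 1 ∧
    (∀ v ∈ A, (degIn G v Aᶜ : ℝ) + H ≤ (degIn G v A : ℝ)) ∧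
    (∀ v ∈ (Aᶜ : Finset (Fin n)), (degIn G v A : ℝ) + H ≤ (degIn G v Aᶜ : ℝ))

open scoped ENNReal

lemma abs_sub_le_of_abs_deriv_le {f f' : ℝ → ℝ} (hf : ∀ x, HasDerivAt f (f' x) x) {M r : ℝ}
    (hM : ∀ s, |s| ≤ r → |f' s| ≤ M) {τ : ℝ} (hτ : |τ| ≤ r) : |f τ - f 0| ≤ M * r := by
  have hr : 0 ≤ r := (abs_nonneg τ).trans hτ
  have hM0 : 0 ≤ M := (abs_nonneg _).trans (hM 0 (by simpa using hr))
  have h := (convex_Icc (-r) r).norm_image_sub_le_of_norm_hasDerivWithin_le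
    (f := f) (f' := f') (C := M) (x := 0) (y := τ)
    (fun x _ => (hf x).hasDerivWithinAt) (fun x hx => hM x (abs_le.2 hx))
    ⟨by linarith, hr⟩ (abs_le.1 hτ)
  rw [sub_zero, Real.norm_eq_abs, Real.norm_eq_abs] at h
  exact h.trans (mul_le_mul_of_nonneg_left hτ hM0)

lemma abs_taylor_two_le {f f₁ f₂ f₃ : ℝ → ℝ} (h₁ : ∀ x, HasDerivAt f (f₁ x) x)
    (h₂ : ∀ x, HasDerivAt f₁ (f₂ x) x) (h₃ : ∀ x, HasDerivAt f₂ (f₃ x) x) {M r : ℝ}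
    (hM : ∀ s, |s| ≤ r → |f₃ s| ≤ M) {τ : ℝ} (hτ : |τ| ≤ r) :
    |f τ - f 0 - f₁ 0 * τ - f₂ 0 * τ ^ 2 / 2| ≤ M * r ^ 3 := by
  have e₂ : ∀ s, |s| ≤ r → |f₂ s - f₂ 0| ≤ M * r := fun s hs =>
    abs_sub_le_of_abs_deriv_le h₃ hM hs
  have e₁ : ∀ s, |s| ≤ r → |f₁ s - f₁ 0 - f₂ 0 * s| ≤ M * r * r := fun s hs => by
    have := abs_sub_le_of_abs_deriv_le (f := fun x => f₁ x - f₁ 0 - f₂ 0 * x)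
      (f' := fun x => f₂ x - f₂ 0)
      (fun x => (((h₂ x).sub_const (f₁ 0)).sub ((hasDerivAt_id x).const_mul (f₂ 0))).congr_deriv
        (by ring))
      e₂ hs
    simpa using this
  have := abs_sub_le_of_abs_deriv_le (f := fun x => f x - f 0 - f₁ 0 * x - f₂ 0 * x ^ 2 / 2)
    (f' := fun x => f₁ x - f₁ 0 - f₂ 0 * x)
    (fun x => ((((h₁ x).sub_const (f 0)).sub ((hasDerivAt_id x).const_mul (f₁ 0))).sub
        (((hasDerivAt_pow 2 x).const_mul (f₂ 0)).div_const 2)).congr_deriv (by push_cast; ring))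
    e₁ hτ
  simp only [sub_self, mul_zero, ne_eq, OfNat.ofNat_ne_zero,
    not_false_eq_true, zero_pow, zero_div, sub_zero] at this
  calc _ ≤ _ := this
    _ = _ := by ring

lemma sigmoid_add_le (a s : ℝ) :
    Real.sigmoid (a + s) ≤ Real.exp |s| * Real.sigmoid a := by
  have h1 : 1 ≤ Real.exp |s| := Real.one_le_exp (abs_nonneg s)
  have h2 : Real.exp (-a) ≤ Real.exp |s| * Real.exp (-(a + s)) := by
    rw [← Real.exp_add]; exact Real.exp_le_exp.2 (by linarith [le_abs_self s])
  rw [Real.sigmoid_def, Real.sigmoid_def, ← div_eq_mul_inv, inv_eq_one_div,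
    div_le_div_iff₀ (by positivity) (by positivity)]
  linarith

/-- Two sigmoid factors moved simultaneously. -/
noncomputable def sigmoidPair (a b τ : ℝ) : ℝ := Real.sigmoid (a + τ) * Real.sigmoid (b + τ)

lemma sigmoidPair_pos (a b τ : ℝ) : 0 < sigmoidPair a b τ :=
  mul_pos (Real.sigmoid_pos _) (Real.sigmoid_pos _)

lemma sigmoidPair_le_one (a b τ : ℝ) : sigmoidPair a b τ ≤ 1 :=
  mul_le_one₀ (Real.sigmoid_le_one _) (Real.sigmoid_nonneg _) (Real.sigmoid_le_one _)

lemma continuous_sigmoidPair (a b : ℝ) : Continuous (sigmoidPair a b) := by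
  have : Continuous Real.sigmoid := contDiff_sigmoid.continuous
  unfold sigmoidPair
  fun_prop

lemma sigmoidPair_add_le (a b τ s : ℝ) :
    sigmoidPair a b (τ + s) ≤ Real.exp (2 * |s|) * sigmoidPair a b τ := by
  have h1 := sigmoid_add_le (a + τ) s
  have h2 := sigmoid_add_le (b + τ) s
  unfold sigmoidPair
  rw [← add_assoc, ← add_assoc, two_mul, Real.exp_add]
  calc _ ≤ _ := mul_le_mul h1 h2 (Real.sigmoid_nonneg _)
        (mul_nonneg (Real.exp_pos _).le (Real.sigmoid_nonneg _))
    _ = _ := by ring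

lemma abs_sigmoidPair_taylor_le (a b : ℝ) : ∃ d₁ d₂ : ℝ, ∀ τ,
    |sigmoidPair a b τ - sigmoidPair a b 0 - d₁ * τ - d₂ * τ ^ 2 / 2| ≤
      20 * Real.exp (2 * |τ|) * sigmoidPair a b 0 * |τ| ^ 3 := by
  have hσ : ∀ c x : ℝ, HasDerivAt (fun x => Real.sigmoid (c + x))
      (Real.sigmoid (c + x) * (1 - Real.sigmoid (c + x))) x := fun c x =>
    (Real.hasDerivAt_sigmoid (c + x)).comp_const_add c x
  let s : ℝ → ℝ := fun x => Real.sigmoid (a + x)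
  let t : ℝ → ℝ := fun x => Real.sigmoid (b + x)
  have hs : ∀ x, HasDerivAt s (s x * (1 - s x)) x := hσ a
  have ht : ∀ x, HasDerivAt t (t x * (1 - t x)) x := hσ b
  let f₁ : ℝ → ℝ := fun x => s x * t x * (2 - s x - t x)
  let f₂ : ℝ → ℝ := fun x =>
    s x * t x * ((2 - s x - t x) ^ 2 - s x * (1 - s x) - t x * (1 - t x))
  let f₃ : ℝ → ℝ := fun x => s x * t x *
    ((2 - s x - t x) * ((2 - s x - t x) ^ 2 - s x * (1 - s x) - t x * (1 - t x))
      - 2 * (2 - s x - t x) * (s x * (1 - s x) + t x * (1 - t x))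
      - s x * (1 - s x) * (1 - 2 * s x) - t x * (1 - t x) * (1 - 2 * t x))
  have h₁ : ∀ x, HasDerivAt (sigmoidPair a b) (f₁ x) x := fun x =>
    ((hs x).mul (ht x)).congr_deriv (by ring)
  have h₂ : ∀ x, HasDerivAt f₁ (f₂ x) x := fun x =>
    (((hs x).mul (ht x)).mul (((hs x).const_sub 2).sub (ht x))).congr_deriv
      (by simp only [f₂, Pi.mul_apply, Pi.sub_apply]; ring)
  have h₃ : ∀ x, HasDerivAt f₂ (f₃ x) x := fun x =>
    (((hs x).mul (ht x)).mul ((((((hs x).const_sub 2).sub (ht x)).pow 2).sub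
      ((hs x).mul ((hs x).const_sub 1))).sub ((ht x).mul ((ht x).const_sub 1)))).congr_deriv
      (by simp only [f₃, Pi.mul_apply, Pi.sub_apply, Pi.pow_apply]; push_cast; ring)
  refine ⟨f₁ 0, f₂ 0, fun τ => abs_taylor_two_le h₁ h₂ h₃ (fun x hx => ?_) le_rfl⟩
  have s0 : 0 ≤ s x := Real.sigmoid_nonneg _
  have s1 : s x ≤ 1 := Real.sigmoid_le_one _
  have t0 : 0 ≤ t x := Real.sigmoid_nonneg _
  have t1 : t x ≤ 1 := Real.sigmoid_le_one _
  have key : |f₃ x| ≤ 20 * sigmoidPair a b x := by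
    have hst : sigmoidPair a b x = s x * t x := rfl
    rw [hst]
    simp only [f₃]
    rw [abs_mul, abs_of_nonneg (mul_nonneg s0 t0), mul_comm (20 : ℝ)]
    refine mul_le_mul_of_nonneg_left ?_ (mul_nonneg s0 t0)
    generalize s x = s at *
    generalize t x = t at *
    have u1 : 0 ≤ s * (1 - s) := mul_nonneg s0 (by linarith)
    have u2 : s * (1 - s) ≤ 1 := by nlinarith
    have v1 : 0 ≤ t * (1 - t) := mul_nonneg t0 (by linarith)
    have v2 : t * (1 - t) ≤ 1 := by nlinarith
    have w0 : |2 - s - t| ≤ 2 := abs_le.2 ⟨by linarith, by linarith⟩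
    have w1 : |(2 - s - t) ^ 2 - s * (1 - s) - t * (1 - t)| ≤ 4 :=
      abs_le.2 ⟨by nlinarith, by nlinarith⟩
    have w2 : |s * (1 - s) + t * (1 - t)| ≤ 2 := abs_le.2 ⟨by linarith, by linarith⟩
    have w3 : |s * (1 - s) * (1 - 2 * s)| ≤ 1 := by
      rw [abs_mul]
      exact mul_le_one₀ (abs_le.2 ⟨by linarith, u2⟩) (abs_nonneg _)
        (abs_le.2 ⟨by linarith, by linarith⟩)
    have w4 : |t * (1 - t) * (1 - 2 * t)| ≤ 1 := by
      rw [abs_mul]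
      exact mul_le_one₀ (abs_le.2 ⟨by linarith, v2⟩) (abs_nonneg _)
        (abs_le.2 ⟨by linarith, by linarith⟩)
    have p1 := mul_le_mul w0 w1 (abs_nonneg _) (by norm_num)
    have p2 := mul_le_mul w0 w2 (abs_nonneg _) (by norm_num)
    rw [← abs_mul] at p1 p2
    have q1 := abs_le.1 p1
    have q2 := abs_le.1 p2
    have q3 := abs_le.1 w3
    have q4 := abs_le.1 w4
    exact abs_le.2 ⟨by linarith, by linarith⟩
  refine key.trans ?_
  have := sigmoidPair_add_le a b 0 x
  rw [zero_add] at this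
  have hx' : Real.exp (2 * |x|) ≤ Real.exp (2 * |τ|) := Real.exp_le_exp.2 (by linarith)
  have := this.trans (mul_le_mul_of_nonneg_right hx' (sigmoidPair_pos a b 0).le)
  linarith

lemma integrable_exp_mul_abs_gaussianReal (c : ℝ) :
    Integrable (fun g => Real.exp (c * |g|)) (gaussianReal 0 1) := by
  refine Integrable.mono' ((integrable_exp_mul_gaussianReal c).add
    (integrable_exp_mul_gaussianReal (-c))) (by fun_prop) (Filter.Eventually.of_forall fun g => ?_)
  rw [Real.norm_of_nonneg (Real.exp_pos _).le]
  rcases abs_cases g with ⟨h, -⟩ | ⟨h, -⟩ <;> rw [h] <;> simp only [Pi.add_apply]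
  · linarith [Real.exp_pos (-c * g)]
  · rw [mul_neg, ← neg_mul]; linarith [Real.exp_pos (c * g)]

lemma integrable_abs_cube_mul_exp_gaussianReal :
    Integrable (fun g : ℝ => |g| ^ 3 * Real.exp (2 * |g|)) (gaussianReal 0 1) := by
  refine Integrable.mono' ((integrable_exp_mul_abs_gaussianReal 3).const_mul 6) (by fun_prop)
    (Filter.Eventually.of_forall fun g => ?_)
  rw [Real.norm_of_nonneg (by positivity)]
  have h := Real.pow_div_factorial_le_exp |g| (abs_nonneg g) 3
  have h6 : ((Nat.factorial 3 : ℕ) : ℝ) = 6 := by norm_num [Nat.factorial]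
  rw [h6, div_le_iff₀ (by norm_num)] at h
  calc _ ≤ (Real.exp |g| * 6) * Real.exp (2 * |g|) :=
        mul_le_mul_of_nonneg_right h (Real.exp_pos _).le
    _ = 6 * (Real.exp |g| * Real.exp (2 * |g|)) := by ring
    _ = _ := by rw [← Real.exp_add]; ring_nf

lemma integral_sq_gaussianReal : ∫ g : ℝ, g ^ 2 ∂(gaussianReal 0 1) = 1 := by
  have h := variance_fun_id_gaussianReal (μ := 0) (v := 1)
  rw [variance_of_integral_eq_zero (by fun_prop) (by simp)] at h
  simpa using h

lemma integrable_sigmoidPair (a b h : ℝ) :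
    Integrable (fun g => sigmoidPair a b (h * g)) (gaussianReal 0 1) := by
  have := continuous_sigmoidPair a b
  refine Integrable.mono' (integrable_const (1 : ℝ)) (by fun_prop)
    (Filter.Eventually.of_forall fun g => ?_)
  rw [Real.norm_of_nonneg (sigmoidPair_pos _ _ _).le]
  exact sigmoidPair_le_one _ _ _

/-- Replacing one symmetric sign by a Gaussian costs a factor `1 + O(h³)`. -/
lemma exists_rademacher_le_gaussian : ∃ C : ℝ, 0 ≤ C ∧ ∀ a b h : ℝ, 0 ≤ h → h ≤ 1 →
    (sigmoidPair a b h + sigmoidPair a b (-h)) / 2 ≤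
      (1 + C * h ^ 3) * ∫ g, sigmoidPair a b (h * g) ∂(gaussianReal 0 1) := by
  set J := ∫ g : ℝ, |g| ^ 3 * Real.exp (2 * |g|) ∂(gaussianReal 0 1) with hJ
  set c := ∫ g : ℝ, Real.exp (-2 * |g|) ∂(gaussianReal 0 1) with hc
  have hJ0 : 0 ≤ J := integral_nonneg fun g => by positivity
  have hc0 : 0 < c := integral_exp_pos (integrable_exp_mul_abs_gaussianReal (-2))
  refine ⟨(20 * Real.exp 2 + 20 * J) / c, by positivity, fun a b h h0 h1 => ?_⟩
  obtain ⟨d₁, d₂, hd⟩ := abs_sigmoidPair_taylor_le a b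
  set A := sigmoidPair a b 0 with hA
  have hA0 : 0 < A := sigmoidPair_pos _ _ _
  set I := ∫ g, sigmoidPair a b (h * g) ∂(gaussianReal 0 1) with hI
  have hT : (sigmoidPair a b h + sigmoidPair a b (-h)) / 2 ≤
      A + d₂ * h ^ 2 / 2 + 20 * Real.exp 2 * A * h ^ 3 := by
    have e1 := (abs_le.1 (hd h)).2
    have e2 := (abs_le.1 (hd (-h))).2
    rw [abs_neg] at e2
    rw [abs_of_nonneg h0] at e1 e2
    have : 20 * Real.exp (2 * h) * A * h ^ 3 ≤ 20 * Real.exp 2 * A * h ^ 3 := by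
      gcongr; linarith
    nlinarith
  have hG : A + d₂ * h ^ 2 / 2 - 20 * J * A * h ^ 3 ≤ I := by
    have i1 : Integrable (fun g : ℝ => g) (gaussianReal 0 1) :=
      (memLp_id_gaussianReal 1).integrable (by simp)
    have i2 : Integrable (fun g : ℝ => g ^ 2) (gaussianReal 0 1) :=
      (memLp_id_gaussianReal 2).integrable_sq
    have i3 := integrable_abs_cube_mul_exp_gaussianReal
    have j1 : Integrable (fun g : ℝ => A + d₁ * h * g) (gaussianReal 0 1) :=
      (integrable_const A).add (i1.const_mul (d₁ * h))
    have j2 : Integrable (fun g : ℝ => A + d₁ * h * g + d₂ * h ^ 2 / 2 * g ^ 2)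
        (gaussianReal 0 1) := j1.add (i2.const_mul (d₂ * h ^ 2 / 2))
    have j3 := i3.const_mul (20 * A * h ^ 3)
    have : ∫ g : ℝ, (A + d₁ * h * g + d₂ * h ^ 2 / 2 * g ^ 2
        - 20 * A * h ^ 3 * (|g| ^ 3 * Real.exp (2 * |g|))) ∂(gaussianReal 0 1) =
        A + d₂ * h ^ 2 / 2 - 20 * J * A * h ^ 3 := by
      rw [integral_sub j2 j3, integral_add j1 (i2.const_mul _),
        integral_add (integrable_const A) (i1.const_mul _), integral_const_mul, integral_const_mul,
        integral_const_mul, integral_sq_gaussianReal, ← hJ, integral_id_gaussianReal]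
      simp; ring
    rw [← this]
    refine integral_mono (j2.sub j3) (integrable_sigmoidPair a b h) fun g => ?_
    have e := (abs_le.1 (hd (h * g))).1
    rw [abs_mul, abs_of_nonneg h0] at e
    have hle : 20 * Real.exp (2 * (h * |g|)) * A * (h * |g|) ^ 3 ≤
        20 * A * h ^ 3 * (|g| ^ 3 * Real.exp (2 * |g|)) := by
      have : Real.exp (2 * (h * |g|)) ≤ Real.exp (2 * |g|) :=
        Real.exp_le_exp.2 (by nlinarith [abs_nonneg g])
      calc _ = 20 * A * h ^ 3 * (|g| ^ 3 * Real.exp (2 * (h * |g|))) := by ring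
        _ ≤ _ := by gcongr
    simp only
    nlinarith
  have hL : A * c ≤ I := by
    rw [hc, ← integral_const_mul]
    refine integral_mono ((integrable_exp_mul_abs_gaussianReal (-2)).const_mul A)
      (integrable_sigmoidPair a b h) fun g => ?_
    have e := sigmoidPair_add_le a b (h * g) (-(h * g))
    rw [add_neg_cancel, abs_neg, abs_mul, abs_of_nonneg h0] at e
    have e2 : A ≤ Real.exp (2 * |g|) * sigmoidPair a b (h * g) :=
      e.trans (mul_le_mul_of_nonneg_right
        (Real.exp_le_exp.2 (by nlinarith [abs_nonneg g])) (sigmoidPair_pos _ _ _).le)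
    have := mul_le_mul_of_nonneg_right e2 (Real.exp_pos (-2 * |g|)).le
    have e3 : Real.exp (2 * |g|) * Real.exp (-2 * |g|) = 1 := by
      rw [← Real.exp_add]; simp
    calc _ ≤ _ := this
      _ = (Real.exp (2 * |g|) * Real.exp (-2 * |g|)) * sigmoidPair a b (h * g) := by ring
      _ = _ := by rw [e3, one_mul]
  have hAI : A ≤ I / c := (le_div_iff₀ hc0).2 hL
  calc _ ≤ I + (20 * Real.exp 2 + 20 * J) * h ^ 3 * A := by linarith
    _ ≤ I + (20 * Real.exp 2 + 20 * J) * h ^ 3 * (I / c) := by gcongr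
    _ = _ := by ring

lemma charFunDual_map_gaussianReal_smul {V : Type*} [Fintype V] (κ : ℝ) (w : V → ℝ)
    (L : StrongDual ℝ (V → ℝ)) :
    charFunDual ((gaussianReal 0 1).map fun g => (κ * g) • w) L =
      Complex.exp (-((κ * L w) ^ 2 / 2 : ℝ)) := by
  rw [charFunDual_eq_charFun_map_one, Measure.map_map (by fun_prop) (by fun_prop)]
  have : (⇑L ∘ fun g : ℝ => (κ * g) • w) = fun g => (κ * L w) * g := by
    ext g; simp; ring
  rw [this, charFun_map_mul, charFun_gaussianReal]
  push_cast
  simp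

/-- Lindeberg replacement: if a single random sign in each direction `w e` may be replaced by a
Gaussian at the cost of a factor, then all of them may be replaced simultaneously. -/
lemma exists_gaussian_sum_powerset_le {V ι : Type*} [Fintype V] [DecidableEq ι]
    {F : (V → ℝ) → ℝ≥0∞} (hF : Measurable F) (r : ℝ≥0∞) (κ : ℝ) (w : ι → V → ℝ) (S : Finset ι)
    (hS : ∀ e ∈ S, ∀ x, F (x + κ • w e) + F (x + (-κ) • w e) ≤
      r * ∫⁻ g, F (x + (κ * g) • w e) ∂(gaussianReal 0 1)) :
    ∃ ν : Measure (V → ℝ), IsProbabilityMeasure ν ∧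
      (∀ L, charFunDual ν L = Complex.exp (-(κ ^ 2 / 2 * ∑ e ∈ S, L (w e) ^ 2 : ℝ))) ∧
      ∀ x, ∑ T ∈ S.powerset, F (x + ∑ e ∈ S, (if e ∈ T then κ else -κ) • w e) ≤
        r ^ S.card * ∫⁻ y, F (x + y) ∂ν := by
  induction S using Finset.induction_on with
  | empty =>
    refine ⟨Measure.dirac 0, inferInstance, fun L => by simp, fun x => ?_⟩
    rw [lintegral_dirac' _ (by fun_prop)]
    simp
  | insert a S ha ih =>
    obtain ⟨ν, hν, hνL, hνF⟩ := ih fun e he => hS e (Finset.mem_insert_of_mem he)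
    have hm : Measurable fun g : ℝ => (κ * g) • w a := by fun_prop
    have hp : IsProbabilityMeasure ((gaussianReal 0 1).map fun g => (κ * g) • w a) :=
      Measure.isProbabilityMeasure_map hm.aemeasurable
    refine ⟨((gaussianReal 0 1).map fun g => (κ * g) • w a) ∗ ν, inferInstance,
      fun L => ?_, fun x => ?_⟩
    · rw [charFunDual_conv, hνL, charFunDual_map_gaussianReal_smul, ← Complex.exp_add,
        Finset.sum_insert ha]
      congr 1
      push_cast
      ring
    have e1 : ∀ T ∈ S.powerset,
        ∑ e ∈ insert a S, (if e ∈ T then κ else -κ) • w e =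
          ∑ e ∈ S, (if e ∈ T then κ else -κ) • w e + (-κ) • w a := fun T hT => by
      have : a ∉ T := fun h => ha (Finset.mem_powerset.1 hT h)
      rw [Finset.sum_insert ha, if_neg this, add_comm]
    have e2 : ∀ T ∈ S.powerset,
        ∑ e ∈ insert a S, (if e ∈ insert a T then κ else -κ) • w e =
          ∑ e ∈ S, (if e ∈ T then κ else -κ) • w e + κ • w a := fun T hT => by
      rw [Finset.sum_insert ha, if_pos (Finset.mem_insert_self _ _), add_comm]
      congr 1
      refine Finset.sum_congr rfl fun e he => ?_
      have : e ≠ a := fun h => ha (h ▸ he)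
      simp [this]
    rw [Finset.sum_powerset_insert ha, Finset.card_insert_of_notMem ha, ← Finset.sum_add_distrib]
    calc _ ≤ ∑ T ∈ S.powerset, r * ∫⁻ g, F (x + ∑ e ∈ S, (if e ∈ T then κ else -κ) • w e
            + (κ * g) • w a) ∂(gaussianReal 0 1) := by
          refine Finset.sum_le_sum fun T hT => ?_
          rw [e1 T hT, e2 T hT, ← add_assoc, ← add_assoc, add_comm (F _)]
          exact hS a (Finset.mem_insert_self _ _) _
      _ = r * ∫⁻ g, ∑ T ∈ S.powerset, F (x + (κ * g) • w a +
            ∑ e ∈ S, (if e ∈ T then κ else -κ) • w e) ∂(gaussianReal 0 1) := by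
          rw [← Finset.mul_sum, lintegral_finsetSum _ fun T _ => by fun_prop]
          simp only [add_right_comm]
      _ ≤ r * ∫⁻ g, r ^ S.card * ∫⁻ y, F (x + (κ * g) • w a + y) ∂ν ∂(gaussianReal 0 1) := by
          gcongr with g
          exact hνF _
      _ = _ := by
          have hm2 : Measurable fun z => ∫⁻ y, F (x + (z + y)) ∂ν :=
            Measurable.lintegral_prod_right' (f := fun p : (V → ℝ) × (V → ℝ) =>
              F (x + (p.1 + p.2))) (by fun_prop)
          rw [Measure.lintegral_conv (by fun_prop), lintegral_map hm2 hm,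
            lintegral_const_mul _ (by simpa only [add_assoc, Function.comp_def] using hm2.comp hm),
            pow_succ']
          simp only [add_assoc, mul_assoc]

lemma prod_sigmoid_add_smul {V : Type*} [Fintype V] [DecidableEq V] (c : ℝ) {u v : V}
    (huv : u ≠ v) (x : V → ℝ) (τ : ℝ) :
    ∏ i, Real.sigmoid (c + (x + τ • (Pi.single u 1 + Pi.single v 1 : V → ℝ)) i) =
      (∏ i ∈ (Finset.univ.erase u).erase v, Real.sigmoid (c + x i)) *
        sigmoidPair (c + x u) (c + x v) τ := by
  rw [← Finset.mul_prod_erase _ _ (Finset.mem_univ u),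
    ← Finset.mul_prod_erase _ _ (Finset.mem_erase.2 ⟨huv.symm, Finset.mem_univ v⟩)]
  have : ∏ i ∈ (Finset.univ.erase u).erase v,
      Real.sigmoid (c + (x + τ • (Pi.single u 1 + Pi.single v 1 : V → ℝ)) i) =
      ∏ i ∈ (Finset.univ.erase u).erase v, Real.sigmoid (c + x i) := by
    refine Finset.prod_congr rfl fun i hi => ?_
    simp only [Finset.mem_erase] at hi
    simp [hi.1, hi.2.1]
  rw [this]
  simp [sigmoidPair, huv, huv.symm, ← add_assoc]
  ring

/-- Ordered representatives of the edges of the complete graph on `Fin n`. -/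
def edgePairs (n : ℕ) : Finset (Fin n × Fin n) := Finset.univ.filter fun p => p.1 < p.2

lemma mem_edgePairs {n : ℕ} {p : Fin n × Fin n} : p ∈ edgePairs n ↔ p.1 < p.2 := by
  simp [edgePairs]

lemma two_mul_sum_edgePairs {n : ℕ} (f : Fin n → Fin n → ℝ) (hf : ∀ u v, f u v = f v u) :
    2 * ∑ p ∈ edgePairs n, f p.1 p.2 = ∑ u, ∑ v, f u v - ∑ u, f u u := by
  have h1 : ∑ p ∈ edgePairs n, f p.1 p.2 = ∑ u, ∑ v, if u < v then f u v else 0 := by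
    rw [edgePairs, Finset.sum_filter, Fintype.sum_prod_type]
  have h2 : ∑ p ∈ edgePairs n, f p.1 p.2 = ∑ u, ∑ v, if v < u then f u v else 0 := by
    rw [h1, Finset.sum_comm]
    simp only [hf]
  have h3 : ∑ u, f u u = ∑ u, ∑ v, if u = v then f u v else 0 := by simp
  rw [two_mul]
  nth_rw 1 [h1]
  rw [h2, h3, ← Finset.sum_add_distrib, ← Finset.sum_sub_distrib]
  refine Finset.sum_congr rfl fun u _ => ?_
  rw [← Finset.sum_add_distrib, ← Finset.sum_sub_distrib]
  refine Finset.sum_congr rfl fun v _ => ?_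
  rcases lt_trichotomy u v with h | h | h
  · simp [h, h.not_gt, h.ne]
  · simp [h]
  · simp [h, h.not_gt, h.ne']

lemma two_mul_card_edgePairs (n : ℕ) : 2 * ((edgePairs n).card : ℝ) = n ^ 2 - n := by
  have := two_mul_sum_edgePairs (n := n) (fun _ _ => 1) (fun _ _ => rfl)
  simp at this
  rw [this]; ring

lemma card_edgePairs (n : ℕ) : (edgePairs n).card = n.choose 2 := by
  have h := two_mul_card_edgePairs n
  have : ((edgePairs n).card : ℝ) = (n.choose 2 : ℕ) := by
    rw [Nat.cast_choose_two]; linarith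
  exact_mod_cast this

lemma eq_conv_of_charFunDual_eq {n : ℕ} {ν : Measure (Fin n → ℝ)} [IsProbabilityMeasure ν]
    {κ K : ℝ} (hK : κ ^ 2 * (n - 2) = K ^ 2)
    (hν : ∀ L, charFunDual ν L = Complex.exp (-(κ ^ 2 / 2 * ∑ p ∈ edgePairs n,
      L (Pi.single p.1 1 + Pi.single p.2 1) ^ 2 : ℝ))) :
    ν = ((gaussianReal 0 1).map fun g => (κ * g) • (fun _ => 1 : Fin n → ℝ)) ∗
      Measure.pi fun _ => (gaussianReal 0 1).map (K * ·) := by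
  have hp : IsProbabilityMeasure
      ((gaussianReal 0 1).map fun g => (κ * g) • (fun _ => 1 : Fin n → ℝ)) :=
    Measure.isProbabilityMeasure_map (by fun_prop)
  have hq : IsProbabilityMeasure ((gaussianReal 0 1).map (K * ·)) :=
    Measure.isProbabilityMeasure_map (by fun_prop)
  refine Measure.ext_of_charFunDual (funext fun L => ?_)
  have hL : L (fun _ => 1) = ∑ u, L (Pi.single u 1) := by
    rw [← map_sum]
    congr 1
    ext i
    simp [Finset.sum_apply, Pi.single_apply]
  have hsum : 2 * ∑ p ∈ edgePairs n, L (Pi.single p.1 1 + Pi.single p.2 1) ^ 2 =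
      2 * ((n - 2) * ∑ u, L (Pi.single u 1) ^ 2 + (∑ u, L (Pi.single u 1)) ^ 2) := by
    refine (two_mul_sum_edgePairs (fun u v => L (Pi.single u 1 + Pi.single v 1) ^ 2)
      (fun u v => by rw [add_comm])).trans ?_
    simp only [map_add, add_sq, Finset.sum_add_distrib, ← Finset.mul_sum, ← Finset.sum_mul,
      Finset.sum_const, Finset.card_univ, Fintype.card_fin, nsmul_eq_mul]
    have : ∀ u, L (Pi.single u 1) * L (Pi.single u 1) = L (Pi.single u 1) ^ 2 := fun u => by ring
    simp only [mul_assoc, this, ← Finset.mul_sum]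
    ring
  have hpi : ∀ u, charFunDual ((gaussianReal 0 1).map (K * ·))
      (L.comp (ContinuousLinearMap.single ℝ (fun _ : Fin n => ℝ) u)) =
      Complex.exp (-(K ^ 2 * L (Pi.single u 1) ^ 2 / 2 : ℝ)) := fun u => by
    rw [charFunDual_eq_charFun_map_one, Measure.map_map (by fun_prop) (by fun_prop)]
    have : (⇑(L.comp (ContinuousLinearMap.single ℝ (fun _ : Fin n => ℝ) u)) ∘ (K * ·)) =
        fun g : ℝ => (K * L (Pi.single u 1)) * g := by
      ext g
      have : Pi.single u (K * g) = (K * g) • (Pi.single u 1 : Fin n → ℝ) := by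
        rw [← Pi.single_smul]; simp
      change L (Pi.single u (K * g)) = _
      rw [this, map_smul, smul_eq_mul]
      ring
    rw [this, charFun_map_mul, charFun_gaussianReal]
    push_cast
    congr 1
    simp; ring
  rw [hν, charFunDual_conv, charFunDual_map_gaussianReal_smul, charFunDual_pi, hL]
  simp only [hpi]
  rw [← Complex.exp_sum, ← Complex.exp_add]
  congr 1
  norm_cast
  rw [Finset.sum_neg_distrib, ← Finset.sum_div, ← Finset.mul_sum, ← hK]
  linear_combination (-κ ^ 2 / 4) * hsum

lemma gaussTail_nonneg (t : ℝ) : 0 ≤ gaussTail t := ENNReal.toReal_nonneg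

lemma gaussTail_eq_measureReal (t : ℝ) : gaussTail t = (gaussianReal 0 1).real (Set.Ici t) := rfl

lemma gaussTail_le_one (t : ℝ) : gaussTail t ≤ 1 := by
  rw [gaussTail_eq_measureReal]; exact measureReal_le_one

lemma gaussTail_antitone : Antitone gaussTail := fun s t hst => by
  rw [gaussTail_eq_measureReal, gaussTail_eq_measureReal]
  exact measureReal_mono (Set.Ici_subset_Ici.2 hst)

lemma gaussTail_lt_half {t : ℝ} (ht : 0 < t) : gaussTail t < 1 / 2 := by
  have hneg : (gaussianReal 0 1).real (Set.Iic (-t)) = gaussTail t := by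
    have h := gaussianReal_map_neg (μ := 0) (v := 1)
    rw [neg_zero] at h
    rw [gaussTail_eq_measureReal, ← h, map_measureReal_apply measurable_neg measurableSet_Iic]
    simp [h]
  have hpos : 0 < (gaussianReal 0 1).real (Set.Ioo (-t) t) := by
    rw [measureReal_def, ENNReal.toReal_pos_iff]
    refine ⟨pos_iff_ne_zero.2 fun h0 => ?_, measure_lt_top _ _⟩
    have := gaussianReal_absolutelyContinuous' 0 one_ne_zero h0
    rw [Real.volume_Ioo, ENNReal.ofReal_eq_zero] at this
    linarith
  have hd1 : Disjoint (Set.Iic (-t)) (Set.Ioo (-t) t) :=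
    Set.disjoint_left.2 fun x h1 h2 => not_lt.2 h1 h2.1
  have hd2 : Disjoint (Set.Iic (-t) ∪ Set.Ioo (-t) t) (Set.Ici t) :=
    Set.disjoint_left.2 fun x h1 h2 => by
      simp only [Set.mem_union, Set.mem_Iic, Set.mem_Ioo, Set.mem_Ici] at h1 h2
      rcases h1 with h | h <;> linarith
  have h1 := measureReal_union (μ := gaussianReal 0 1) hd1 measurableSet_Ioo
  have h2 := measureReal_union (μ := gaussianReal 0 1) hd2 measurableSet_Ici
  have h3 := measureReal_le_one (μ := gaussianReal 0 1)
    (s := Set.Iic (-t) ∪ Set.Ioo (-t) t ∪ Set.Ici t)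
  rw [h2, h1, hneg, ← gaussTail_eq_measureReal] at h3
  linarith

lemma IsGammaCrit.exp_mul_gaussTail_le {γ : ℝ} (hγ : IsGammaCrit γ) (a : ℝ) :
    Real.exp (-a ^ 2 / 2) * gaussTail (γ * √2 - a) ≤ 1 / 2 := by
  have hbdd : BddAbove (Set.range fun α : ℝ =>
      -α ^ 2 + Real.log (gaussTail ((γ + α) * √2))) := by
    refine ⟨0, ?_⟩
    rintro _ ⟨α, rfl⟩
    have := Real.log_nonpos (gaussTail_nonneg _) (gaussTail_le_one ((γ + α) * √2))
    simp only
    nlinarith [sq_nonneg α]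
  have h2 : √2 * √2 = 2 := Real.mul_self_sqrt (by norm_num)
  have hle := le_ciSup hbdd (-a / √2)
  have hsup := hγ.2
  have he : (γ + -a / √2) * √2 = γ * √2 - a := by
    rw [add_mul, div_mul_cancel₀ _ (by positivity)]; ring
  have hsq : -(-a / √2) ^ 2 = -a ^ 2 / 2 := by
    rw [div_pow, neg_sq, Real.sq_sqrt (by norm_num)]; ring
  rw [he, hsq] at hle
  rcases (gaussTail_nonneg (γ * √2 - a)).eq_or_lt with h0 | h0
  · rw [← h0]; norm_num
  · have : -a ^ 2 / 2 + Real.log (gaussTail (γ * √2 - a)) ≤ -Real.log 2 := by linarith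
    have := Real.exp_le_exp.2 this
    rw [Real.exp_add, Real.exp_log h0, Real.exp_neg, Real.exp_log two_pos] at this
    linarith

lemma IsGammaCrit.exists_exp_mul_gaussTail_le {γ : ℝ} (hγ : IsGammaCrit γ) {ε : ℝ} (hε : 0 < ε) :
    ∃ c : ℝ, c < 1 / 2 ∧ ∀ a, Real.exp (-a ^ 2 / 2) * gaussTail (γ * √2 + ε - a) ≤ c := by
  have ht : 0 < γ * √2 := mul_pos hγ.1 (by positivity)
  refine ⟨max (gaussTail (γ * √2)) (Real.exp (-ε ^ 2 / 2) * (1 / 2)),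
    max_lt (gaussTail_lt_half ht) ?_, fun a => ?_⟩
  · have : Real.exp (-ε ^ 2 / 2) < 1 := Real.exp_lt_one_iff.2 (by nlinarith [sq_pos_of_pos hε])
    linarith
  rcases le_total a ε with h | h
  · refine le_max_of_le_left ?_
    have h1 : Real.exp (-a ^ 2 / 2) ≤ 1 := Real.exp_le_one_iff.2 (by nlinarith [sq_nonneg a])
    calc _ ≤ 1 * gaussTail (γ * √2) :=
          mul_le_mul h1 (gaussTail_antitone (by linarith)) (gaussTail_nonneg _) zero_le_one
      _ = _ := one_mul _
  · refine le_max_of_le_right ?_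
    have h1 := hγ.exp_mul_gaussTail_le (a - ε)
    have h2 : Real.exp (-a ^ 2 / 2) ≤ Real.exp (-ε ^ 2 / 2) * Real.exp (-(a - ε) ^ 2 / 2) := by
      rw [← Real.exp_add]
      exact Real.exp_le_exp.2 (by nlinarith [mul_nonneg hε.le (sub_nonneg.2 h)])
    have h3 : γ * √2 + ε - a = γ * √2 - (a - ε) := by ring
    rw [h3]
    calc _ ≤ (Real.exp (-ε ^ 2 / 2) * Real.exp (-(a - ε) ^ 2 / 2)) *
          gaussTail (γ * √2 - (a - ε)) := mul_le_mul_of_nonneg_right h2 (gaussTail_nonneg _)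
      _ = Real.exp (-ε ^ 2 / 2) *
          (Real.exp (-(a - ε) ^ 2 / 2) * gaussTail (γ * √2 - (a - ε))) := by ring
      _ ≤ _ := mul_le_mul_of_nonneg_left h1 (Real.exp_pos _).le

lemma sigmoid_le_exp (x : ℝ) : Real.sigmoid x ≤ Real.exp x := by
  rw [Real.sigmoid_def]
  refine inv_le_of_inv_le₀ (Real.exp_pos x) ?_
  rw [← Real.exp_neg]
  linarith [Real.exp_pos (-x)]

lemma integrable_sigmoid_comp {f : ℝ → ℝ} (hf : Continuous f) :
    Integrable (fun z => Real.sigmoid (f z)) (gaussianReal 0 1) := by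
  have : Continuous fun z => Real.sigmoid (f z) := contDiff_sigmoid.continuous.comp hf
  refine Integrable.mono' (integrable_const (1 : ℝ)) (by fun_prop)
    (Filter.Eventually.of_forall fun g => ?_)
  rw [Real.norm_of_nonneg (Real.sigmoid_nonneg _)]
  exact Real.sigmoid_le_one _

lemma integral_sigmoid_le_gaussTail_add {K : ℝ} (hK : 0 < K) (t η a : ℝ) :
    ∫ z, Real.sigmoid (K * (z + a - (t + η))) ∂(gaussianReal 0 1) ≤
      gaussTail (t - a) + Real.exp (-(K * η)) := by
  have h : ∫ z, ((Set.Ici (t - a)).indicator (fun _ => (1 : ℝ)) z + Real.exp (-(K * η)))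
      ∂(gaussianReal 0 1) = gaussTail (t - a) + Real.exp (-(K * η)) := by
    rw [integral_add ((integrable_const _).indicator measurableSet_Ici) (integrable_const _),
      integral_indicator_const _ measurableSet_Ici, ← gaussTail_eq_measureReal]
    simp
  rw [← h]
  refine integral_mono (integrable_sigmoid_comp (by fun_prop))
    (((integrable_const _).indicator measurableSet_Ici).add (integrable_const _)) fun z => ?_
  by_cases hz : z ∈ Set.Ici (t - a)
  · simp only [Set.indicator_of_mem hz]
    linarith [Real.sigmoid_le_one (K * (z + a - (t + η))), Real.exp_pos (-(K * η))]
  · simp only [Set.indicator_of_notMem hz, zero_add]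
    refine (sigmoid_le_exp _).trans (Real.exp_le_exp.2 ?_)
    have : z < t - a := not_le.1 hz
    nlinarith

/-- Above the threshold, a smoothed tail is bounded by a subcritical constant times a Gaussian
weight that is still integrable. -/
lemma IsGammaCrit.exists_smoothing {γ : ℝ} (hγ : IsGammaCrit γ) {ε : ℝ} (hε : 0 < ε) :
    ∃ K c δ : ℝ, 0 < K ∧ 0 < c ∧ 0 < δ ∧ δ < 1 ∧ c * (1 + Real.exp (-(K * ε))) < 1 / 2 ∧
      ∀ a, ∫ z, Real.sigmoid (K * (z + a - (γ * √2 + 2 * ε))) ∂(gaussianReal 0 1) ≤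
        c * Real.exp ((1 - δ) * (a ^ 2 / 2)) := by
  obtain ⟨c₀, hc₀, hle⟩ := hγ.exists_exp_mul_gaussTail_le hε
  have hc₀0 : 0 ≤ c₀ :=
    (mul_nonneg (Real.exp_pos _).le (gaussTail_nonneg _)).trans (hle 0)
  have hlim : Filter.Tendsto (fun K : ℝ => Real.exp (-(K * ε))) Filter.atTop (nhds 0) :=
    Real.tendsto_exp_neg_atTop_nhds_zero.comp (Filter.tendsto_id.atTop_mul_const hε)
  have hlim2 : Filter.Tendsto (fun K : ℝ => (c₀ + Real.exp (-(K * ε))) *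
      (1 + Real.exp (-(K * ε)))) Filter.atTop (nhds ((c₀ + 0) * (1 + 0))) :=
    (hlim.const_add c₀).mul (hlim.const_add 1)
  obtain ⟨K, hK, hK0⟩ := ((hlim2.eventually_lt_const (u := 1 / 2) (by linarith)).and
    (Filter.eventually_gt_atTop 0)).exists
  set E := Real.exp (-(K * ε)) with hE
  have hE0 : 0 < E := Real.exp_pos _
  have hc1 : 0 < c₀ + E := by linarith
  have hlim3 : Filter.Tendsto (fun δ : ℝ => (c₀ + E) ^ (1 - δ) * (1 + E)) (nhdsWithin 0 (Set.Ioi 0))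
      (nhds ((c₀ + E) ^ (1 - (0 : ℝ)) * (1 + E))) := by
    refine (Continuous.tendsto ?_ 0).mono_left nhdsWithin_le_nhds
    exact ((Real.continuous_const_rpow hc1.ne').comp
      (continuous_const.sub continuous_id)).mul_const _
  rw [sub_zero, Real.rpow_one] at hlim3
  obtain ⟨δ, ⟨hδ, hδ1⟩, hδ0⟩ := ((hlim3.eventually_lt_const hK).and
    (nhdsWithin_le_nhds (eventually_lt_nhds (zero_lt_one)))).and self_mem_nhdsWithin |>.exists
  refine ⟨K, (c₀ + E) ^ (1 - δ), δ, hK0, Real.rpow_pos_of_pos hc1 _, hδ0, hδ1, hδ, fun a => ?_⟩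
  set q := ∫ z, Real.sigmoid (K * (z + a - (γ * √2 + 2 * ε))) ∂(gaussianReal 0 1) with hq
  have hq0 : 0 ≤ q := integral_nonneg fun z => Real.sigmoid_nonneg _
  have hq1 : q ≤ 1 := by
    calc q ≤ ∫ _, (1 : ℝ) ∂(gaussianReal 0 1) :=
          integral_mono (integrable_sigmoid_comp (by fun_prop)) (integrable_const _)
            fun z => Real.sigmoid_le_one _
      _ = 1 := by simp
  have hq2 : q ≤ (c₀ + E) * Real.exp (a ^ 2 / 2) := by
    have h1 := integral_sigmoid_le_gaussTail_add hK0 (γ * √2 + ε) ε a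
    have e : γ * √2 + ε + ε = γ * √2 + 2 * ε := by ring
    rw [e, ← hq, ← hE] at h1
    have h2 := hle a
    have h3 : Real.exp (a ^ 2 / 2) * Real.exp (-a ^ 2 / 2) = 1 := by
      rw [← Real.exp_add]; simp [neg_div]
    have h4 : 1 ≤ Real.exp (a ^ 2 / 2) := Real.one_le_exp (by positivity)
    have h5 := mul_le_mul_of_nonneg_left h2 (Real.exp_pos (a ^ 2 / 2)).le
    rw [← mul_assoc, h3, one_mul] at h5
    nlinarith
  calc q ≤ q ^ (1 - δ) := Real.self_le_rpow_of_le_one hq0 hq1 (by linarith [show 0 < δ from hδ0])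
    _ ≤ ((c₀ + E) * Real.exp (a ^ 2 / 2)) ^ (1 - δ) :=
        Real.rpow_le_rpow hq0 hq2 (by linarith)
    _ = _ := by
      rw [Real.mul_rpow hc1.le (Real.exp_pos _).le, ← Real.exp_mul, mul_comm (a ^ 2 / 2)]

lemma integrable_exp_mul_sq_gaussianReal {θ : ℝ} (hθ : θ < 1) :
    Integrable (fun g : ℝ => Real.exp (θ * (g ^ 2 / 2))) (gaussianReal 0 1) := by
  rw [gaussianReal_of_var_ne_zero _ one_ne_zero,
    integrable_withDensity_iff_integrable_smul' (measurable_gaussianPDF 0 1)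
      (Filter.Eventually.of_forall fun x => gaussianPDF_lt_top)]
  refine ((integrable_exp_neg_mul_sq (b := (1 - θ) / 2) (by linarith)).const_mul
    (√(2 * Real.pi * 1))⁻¹).congr (Filter.Eventually.of_forall fun x => ?_)
  simp only [toReal_gaussianPDF, gaussianPDFReal, NNReal.coe_one, smul_eq_mul]
  rw [mul_assoc _ (Real.exp _), ← Real.exp_add]
  ring_nf

/-- The vector with ones at the endpoints of an edge. -/
def edgeVector {n : ℕ} (p : Fin n × Fin n) : Fin n → ℝ := Pi.single p.1 1 + Pi.single p.2 1

/-- Gaussian upper bound for a smoothed count of sign assignments to the edges of the complete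
graph. -/
lemma exists_sum_prod_sigmoid_le : ∃ C : ℝ, 0 ≤ C ∧ ∀ (n : ℕ) (κ K c : ℝ), 0 ≤ κ → κ ≤ 1 →
    κ ^ 2 * (n - 2) = K ^ 2 →
    ∑ T ∈ (edgePairs n).powerset, ENNReal.ofReal (∏ v, Real.sigmoid
      (c + (∑ e ∈ edgePairs n, (if e ∈ T then κ else -κ) • edgeVector e) v)) ≤
    ENNReal.ofReal (2 * (1 + C * κ ^ 3)) ^ (edgePairs n).card *
      ∫⁻ g, ENNReal.ofReal ((∫ z, Real.sigmoid (c + (κ * g + K * z)) ∂(gaussianReal 0 1)) ^ n)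
        ∂(gaussianReal 0 1) := by
  obtain ⟨C, hC0, hC⟩ := exists_rademacher_le_gaussian
  refine ⟨C, hC0, fun n κ K c h0 h1 hK => ?_⟩
  have hcont : Continuous fun x : Fin n → ℝ => ∏ v, Real.sigmoid (c + x v) :=
    continuous_finsetProd _ fun v _ => continuous_sigmoid.comp (by fun_prop)
  have hF : Measurable fun x : Fin n → ℝ => ENNReal.ofReal (∏ v, Real.sigmoid (c + x v)) :=
    hcont.measurable.ennreal_ofReal
  have hC' : 0 ≤ 1 + C * κ ^ 3 := by positivity
  obtain ⟨ν, hν, hνL, hνF⟩ := exists_gaussian_sum_powerset_le hF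
    (ENNReal.ofReal (2 * (1 + C * κ ^ 3))) κ edgeVector (edgePairs n) fun e he x => by
      have huv : e.1 ≠ e.2 := (mem_edgePairs.1 he).ne
      have hD : 0 ≤ ∏ i ∈ (Finset.univ.erase e.1).erase e.2, Real.sigmoid (c + x i) :=
        Finset.prod_nonneg fun i _ => Real.sigmoid_nonneg _
      simp only [edgeVector, prod_sigmoid_add_smul c huv]
      generalize (∏ i ∈ (Finset.univ.erase e.1).erase e.2, Real.sigmoid (c + x i)) = D at hD
      have key := hC (c + x e.1) (c + x e.2) κ h0 h1
      rw [← ofReal_integral_eq_lintegral_ofReal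
        ((integrable_sigmoidPair (c + x e.1) (c + x e.2) κ).const_mul D)
        (Filter.Eventually.of_forall fun g => mul_nonneg hD (sigmoidPair_pos _ _ _).le),
        ← ENNReal.ofReal_mul (by positivity),
        ← ENNReal.ofReal_add (mul_nonneg hD (sigmoidPair_pos _ _ _).le)
          (mul_nonneg hD (sigmoidPair_pos _ _ _).le), integral_const_mul]
      refine ENNReal.ofReal_le_ofReal ?_
      nlinarith [mul_le_mul_of_nonneg_left key hD]
  have h := hνF 0
  simp only [zero_add] at h
  refine h.trans (mul_le_mul_right ?_ _)
  have hq : IsProbabilityMeasure ((gaussianReal 0 1).map (K * ·)) :=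
    Measure.isProbabilityMeasure_map (by fun_prop)
  have hm : Measurable fun z : Fin n → ℝ =>
      ∫⁻ y : Fin n → ℝ, ENNReal.ofReal (∏ v, Real.sigmoid (c + (z + y) v))
        ∂(Measure.pi fun _ => (gaussianReal 0 1).map (K * ·)) :=
    Measurable.lintegral_prod_right' (f := fun p : (Fin n → ℝ) × (Fin n → ℝ) =>
      ENNReal.ofReal (∏ v, Real.sigmoid (c + (p.1 + p.2) v)))
      (hF.comp (measurable_fst.add measurable_snd))
  rw [eq_conv_of_charFunDual_eq hK hνL, Measure.lintegral_conv hF, lintegral_map hm (by fun_prop)]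
  refine lintegral_mono fun g => le_of_eq ?_
  have hs : Continuous fun y : ℝ => Real.sigmoid (c + (κ * g + y)) :=
    continuous_sigmoid.comp (by fun_prop)
  have hint : ∀ v : Fin n, Integrable (fun y : ℝ => Real.sigmoid (c + (κ * g + y)))
      ((gaussianReal 0 1).map (K * ·)) := fun v => by
    rw [integrable_map_measure hs.aestronglyMeasurable (by fun_prop)]
    exact integrable_sigmoid_comp (by fun_prop)
  have hI : Integrable (fun y : Fin n → ℝ => ∏ v, Real.sigmoid (c + (κ * g + y v)))
      (Measure.pi fun _ => (gaussianReal 0 1).map (K * ·)) :=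
    Integrable.fintype_prod (f := fun _ y => Real.sigmoid (c + (κ * g + y))) hint
  simp only [Pi.add_apply, Pi.smul_apply, smul_eq_mul, mul_one]
  rw [← ofReal_integral_eq_lintegral_ofReal hI (Filter.Eventually.of_forall fun y =>
    Finset.prod_nonneg fun i _ => Real.sigmoid_nonneg _)]
  congr 1
  rw [integral_fintype_prod_eq_prod (fun _ y => Real.sigmoid (c + (κ * g + y))),
    Finset.prod_const, Finset.card_univ, Fintype.card_fin, integral_map (by fun_prop)
      hs.aestronglyMeasurable]

/-- Sign assignments all of whose normalized row sums exceed a supercritical threshold are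
exponentially rarer than `2⁻ⁿ`. -/
lemma IsGammaCrit.exists_card_signs_le {γ : ℝ} (hγ : IsGammaCrit γ) {ε : ℝ} (hε : 0 < ε) :
    ∃ B r : ℝ, 0 ≤ r ∧ r < 1 / 2 ∧ ∀ᶠ n : ℕ in Filter.atTop,
      (((edgePairs n).powerset.filter fun T => ∀ v, γ * √2 + 3 * ε ≤
        (√((n : ℝ) - 2))⁻¹ * ∑ e ∈ edgePairs n,
          (if e ∈ T then (1 : ℝ) else -1) * edgeVector e v).card : ℝ) ≤
        2 ^ (edgePairs n).card * (B * r ^ n) := by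
  obtain ⟨C, hC0, hC⟩ := exists_sum_prod_sigmoid_le
  obtain ⟨K, c, δ, hK, hc, hδ0, hδ1, hcE, hq⟩ := hγ.exists_smoothing hε
  set E := Real.exp (-(K * ε)) with hE
  have hE0 : 0 < E := Real.exp_pos _
  set B := ∫ g : ℝ, Real.exp ((1 - δ / 2) * (g ^ 2 / 2)) ∂(gaussianReal 0 1) with hB
  have hB0 : 0 ≤ B := integral_nonneg fun _ => (Real.exp_pos _).le
  obtain ⟨r, hr1, hr2⟩ := exists_between hcE
  have hr0 : 0 ≤ r := (by positivity : 0 ≤ c * (1 + E)).trans hr1.le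
  have hnat : Filter.Tendsto (fun n : ℕ => (n : ℝ) - 2) Filter.atTop Filter.atTop :=
    Filter.tendsto_atTop_add_const_right _ _ tendsto_natCast_atTop_atTop
  have hh : Filter.Tendsto (fun n : ℕ => (√((n : ℝ) - 2))⁻¹) Filter.atTop (nhds 0) :=
    (Real.tendsto_sqrt_atTop.comp hnat).inv_tendsto_atTop
  have hlim : Filter.Tendsto (fun n : ℕ => c * (1 + E) *
      Real.exp (C * K ^ 3 * (√((n : ℝ) - 2))⁻¹)) Filter.atTop
      (nhds (c * (1 + E) * Real.exp (C * K ^ 3 * 0))) :=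
    ((Real.continuous_exp.tendsto _).comp (hh.const_mul _)).const_mul _
  rw [mul_zero, Real.exp_zero, mul_one] at hlim
  refine ⟨B, r, hr0, hr2, ?_⟩
  filter_upwards [hlim.eventually_lt_const hr1, hh.eventually_lt_const (inv_pos.2 hK),
    Filter.eventually_ge_atTop 4, tendsto_natCast_atTop_atTop.eventually_ge_atTop (4 / δ)]
    with n hn1 hn2 hn4 hnδ
  have hn4' : (4 : ℝ) ≤ n := by exact_mod_cast hn4
  set h := (√((n : ℝ) - 2))⁻¹ with hh_def
  have hh0 : 0 < h := inv_pos.2 (Real.sqrt_pos.2 (by linarith))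
  have hhsq : h ^ 2 * (n - 2) = 1 := by
    rw [hh_def, inv_pow, Real.sq_sqrt (by linarith), inv_mul_cancel₀ (by linarith)]
  have hκ1 : K * h ≤ 1 := by
    rw [← mul_inv_cancel₀ hK.ne']; exact mul_le_mul_of_nonneg_left hn2.le hK.le
  have hmain := hC n (K * h) K (-(K * (γ * √2 + 2 * ε))) (by positivity) hκ1
    (by linear_combination K ^ 2 * hhsq)
  set N := (edgePairs n).card with hN
  have hN2 : 2 * (N : ℝ) = n ^ 2 - n := two_mul_card_edgePairs n
  have hgauss : ∫⁻ g, ENNReal.ofReal ((∫ z, Real.sigmoid (-(K * (γ * √2 + 2 * ε)) +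
      (K * h * g + K * z)) ∂(gaussianReal 0 1)) ^ n) ∂(gaussianReal 0 1) ≤
      ENNReal.ofReal (c ^ n * B) := by
    rw [hB, ← integral_const_mul, ofReal_integral_eq_lintegral_ofReal
      ((integrable_exp_mul_sq_gaussianReal (by linarith)).const_mul _)
      (Filter.Eventually.of_forall fun g => by positivity)]
    refine lintegral_mono fun g => ENNReal.ofReal_le_ofReal ?_
    have e : ∀ z, -(K * (γ * √2 + 2 * ε)) + (K * h * g + K * z) =
        K * (z + h * g - (γ * √2 + 2 * ε)) := fun z => by ring
    simp only [e]
    calc _ ≤ (c * Real.exp ((1 - δ) * ((h * g) ^ 2 / 2))) ^ n :=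
          pow_le_pow_left₀ (integral_nonneg fun z => Real.sigmoid_nonneg _) (hq (h * g)) n
      _ = c ^ n * Real.exp (n * ((1 - δ) * ((h * g) ^ 2 / 2))) := by
          rw [mul_pow, ← Real.exp_nat_mul]
      _ ≤ _ := by
          gcongr c ^ n * Real.exp ?_
          have h1 : (1 - δ) * n ≤ (1 - δ / 2) * (n - 2) := by
            have := (div_le_iff₀ hδ0).1 hnδ
            nlinarith
          have h2 : (1 - δ) * n * h ^ 2 ≤ 1 - δ / 2 := by
            calc _ ≤ (1 - δ / 2) * (n - 2) * h ^ 2 := by gcongr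
              _ = _ := by rw [mul_assoc, mul_comm _ (h ^ 2), hhsq, mul_one]
          calc _ = ((1 - δ) * n * h ^ 2) * (g ^ 2 / 2) := by ring
            _ ≤ _ := mul_le_mul_of_nonneg_right h2 (by positivity)
  have hreal : ∑ T ∈ (edgePairs n).powerset, (∏ v, Real.sigmoid (-(K * (γ * √2 + 2 * ε)) +
      (∑ e ∈ edgePairs n, (if e ∈ T then K * h else -(K * h)) • edgeVector e) v)) ≤
      (2 * (1 + C * (K * h) ^ 3)) ^ N * (c ^ n * B) := by
    have h1 := hmain.trans (mul_le_mul_right hgauss _)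
    rw [← ENNReal.ofReal_sum_of_nonneg fun T _ =>
      Finset.prod_nonneg fun i _ => Real.sigmoid_nonneg _, ← ENNReal.ofReal_pow (by positivity),
      ← ENNReal.ofReal_mul (by positivity)] at h1
    exact (ENNReal.ofReal_le_ofReal_iff (by positivity)).1 h1
  have herr : (1 + C * (K * h) ^ 3) ^ N ≤ Real.exp (C * K ^ 3 * h) ^ n := by
    have hC3 : 0 ≤ C * (K * h) ^ 3 := by positivity
    calc (1 + C * (K * h) ^ 3) ^ N ≤ Real.exp (C * (K * h) ^ 3) ^ N := by
          gcongr
          linarith [Real.add_one_le_exp (C * (K * h) ^ 3)]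
      _ = Real.exp (C * K ^ 3 * h * (N * h ^ 2)) := by rw [← Real.exp_nat_mul]; ring_nf
      _ ≤ Real.exp (C * K ^ 3 * h * n) := by
          gcongr
          have : (N : ℝ) ≤ n * (n - 2) := by nlinarith
          calc (N : ℝ) * h ^ 2 ≤ (n : ℝ) * ((n : ℝ) - 2) * h ^ 2 := by gcongr
            _ = (n : ℝ) := by rw [mul_assoc, mul_comm _ (h ^ 2), hhsq, mul_one]
      _ = _ := by rw [← Real.exp_nat_mul]; ring_nf
  rw [Finset.card_filter]
  push_cast
  calc _ ≤ ∑ T ∈ (edgePairs n).powerset, (1 + E) ^ n *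
        (∏ v, Real.sigmoid (-(K * (γ * √2 + 2 * ε)) +
      (∑ e ∈ edgePairs n, (if e ∈ T then K * h else -(K * h)) • edgeVector e) v)) := by
        refine Finset.sum_le_sum fun T _ => ?_
        have hn : (1 + E) ^ n = ∏ _v : Fin n, (1 + E) := by simp
        rw [hn, ← Finset.prod_mul_distrib]
        have hnn : ∀ x : ℝ, 0 ≤ (1 + E) * Real.sigmoid x := fun x =>
          mul_nonneg (by positivity) (Real.sigmoid_nonneg x)
        split_ifs with hT
        · refine Finset.prod_const_one.symm.le.trans
            (Finset.prod_le_prod (fun _ _ => zero_le_one) fun v _ => ?_)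
          have hv := hT v
          have e1 : (∑ e ∈ edgePairs n, (if e ∈ T then K * h else -(K * h)) • edgeVector e) v =
              K * (h * ∑ e ∈ edgePairs n,
                (if e ∈ T then (1 : ℝ) else -1) * edgeVector e v) := by
            rw [Finset.sum_apply, Finset.mul_sum, Finset.mul_sum]
            refine Finset.sum_congr rfl fun e _ => ?_
            split_ifs <;> simp <;> ring
          rw [e1]
          have h1 : Real.sigmoid (K * ε) ≤ Real.sigmoid (-(K * (γ * √2 + 2 * ε)) +
              K * (h * ∑ e ∈ edgePairs n,
                (if e ∈ T then (1 : ℝ) else -1) * edgeVector e v)) :=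
            Real.sigmoid_le (by nlinarith)
          have h2 : (1 + E) * Real.sigmoid (K * ε) = 1 := by
            rw [Real.sigmoid_def, ← hE, mul_inv_cancel₀ (by positivity)]
          exact h2.symm.le.trans (mul_le_mul_of_nonneg_left h1 (by positivity))
        · exact Finset.prod_nonneg fun v _ => hnn _
    _ ≤ (1 + E) ^ n * ((2 * (1 + C * (K * h) ^ 3)) ^ N * (c ^ n * B)) := by
        rw [← Finset.mul_sum]
        gcongr
    _ ≤ (1 + E) ^ n * ((2 ^ N * Real.exp (C * K ^ 3 * h) ^ n) * (c ^ n * B)) := by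
        rw [mul_pow 2]
        gcongr
    _ = 2 ^ N * (B * (c * (1 + E) * Real.exp (C * K ^ 3 * h)) ^ n) := by
        rw [mul_pow, mul_pow]; ring
    _ ≤ _ := by gcongr

lemma sum_edgePairs_mul_edgeVector {n : ℕ} {f : Fin n → Fin n → ℝ} (hf : ∀ u w, f u w = f w u)
    (v : Fin n) :
    ∑ e ∈ edgePairs n, f e.1 e.2 * edgeVector e v = ∑ w, f v w - f v v := by
  have h := two_mul_sum_edgePairs (n := n) (f := fun u w => f u w * edgeVector (u, w) v)
    fun u w => by simp only [edgeVector, hf u w, add_comm]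
  have h1 : ∑ u, ∑ w, f u w * edgeVector (u, w) v = 2 * ∑ w, f v w := by
    simp [edgeVector, Pi.single_apply, mul_add, Finset.sum_add_distrib, two_mul, hf _ v]
  have h2 : ∑ u, f u u * edgeVector (u, u) v = 2 * f v v := by
    simp [edgeVector, Pi.single_apply, mul_add, Finset.sum_add_distrib, two_mul]
  linarith

open Classical in
lemma degIn_eq_sum {n : ℕ} (G : SimpleGraph (Fin n)) (v : Fin n) (S : Finset (Fin n)) :
    (degIn G v S : ℝ) = ∑ w, if w ∈ S ∧ G.Adj v w then (1 : ℝ) else 0 := by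
  rw [degIn, Nat.card_eq_fintype_card, Fintype.card_subtype, Finset.card_filter]
  push_cast
  rfl

open Classical in
/-- A vertex with at least `H` more neighbours in its own part than in the other one has row sum
at least `2 * H` in the signed adjacency matrix twisted by an equipartition. -/
lemma two_mul_le_sum_sign {n : ℕ} {G : SimpleGraph (Fin n)} {A S : Finset (Fin n)} {v : Fin n}
    {H : ℝ} (hS : ∀ w, w ∈ S ↔ (v ∈ A ↔ w ∈ A)) (hcard : (S.card : ℝ) ≤ Sᶜ.card + 1)
    (h : (degIn G v Sᶜ : ℝ) + H ≤ degIn G v S) :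
    2 * H ≤ ∑ e ∈ edgePairs n,
      (if (G.Adj e.1 e.2 ↔ (e.1 ∈ A ↔ e.2 ∈ A)) then (1 : ℝ) else -1) * edgeVector e v := by
  rw [sum_edgePairs_mul_edgeVector
    (f := fun u w => if (G.Adj u w ↔ (u ∈ A ↔ w ∈ A)) then (1 : ℝ) else -1)
    (fun u w => by simp only [G.adj_comm u w, iff_comm (a := u ∈ A)])]
  have hsum : ∑ w, (if (G.Adj v w ↔ (v ∈ A ↔ w ∈ A)) then (1 : ℝ) else -1) =
      2 * degIn G v S - 2 * degIn G v Sᶜ - S.card + Sᶜ.card := by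
    have hc : ∀ U : Finset (Fin n), (U.card : ℝ) = ∑ w, if w ∈ U then (1 : ℝ) else 0 :=
      fun U => by simp
    rw [degIn_eq_sum, degIn_eq_sum, hc, hc, Finset.mul_sum, Finset.mul_sum,
      ← Finset.sum_sub_distrib, ← Finset.sum_sub_distrib, ← Finset.sum_add_distrib]
    refine Finset.sum_congr rfl fun w _ => ?_
    simp only [← hS w, Finset.mem_compl]
    by_cases h1 : w ∈ S <;> by_cases h2 : G.Adj v w <;> simp [h1, h2] <;> norm_num
  simp only [hsum, G.irrefl, false_iff, iff_self, not_true_eq_false, if_false]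
  linarith

open Classical in
lemma card_hasFriendlyEquipartition_le (n : ℕ) (H : ℝ) :
    Nat.card {G : SimpleGraph (Fin n) // HasFriendlyEquipartition G H} ≤
      2 ^ n * ((edgePairs n).powerset.filter fun T => ∀ v, 2 * H ≤
        ∑ e ∈ edgePairs n, (if e ∈ T then (1 : ℝ) else -1) * edgeVector e v).card := by
  set good := (edgePairs n).powerset.filter fun T => ∀ v, 2 * H ≤
    ∑ e ∈ edgePairs n, (if e ∈ T then (1 : ℝ) else -1) * edgeVector e v with hgood
  let enc (A : Finset (Fin n)) (G : SimpleGraph (Fin n)) : Finset (Fin n × Fin n) :=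
    (edgePairs n).filter fun e => G.Adj e.1 e.2 ↔ (e.1 ∈ A ↔ e.2 ∈ A)
  have henc (A : Finset (Fin n)) : Function.Injective (enc A) := fun G G' hG => by
    have hlt : ∀ u w : Fin n, u < w → (G.Adj u w ↔ G'.Adj u w) := fun u w huw => by
      have he : (u, w) ∈ edgePairs n := mem_edgePairs.2 huw
      have := Finset.ext_iff.1 hG (u, w)
      simp only [enc, Finset.mem_filter, he, true_and] at this
      tauto
    ext u w
    rcases lt_trichotomy u w with huw | rfl | huw
    · exact hlt u w huw
    · simp
    · rw [G.adj_comm, G'.adj_comm]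
      exact hlt w u huw
  rw [Nat.card_eq_fintype_card, Fintype.card_subtype]
  calc _ ≤ ((Finset.univ : Finset (Finset (Fin n))).biUnion fun A =>
        Finset.univ.filter fun G => enc A G ∈ good).card := by
        refine Finset.card_le_card fun G hG => ?_
        obtain ⟨A, hA, h1, h2⟩ := (Finset.mem_filter.1 hG).2
        refine Finset.mem_biUnion.2 ⟨A, Finset.mem_univ _, Finset.mem_filter.2
          ⟨Finset.mem_univ _, Finset.mem_filter.2
            ⟨Finset.mem_powerset.2 (Finset.filter_subset _ _), fun v => ?_⟩⟩⟩
        have hA' : |(A.card : ℝ) - (Aᶜ.card : ℝ)| ≤ 1 := by exact_mod_cast hA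
        rw [abs_le] at hA'
        have key : 2 * H ≤ ∑ e ∈ edgePairs n,
            (if (G.Adj e.1 e.2 ↔ (e.1 ∈ A ↔ e.2 ∈ A)) then (1 : ℝ) else -1) *
              edgeVector e v := by
          by_cases hv : v ∈ A
          · exact two_mul_le_sum_sign (S := A) (fun w => by simp [hv]) (by linarith) (h1 v hv)
          · refine two_mul_le_sum_sign (S := Aᶜ) (fun w => by simp [hv]) ?_ ?_
            · rw [compl_compl]; linarith
            · rw [compl_compl]; exact h2 v (Finset.mem_compl.2 hv)
        refine key.trans_eq (Finset.sum_congr rfl fun e he => ?_)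
        simp only [enc, Finset.mem_filter, he, true_and]
    _ ≤ ∑ A : Finset (Fin n), (Finset.univ.filter fun G => enc A G ∈ good).card :=
        Finset.card_biUnion_le
    _ ≤ ∑ _A : Finset (Fin n), good.card := Finset.sum_le_sum fun A _ =>
        Finset.card_le_card_of_injOn (enc A) (fun G hG => (Finset.mem_filter.1 hG).2)
          (henc A).injOn
    _ = _ := by simp

/-- For every `ε > 0`, the probability that `G ∼ G(n,1/2)` admits a
`(γ_crit/√2 + ε)·√n`-friendly equipartition tends to `0` as `n → ∞`. -/
theorem no_friendly_equipartition_above_threshold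
    (γcrit : ℝ) (hγ : IsGammaCrit γcrit) (ε : ℝ) (hε : 0 < ε) :
    Filter.Tendsto
      (fun n : ℕ => graphProb n (fun G =>
        HasFriendlyEquipartition G ((γcrit / Real.sqrt 2 + ε) * Real.sqrt n)))
      Filter.atTop (nhds 0) := by
  classical
  obtain ⟨B, r, hr0, hr, hbound⟩ := hγ.exists_card_signs_le (ε := 2 * ε / 3) (by positivity)
  have hlim : Filter.Tendsto (fun n : ℕ => B * (2 * r) ^ n) Filter.atTop (nhds 0) := by
    simpa using (tendsto_pow_atTop_nhds_zero_of_lt_one (by positivity : 0 ≤ 2 * r)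
      (by linarith)).const_mul B
  refine tendsto_of_tendsto_of_tendsto_of_le_of_le' tendsto_const_nhds hlim
    (Filter.Eventually.of_forall fun n => by unfold graphProb; positivity) ?_
  filter_upwards [hbound, Filter.eventually_ge_atTop 3] with n hn h3
  have h3' : (3 : ℝ) ≤ n := by exact_mod_cast h3
  set H := (γcrit / √2 + ε) * √(n : ℝ) with hH
  have hH0 : 0 ≤ 2 * H := by have := hγ.1; positivity
  have hsqrt : 1 ≤ (√((n : ℝ) - 2))⁻¹ * √(n : ℝ) := by
    rw [← div_eq_inv_mul, one_le_div (Real.sqrt_pos.2 (by linarith))]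
    exact Real.sqrt_le_sqrt (by linarith)
  have hthr : γcrit * √2 + 3 * (2 * ε / 3) ≤ (√((n : ℝ) - 2))⁻¹ * (2 * H) := by
    have h2 : γcrit / √2 * 2 = γcrit * √2 := by
      rw [div_mul_eq_mul_div, mul_div_assoc, Real.div_sqrt]
    have h4 : (√((n : ℝ) - 2))⁻¹ * (2 * H) =
        (γcrit * √2 + 2 * ε) * ((√((n : ℝ) - 2))⁻¹ * √(n : ℝ)) := by
      rw [← h2, hH]; ring
    rw [h4]
    have h5 : 0 ≤ γcrit * √2 + 2 * ε := by have := hγ.1; positivity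
    nlinarith
  rw [graphProb, div_le_iff₀ (by positivity), ← card_edgePairs]
  calc (Nat.card {G : SimpleGraph (Fin n) // HasFriendlyEquipartition G H} : ℝ)
      ≤ 2 ^ n * (((edgePairs n).powerset.filter fun T => ∀ v, 2 * H ≤
        ∑ e ∈ edgePairs n, (if e ∈ T then (1 : ℝ) else -1) * edgeVector e v).card : ℝ) := by
        exact_mod_cast card_hasFriendlyEquipartition_le n H
    _ ≤ 2 ^ n * (2 ^ (edgePairs n).card * (B * r ^ n)) := by
        refine mul_le_mul_of_nonneg_left (le_trans ?_ hn) (by positivity)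
        refine Nat.cast_le.2 (Finset.card_le_card fun T hT => ?_)
        rw [Finset.mem_filter] at hT ⊢
        exact ⟨hT.1, fun v => hthr.trans (mul_le_mul_of_nonneg_left (hT.2 v) (by positivity))⟩
    _ = _ := by rw [mul_pow]; ring
end

section
/- There exists an absolute constant C > 0 such that for all n ≥ 3 and all ε ∈ (0,1) (possibly depending on n): if 𝒢 is an S_n-invariant family of labeled graphs on vertex set [n] with μ(𝒢) ≥ ε, then μ(𝒢_T) ≥ 1 − ε, where T = C·log(1/ε)·√(n/log n). -/
/-- `d(G,H) = Δ(G △ H)`: the maximum, over vertices `v`, of the number of vertices `w`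
at which the adjacency of `G` and `H` at `{v,w}` differs. -/
noncomputable def maxDegSD {n : ℕ} (G H : SimpleGraph (Fin n)) : ℕ :=
  Finset.univ.sup fun v : Fin n => Nat.card {w : Fin n // ¬ (G.Adj v w ↔ H.Adj v w)}

namespace CubeExpansion

open Finset

section Cube

variable {E : Type*} [Fintype E] [DecidableEq E]

/-- The sign `±1` attached to a bit. -/
def sgn (b : Bool) : ℝ := if b then 1 else -1

lemma sgn_mul_self (b : Bool) : sgn b * sgn b = 1 := by cases b <;> simp [sgn]

lemma sgn_not (b : Bool) : sgn (!b) = -sgn b := by cases b <;> simp [sgn]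

lemma sum_prod_eq_prod_sum (h : E → Bool → ℝ) :
    ∑ x : E → Bool, ∏ e, h e (x e) = ∏ e, ∑ b, h e b := by
  rw [Finset.prod_univ_sum, Fintype.piFinset_univ]

lemma sum_sum_prod_eq_prod_sum_sum (h : E → Bool → Bool → ℝ) :
    ∑ x : E → Bool, ∑ y : E → Bool, ∏ e, h e (x e) (y e) = ∏ e, ∑ b, ∑ b', h e b b' := by
  simp_rw [fun x : E → Bool => sum_prod_eq_prod_sum (fun e b' => h e (x e) b')]
  exact sum_prod_eq_prod_sum (fun e b => ∑ b', h e b b')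

/-- The weight of a point of the cube under a product measure. -/
def weight (p : E → Bool → ℝ) (y : E → Bool) : ℝ := ∏ e, p e (y e)

omit [DecidableEq E] in
lemma weight_nonneg {p : E → Bool → ℝ} (hp : ∀ e b, 0 ≤ p e b) (y : E → Bool) :
    0 ≤ weight p y := prod_nonneg fun e _ => hp e _

lemma sum_weight_mul_prod {p : E → Bool → ℝ} (hp : ∀ e, ∑ b, p e b = 1) (s : Finset E)
    (g : E → Bool → ℝ) :
    ∑ y, weight p y * ∏ e ∈ s, g e (y e) = ∏ e ∈ s, ∑ b, p e b * g e b := by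
  have h1 : ∀ y : E → Bool, weight p y * ∏ e ∈ s, g e (y e)
      = ∏ e, p e (y e) * (if e ∈ s then g e (y e) else 1) := fun y => by
    rw [prod_mul_distrib, weight, prod_ite_mem, univ_inter]
  simp_rw [h1]
  rw [sum_prod_eq_prod_sum (fun e b => p e b * if e ∈ s then g e b else 1),
    ← univ_inter s, ← prod_ite_mem]
  refine prod_congr rfl fun e _ => ?_
  by_cases h : e ∈ s
  · simp [h]
  · simpa [h] using hp e

lemma sum_weight {p : E → Bool → ℝ} (hp : ∀ e, ∑ b, p e b = 1) : ∑ y, weight p y = 1 := by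
  simpa using sum_weight_mul_prod hp ∅ fun _ _ => 1

lemma sum_weight_mul {p : E → Bool → ℝ} (hp : ∀ e, ∑ b, p e b = 1) (i : E) (g : Bool → ℝ) :
    ∑ y, weight p y * g (y i) = ∑ b, p i b * g b := by
  simpa using sum_weight_mul_prod hp {i} fun _ => g

lemma sum_weight_mul_mul {p : E → Bool → ℝ} (hp : ∀ e, ∑ b, p e b = 1) {i j : E} (hij : i ≠ j)
    (g : E → Bool → ℝ) :
    ∑ y, weight p y * (g i (y i) * g j (y j)) = (∑ b, p i b * g i b) * ∑ b, p j b * g j b := by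
  simpa [prod_pair hij] using sum_weight_mul_prod hp {i, j} g

/-- The average over the cube. -/
noncomputable def avg (f : (E → Bool) → ℝ) : ℝ := (∑ x, f x) / 2 ^ Fintype.card E

lemma avg_mono {f g : (E → Bool) → ℝ} (h : ∀ x, f x ≤ g x) : avg f ≤ avg g := by
  unfold avg; gcongr; exact h _

lemma avg_nonneg {f : (E → Bool) → ℝ} (h : ∀ x, 0 ≤ f x) : 0 ≤ avg f := by
  unfold avg; exact div_nonneg (sum_nonneg fun x _ => h x) (by positivity)

lemma avg_const (c : ℝ) : avg (fun _ : E → Bool => c) = c := by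
  simp [avg]

lemma avg_add (f g : (E → Bool) → ℝ) : avg (fun x => f x + g x) = avg f + avg g := by
  simp [avg, sum_add_distrib, add_div]

lemma avg_const_mul (c : ℝ) (f : (E → Bool) → ℝ) : avg (fun x => c * f x) = c * avg f := by
  simp [avg, ← mul_sum, mul_div_assoc]

lemma avg_sum {ι : Type*} (s : Finset ι) (f : ι → (E → Bool) → ℝ) :
    avg (fun x => ∑ i ∈ s, f i x) = ∑ i ∈ s, avg (f i) := by
  simp only [avg, ← sum_div]; rw [sum_comm]

lemma avg_mul_sq_le (f g : (E → Bool) → ℝ) :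
    avg (fun x => f x * g x) ^ 2 ≤ avg (fun x => f x ^ 2) * avg (fun x => g x ^ 2) := by
  simp only [avg]
  rw [div_pow, div_mul_div_comm, ← sq]
  gcongr
  exact sum_mul_sq_le_sq_mul_sq _ _ _

/-- The Walsh character of a set of coordinates. -/
def chi (S : Finset E) (x : E → Bool) : ℝ := ∏ e ∈ S, sgn (x e)

lemma avg_chi_mul_chi (S T : Finset E) :
    avg (fun x => chi S x * chi T x) = if S = T then 1 else 0 := by
  have h1 : ∀ x : E → Bool, chi S x * chi T x
      = ∏ e, (if e ∈ S then sgn (x e) else 1) * (if e ∈ T then sgn (x e) else 1) := fun x => by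
    rw [prod_mul_distrib, prod_ite_mem, prod_ite_mem, univ_inter, univ_inter, chi, chi]
  simp only [avg, h1]
  rw [sum_prod_eq_prod_sum (fun e b => (if e ∈ S then sgn b else 1) * (if e ∈ T then sgn b else 1))]
  split_ifs with h
  · subst h
    rw [div_eq_one_iff_eq (by positivity), ← Finset.card_univ, ← prod_const]
    refine prod_congr rfl fun e _ => ?_
    split_ifs <;> norm_num [sgn]
  · obtain ⟨e, he⟩ : ∃ e, ¬ (e ∈ S ↔ e ∈ T) := by
      by_contra hc; push Not at hc; exact h (Finset.ext hc)
    rw [prod_eq_zero (mem_univ e), zero_div]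
    by_cases h1 : e ∈ S <;> by_cases h2 : e ∈ T <;> simp_all [sgn]

/-- The multilinear polynomial with coefficients `a`, on the cube. -/
def walsh (a : Finset E → ℝ) (x : E → Bool) : ℝ := ∑ S, a S * chi S x

lemma avg_walsh_mul_walsh (a b : Finset E → ℝ) :
    avg (fun x => walsh a x * walsh b x) = ∑ S, a S * b S := by
  simp only [walsh, sum_mul_sum]
  rw [avg_sum]
  refine sum_congr rfl fun S _ => ?_
  rw [avg_sum, sum_eq_single S]
  · have := avg_chi_mul_chi S S
    simp only [if_true] at this
    rw [← mul_one (a S * b S), ← this, ← avg_const_mul]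
    congr 1; ext x; ring
  · intro T _ hT
    have := avg_chi_mul_chi S T
    rw [if_neg (Ne.symm hT)] at this
    rw [← mul_zero (a S * b T), ← this, ← avg_const_mul]
    congr 1; ext x; ring
  · simp

lemma avg_walsh_sq (a : Finset E → ℝ) : avg (fun x => walsh a x ^ 2) = ∑ S, a S ^ 2 := by
  simpa only [sq] using avg_walsh_mul_walsh a a

/-- Flipping one coordinate. -/
def flipEquiv (e : E) : (E → Bool) ≃ (E → Bool) :=
  Function.Involutive.toPerm (fun x => Function.update x e (!x e)) fun x => by simp

omit [Fintype E] in
lemma flipEquiv_apply (e : E) (x : E → Bool) :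
    flipEquiv e x = Function.update x e (!x e) := rfl

lemma avg_sgn_mul (e : E) {h : (E → Bool) → ℝ} (hh : ∀ x, h (flipEquiv e x) = h x) :
    avg (fun x => sgn (x e) * h x) = 0 := by
  have h1 : ∑ x : E → Bool, sgn (x e) * h x = -∑ x : E → Bool, sgn (x e) * h x := by
    conv_lhs => rw [← (flipEquiv e).sum_comp]
    rw [← sum_neg_distrib]
    refine sum_congr rfl fun x _ => ?_
    rw [hh]
    simp [flipEquiv_apply, sgn_not]
  simp only [avg]
  rw [show ∑ x : E → Bool, sgn (x e) * h x = 0 by linarith, zero_div]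

omit [Fintype E] in
lemma chi_flipEquiv {e : E} {S : Finset E} (h : e ∉ S) (x : E → Bool) :
    chi S (flipEquiv e x) = chi S x := by
  refine prod_congr rfl fun i hi => ?_
  have : i ≠ e := fun h' => h (h' ▸ hi)
  simp [flipEquiv_apply, this]

lemma avg_sum_powerset_pow_four_le (s : Finset E) : ∀ a : Finset E → ℝ,
    avg (fun x => (∑ S ∈ s.powerset, a S * (1 / 2) ^ #S * chi S x) ^ 4)
      ≤ (∑ S ∈ s.powerset, a S ^ 2) ^ 2 := by
  induction s using Finset.induction_on with
  | empty => intro a; simp [chi, avg_const]; apply le_of_eq; ring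
  | insert e s he ih =>
    intro a
    set A : (E → Bool) → ℝ := fun x => ∑ S ∈ s.powerset, a S * (1 / 2) ^ #S * chi S x with hA
    set B : (E → Bool) → ℝ :=
      fun x => ∑ S ∈ s.powerset, a (insert e S) * (1 / 2) ^ #S * chi S x with hB
    have hmem : ∀ S ∈ s.powerset, e ∉ S := fun S hS h => he (mem_powerset.1 hS h)
    have hAf : ∀ x, A (flipEquiv e x) = A x := fun x =>
      sum_congr rfl fun S hS => by rw [chi_flipEquiv (hmem S hS)]
    have hBf : ∀ x, B (flipEquiv e x) = B x := fun x =>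
      sum_congr rfl fun S hS => by rw [chi_flipEquiv (hmem S hS)]
    have h1 : ∀ x, ∑ S ∈ (insert e s).powerset, a S * (1 / 2) ^ #S * chi S x
        = A x + sgn (x e) * (1 / 2 * B x) := fun x => by
      rw [sum_powerset_insert he, hA, hB]
      simp only [mul_sum]
      congr 1
      refine sum_congr rfl fun S hS => ?_
      rw [card_insert_of_notMem (hmem S hS), chi, prod_insert (hmem S hS), chi]
      ring
    have h2 : ∀ x, (A x + sgn (x e) * (1 / 2 * B x)) ^ 4
        = (A x ^ 4 + ((3 / 2) * (A x ^ 2 * B x ^ 2) + (1 / 16) * B x ^ 4))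
          + sgn (x e) * (2 * A x ^ 3 * B x + (1 / 2) * A x * B x ^ 3) := fun x => by
      have := sgn_mul_self (x e)
      linear_combination (3 / 2 * A x ^ 2 * B x ^ 2 + 1 / 2 * A x * B x ^ 3 * sgn (x e)
        + 1 / 16 * B x ^ 4 * (sgn (x e) * sgn (x e) + 1)) * this
    simp_rw [h1, h2]
    rw [avg_add, avg_sgn_mul e (by intro x; rw [hAf, hBf]), avg_add, avg_add, avg_const_mul,
      avg_const_mul, add_zero, sum_powerset_insert he]
    have hA4 := ih a
    have hB4 := ih fun S => a (insert e S)
    have hAB := avg_mul_sq_le (fun x => A x ^ 2) (fun x => B x ^ 2)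
    simp only [← pow_mul, Nat.reduceMul] at hAB
    change avg (fun x => A x ^ 4) ≤ _ at hA4
    change avg (fun x => B x ^ 4) ≤ _ at hB4
    set α := ∑ S ∈ s.powerset, a S ^ 2
    set β := ∑ S ∈ s.powerset, a (insert e S) ^ 2
    have hα : 0 ≤ α := sum_nonneg fun _ _ => sq_nonneg _
    have hβ : 0 ≤ β := sum_nonneg fun _ _ => sq_nonneg _
    have hAB' : avg (fun x => A x ^ 2 * B x ^ 2) ≤ α * β := by
      refine abs_le_of_sq_le_sq' ?_ (by positivity) |>.2
      refine hAB.trans ?_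
      rw [mul_pow]
      exact mul_le_mul hA4 hB4 (avg_nonneg fun x => by positivity) (by positivity)
    nlinarith [mul_nonneg hα hβ, sq_nonneg β]

/-- Bonami's `(2, 4)`-hypercontractive inequality, with noise rate `1 / 2`. -/
lemma avg_walsh_pow_four_le (a : Finset E → ℝ) :
    avg (fun x => walsh (fun S => a S * (1 / 2) ^ #S) x ^ 4) ≤ (∑ S, a S ^ 2) ^ 2 := by
  simpa [walsh] using avg_sum_powerset_pow_four_le (univ : Finset E) a

lemma sum_sq_mul_pow_le (a : Finset E → ℝ) :
    ∑ S, a S ^ 2 * (1 / 4) ^ #S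
      ≤ avg (fun x => |walsh a x|) * √(∑ S, a S ^ 2) := by
  set Q := ∑ S, a S ^ 2 * (1 / 4 : ℝ) ^ #S with hQ
  have hQ0 : 0 ≤ Q := sum_nonneg fun _ _ => by positivity
  set c : Finset E → ℝ := fun S => (a S * (1 / 2) ^ #S) * (1 / 2) ^ #S with hc
  have h1 : avg (fun x => walsh a x * walsh c x) = Q := by
    rw [avg_walsh_mul_walsh]
    refine sum_congr rfl fun S _ => ?_
    rw [hc, show (1 / 4 : ℝ) = 1 / 2 * (1 / 2) by norm_num, mul_pow]; ring
  have h2 : avg (fun x => walsh c x ^ 4) ≤ Q ^ 2 := by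
    refine (avg_walsh_pow_four_le (fun S => a S * (1 / 2) ^ #S)).trans (le_of_eq ?_)
    congr 1
    refine sum_congr rfl fun S _ => ?_
    rw [show (1 / 4 : ℝ) = 1 / 2 * (1 / 2) by norm_num, mul_pow, mul_pow, ← pow_mul, mul_comm _ 2,
      pow_mul, sq ((1 / 2 : ℝ)), mul_pow]
  have h3 : Q ^ 2 ≤ avg (fun x => |walsh a x|) * avg (fun x => |walsh a x| * walsh c x ^ 2) := by
    have := avg_mul_sq_le (fun x => √|walsh a x|) (fun x => √|walsh a x| * |walsh c x|)
    simp only [mul_pow, Real.sq_sqrt (abs_nonneg _), sq_abs, ← mul_assoc,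
      Real.mul_self_sqrt (abs_nonneg _)] at this
    refine le_trans ?_ this
    gcongr
    rw [← h1]
    exact avg_mono fun x => by rw [← abs_mul]; exact le_abs_self _
  have h4 : avg (fun x => |walsh a x| * walsh c x ^ 2) ≤ √(∑ S, a S ^ 2) * Q := by
    have := avg_mul_sq_le (fun x => |walsh a x|) (fun x => walsh c x ^ 2)
    simp only [sq_abs, ← pow_mul, Nat.reduceMul, avg_walsh_sq] at this
    refine abs_le_of_sq_le_sq' ?_ (by positivity) |>.2
    rw [mul_pow, Real.sq_sqrt (sum_nonneg fun _ _ => sq_nonneg _)]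
    exact this.trans (mul_le_mul_of_nonneg_left h2 (sum_nonneg fun _ _ => sq_nonneg _))
  have h5 : 0 ≤ avg (fun x => |walsh a x|) := avg_nonneg fun _ => abs_nonneg _
  rcases hQ0.eq_or_lt with h | h
  · rw [← h]; positivity
  · have : Q * Q ≤ (avg (fun x => |walsh a x|) * √(∑ S, a S ^ 2)) * Q := by
      rw [← sq]
      refine h3.trans ?_
      rw [mul_assoc]
      exact mul_le_mul_of_nonneg_left h4 h5
    exact le_of_mul_le_mul_right this h

end Cube

section Noise

variable {E : Type*} [Fintype E] [DecidableEq E]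

/-- The Fourier–Walsh coefficients of a function on the cube. -/
noncomputable def coeff (f : (E → Bool) → ℝ) (S : Finset E) : ℝ := avg fun x => f x * chi S x

omit [DecidableEq E] in
lemma prod_one_add_mul_sgn (t : E → ℝ) (x y : E → Bool) :
    ∏ e, (1 + t e * (sgn (x e) * sgn (y e))) = ∑ S, (∏ e ∈ S, t e) * (chi S x * chi S y) := by
  rw [prod_one_add, powerset_univ]
  simp [chi, prod_mul_distrib]

lemma avg_mul_prod_one_add (f : (E → Bool) → ℝ) (t : E → ℝ) (x : E → Bool) :
    avg (fun y => f y * ∏ e, (1 + t e * (sgn (x e) * sgn (y e))))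
      = walsh (fun S => coeff f S * ∏ e ∈ S, t e) x := by
  simp only [prod_one_add_mul_sgn, mul_sum]
  rw [avg_sum]
  refine sum_congr rfl fun S _ => ?_
  rw [show coeff f S * (∏ e ∈ S, t e) * chi S x = (∏ e ∈ S, t e) * chi S x * coeff f S by ring, coeff,
    ← avg_const_mul]
  congr 1; ext y; ring

lemma avg_mul_walsh (f : (E → Bool) → ℝ) (a : Finset E → ℝ) :
    avg (fun x => f x * walsh a x) = ∑ S, coeff f S * a S := by
  simp only [walsh, mul_sum]
  rw [avg_sum]
  refine sum_congr rfl fun S _ => ?_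
  rw [coeff, mul_comm, ← avg_const_mul]
  congr 1; ext y; ring

lemma avg_mul_avg_mul_prod (f : (E → Bool) → ℝ) (t : E → ℝ) :
    avg (fun x => f x * avg (fun y => f y * ∏ e, (1 + t e * (sgn (x e) * sgn (y e)))))
      = ∑ S, coeff f S ^ 2 * ∏ e ∈ S, t e := by
  simp only [avg_mul_prod_one_add, avg_mul_walsh]
  exact sum_congr rfl fun S _ => by ring

omit [DecidableEq E] in
lemma prod_one_add_sgn_mul_sgn (x y : E → Bool) :
    ∏ e, (1 + 1 * (sgn (x e) * sgn (y e))) = if x = y then (2 : ℝ) ^ Fintype.card E else 0 := by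
  split_ifs with h
  · subst h
    rw [← Finset.card_univ, ← prod_const]
    exact prod_congr rfl fun e _ => by rw [sgn_mul_self]; norm_num
  · obtain ⟨e, he⟩ := Function.ne_iff.1 h
    refine prod_eq_zero (mem_univ e) ?_
    generalize x e = b at *; generalize y e = b' at *
    cases b <;> cases b' <;> simp_all [sgn]

lemma sum_coeff_sq (f : (E → Bool) → ℝ) : ∑ S, coeff f S ^ 2 = avg fun x => f x ^ 2 := by
  have := avg_mul_avg_mul_prod f fun _ => 1
  simp only [prod_one_add_sgn_mul_sgn, prod_const_one, mul_one] at this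
  rw [← this]
  congr 1; ext x
  simp only [avg, mul_ite, mul_zero]
  rw [sum_ite_eq, if_pos (mem_univ _), mul_div_assoc, div_self (by positivity)]
  ring

lemma coeff_empty (f : (E → Bool) → ℝ) : coeff f ∅ = avg f := by simp [coeff, chi]

/-- The discrete gradient in direction `e` of the noisy version of `f`. -/
noncomputable def noisyGrad (f : (E → Bool) → ℝ) (e : E) : (E → Bool) → ℝ :=
  walsh fun S => if e ∈ S then coeff f S * (1 / 2) ^ #S else 0

/-- The one-coordinate marginals of the noise around `x`. -/
noncomputable def noise (x : E → Bool) (e : E) (b : Bool) : ℝ :=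
  (1 + 1 / 2 * (sgn (x e) * sgn b)) / 2

/-- The logarithmic derivative of `noise`. -/
noncomputable def score (x : E → Bool) (e : E) (b : Bool) : ℝ :=
  (1 / 2 * (sgn (x e) * sgn b)) / (1 + 1 / 2 * (sgn (x e) * sgn b))

lemma noisyGrad_eq (f : (E → Bool) → ℝ) (e : E) (x : E → Bool) :
    noisyGrad f e x = ∑ y, weight (noise x) y * (score x e (y e) * f y) := by
  have h1 := avg_mul_prod_one_add f (fun _ => 1 / 2) x
  have h2 := avg_mul_prod_one_add f (fun i => if i = e then 0 else 1 / 2) x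
  have h3 : noisyGrad f e x = walsh (fun S => coeff f S * ∏ e ∈ S, (1 / 2)) x
      - walsh (fun S => coeff f S * ∏ i ∈ S, if i = e then 0 else 1 / 2) x := by
    simp only [noisyGrad, walsh, ← sum_sub_distrib]
    refine sum_congr rfl fun S _ => ?_
    split_ifs with h
    · rw [prod_eq_zero (f := fun i => if i = e then (0 : ℝ) else 1 / 2) h (if_pos rfl)]; simp
    · rw [prod_congr rfl (g := fun _ => (1 / 2 : ℝ)) fun i hi =>
        if_neg (show i ≠ e from fun h' => h (h' ▸ hi))]
      simp
  rw [h3, ← h1, ← h2]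
  simp only [avg]
  rw [← sub_div, ← sum_sub_distrib, sum_div]
  refine sum_congr rfl fun y _ => ?_
  have h4 : weight (noise x) y = (∏ i, (1 + 1 / 2 * (sgn (x i) * sgn (y i)))) / 2 ^ Fintype.card E := by
    simp only [weight, noise, prod_div_distrib, prod_const, Finset.card_univ]
  have h5 : ∏ i, (1 + (if i = e then 0 else 1 / 2) * (sgn (x i) * sgn (y i)))
      = (∏ i, (1 + 1 / 2 * (sgn (x i) * sgn (y i)))) / (1 + 1 / 2 * (sgn (x e) * sgn (y e))) := by
    have hne : (1 + 1 / 2 * (sgn (x e) * sgn (y e))) ≠ 0 := by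
      generalize x e = b; generalize y e = b'
      cases b <;> cases b' <;> norm_num [sgn]
    rw [← mul_prod_erase univ _ (mem_univ e), ← mul_prod_erase univ (a := e) (h := mem_univ e)
      (f := fun i => (1 + 1 / 2 * (sgn (x i) * sgn (y i)))), mul_div_cancel_left₀ _ hne]
    simp only [if_true, zero_mul, add_zero, one_mul]
    exact prod_congr rfl fun i hi => by rw [if_neg (ne_of_mem_erase hi)]
  rw [h5, h4, score]
  have hne : (1 + 1 / 2 * (sgn (x e) * sgn (y e))) ≠ 0 := by
    generalize x e = b; generalize y e = b'
    cases b <;> cases b' <;> norm_num [sgn]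
  generalize ∏ i, (1 + 1 / 2 * (sgn (x i) * sgn (y i))) = P
  generalize hD : 1 + 1 / 2 * (sgn (x e) * sgn (y e)) = D at hne ⊢
  rw [show 1 / 2 * (sgn (x e) * sgn (y e)) = D - 1 by rw [← hD]; ring]
  field_simp

lemma sum_weight_linearization {p r : E → Bool → ℝ} {A : E → ℝ} (hp : ∀ e, ∑ b, p e b = 1)
    (hp0 : ∀ e b, 0 ≤ p e b) (hr : ∀ e, ∑ b, p e b * r e b = 0)
    (hr2 : ∀ e, ∑ b, p e b * r e b ^ 2 = A e) (hA : ∑ e, A e ≤ 1)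
    {f : (E → Bool) → ℝ} (hf0 : ∀ x, 0 ≤ f x) (hf1 : ∀ x, f x ≤ 1) :
    |∑ y, weight p y * ((∏ e, (1 + r e (y e)) - 1 - ∑ e, r e (y e)) * f y)| ≤ ∑ e, A e := by
  have hA0 : ∀ e, 0 ≤ A e := fun e => by
    rw [← hr2]; exact sum_nonneg fun b _ => mul_nonneg (hp0 _ _) (sq_nonneg _)
  have hAs : 0 ≤ ∑ e, A e := sum_nonneg fun e _ => hA0 e
  set G : (E → Bool) → ℝ := fun y => ∏ e, (1 + r e (y e)) with hG
  set R : (E → Bool) → ℝ := fun y => ∑ e, r e (y e) with hR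
  have hw := weight_nonneg hp0
  have hGG : ∑ y, weight p y * (G y * G y) = ∏ e, (1 + A e) := by
    simp only [hG, ← prod_mul_distrib]
    rw [sum_weight_mul_prod hp univ (fun e b => (1 + r e b) * (1 + r e b))]
    refine prod_congr rfl fun e _ => ?_
    have h1 := hr e; have h2 := hp e; have h3 := hr2 e
    simp only [Fintype.sum_bool] at *
    linear_combination h2 + 2 * h1 + h3
  have hq : ∀ e, ∑ b, p e b * (1 + r e b) = 1 := fun e => by
    have h1 := hr e; have h2 := hp e
    simp only [Fintype.sum_bool] at *
    linear_combination h2 + h1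
  have hGw : ∀ y, weight p y * G y = weight (fun e b => p e b * (1 + r e b)) y := fun y => by
    simp only [weight, hG, prod_mul_distrib]
  have hG1 : ∑ y, weight p y * G y = 1 := by
    simp only [hGw]; exact sum_weight hq
  have hGR : ∑ y, weight p y * (G y * R y) = ∑ e, A e := by
    simp only [← mul_assoc, hGw, hR, mul_sum]
    rw [sum_comm]
    refine sum_congr rfl fun e _ => ?_
    rw [sum_weight_mul hq e (r e)]
    have h1 := hr e; have h3 := hr2 e
    simp only [Fintype.sum_bool] at *
    linear_combination h1 + h3
  have hR1 : ∑ y, weight p y * R y = 0 := by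
    simp only [hR, mul_sum]
    rw [sum_comm]
    exact sum_eq_zero fun e _ => by rw [sum_weight_mul hp e (r e), hr]
  have hRR : ∑ y, weight p y * (R y * R y) = ∑ e, A e := by
    simp only [hR, sum_mul_sum]
    simp only [mul_sum]
    rw [sum_comm]
    refine sum_congr rfl fun e _ => ?_
    rw [sum_comm, sum_eq_single e]
    · rw [sum_weight_mul hp e (fun b => r e b * r e b), ← hr2]
      exact sum_congr rfl fun b _ => by ring
    · intro i _ hi
      rw [sum_weight_mul_mul hp hi.symm r, hr, zero_mul]
    · simp
  have hsq : ∑ y, weight p y * (G y - 1 - R y) ^ 2 = ∏ e, (1 + A e) - 1 - ∑ e, A e := by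
    have h1 : ∀ y, weight p y * (G y - 1 - R y) ^ 2 = weight p y * (G y * G y) + weight p y
        + weight p y * (R y * R y) - 2 * (weight p y * G y) - 2 * (weight p y * (G y * R y))
        + 2 * (weight p y * R y) := fun y => by ring
    simp only [h1, sum_add_distrib, sum_sub_distrib, ← mul_sum, hGG, hG1, hGR, hR1, hRR,
      sum_weight hp]
    ring
  have hbound : ∏ e, (1 + A e) - 1 - ∑ e, A e ≤ (∑ e, A e) ^ 2 := by
    have h1 : ∏ e, (1 + A e) ≤ Real.exp (∑ e, A e) := by
      rw [Real.exp_sum]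
      exact prod_le_prod (fun e _ => by linarith [hA0 e]) fun e _ => by
        linarith [Real.add_one_le_exp (A e)]
    have h2 := (abs_le.1 (Real.abs_exp_sub_one_sub_id_le (x := ∑ e, A e)
      (by rwa [abs_of_nonneg hAs]))).2
    linarith
  have hff : ∑ y, weight p y * f y ^ 2 ≤ 1 := by
    rw [← sum_weight hp]
    exact sum_le_sum fun y _ => mul_le_of_le_one_right (hw y) (pow_le_one₀ (hf0 y) (hf1 y))
  refine abs_le_of_sq_le_sq ?_ hAs
  have hcs := sum_mul_sq_le_sq_mul_sq univ (fun y => √(weight p y) * (G y - 1 - R y))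
    (fun y => √(weight p y) * f y)
  simp only [mul_pow, Real.sq_sqrt (hw _)] at hcs
  have h1 : ∀ y, √(weight p y) * (G y - 1 - R y) * (√(weight p y) * f y)
      = weight p y * ((G y - 1 - R y) * f y) := fun y => by
    rw [mul_mul_mul_comm, Real.mul_self_sqrt (hw y)]
  simp only [h1] at hcs
  refine hcs.trans ?_
  rw [hsq]
  have h0 : 0 ≤ ∏ e, (1 + A e) - 1 - ∑ e, A e := by
    rw [← hsq]; exact sum_nonneg fun y _ => mul_nonneg (hw y) (sq_nonneg _)
  calc _ ≤ (∏ e, (1 + A e) - 1 - ∑ e, A e) * 1 := mul_le_mul_of_nonneg_left hff h0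
    _ ≤ _ := by rw [mul_one]; exact hbound

/-- The largest number, over all `v`, of coordinates in `I v` at which `x` and `y` differ. -/
def starDist {V : Type*} [Fintype V] (I : V → Finset E) (x y : E → Bool) : ℕ :=
  univ.sup fun v => #{e ∈ I v | x e ≠ y e}

omit [Fintype E] [DecidableEq E] in
lemma card_le_starDist {V : Type*} [Fintype V] (I : V → Finset E) (x y : E → Bool) (v : V) :
    #{e ∈ I v | x e ≠ y e} ≤ starDist I x y :=
  le_sup (f := fun v => #{e ∈ I v | x e ≠ y e}) (mem_univ v)

lemma sum_coupling_starDist_le {V : Type*} [Fintype V] (I : V → Finset E) {b : ℝ} (hb : 2 ≤ b)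
    (hV : (Fintype.card V : ℝ) ≤ b ^ 4) (hI : ∀ v, (#(I v) : ℝ) ≤ b ^ 4)
    {κ : E → Bool → Bool → ℝ} (hκ0 : ∀ e i j, 0 ≤ κ e i j) (hκ1 : ∀ e, ∑ i, ∑ j, κ e i j = 1)
    (hκ : ∀ e, κ e true false + κ e false true ≤ 1 / b ^ 5) :
    ∑ x, ∑ y, (∏ e, κ e (x e) (y e)) * (starDist I x y : ℝ) ≤ 7 := by
  have hb0 : 0 < b := by linarith
  have hpow : ∀ z : ℕ, (z : ℝ) ≤ 4 + b ^ z / b ^ 4 := fun z => by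
    rcases le_total z 4 with h | h
    · have : (z : ℝ) ≤ 4 := by exact_mod_cast h
      have : 0 ≤ b ^ z / b ^ 4 := by positivity
      linarith
    · obtain ⟨k, rfl⟩ := Nat.exists_eq_add_of_le h
      rw [pow_add, mul_div_cancel_left₀ _ (by positivity)]
      have h1 := one_add_mul_le_pow (a := b - 1) (by linarith) k
      have hk : (0 : ℝ) ≤ k := k.cast_nonneg
      rw [add_sub_cancel] at h1
      push_cast
      nlinarith
  have hdist : ∀ x y : E → Bool,
      (starDist I x y : ℝ) ≤ 4 + (∑ v, b ^ #{e ∈ I v | x e ≠ y e}) / b ^ 4 := fun x y => by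
    have h0 : 0 ≤ (∑ v, b ^ #{e ∈ I v | x e ≠ y e}) / b ^ 4 :=
      div_nonneg (sum_nonneg fun v _ => by positivity) (by positivity)
    rcases isEmpty_or_nonempty V with hV | hV
    · have : starDist I x y = 0 := by simp [starDist]
      rw [this]; push_cast; linarith
    · obtain ⟨v, -, hv⟩ := exists_mem_eq_sup univ univ_nonempty fun v => #{e ∈ I v | x e ≠ y e}
      rw [starDist, hv]
      refine (hpow _).trans ?_
      gcongr
      exact single_le_sum (f := fun v => b ^ #{e ∈ I v | x e ≠ y e})
        (fun v _ => by positivity) (mem_univ v)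
  have hw : ∀ x y : E → Bool, 0 ≤ ∏ e, κ e (x e) (y e) := fun x y => prod_nonneg fun e _ => hκ0 _ _ _
  have htot : ∑ x : E → Bool, ∑ y : E → Bool, ∏ e, κ e (x e) (y e) = 1 := by
    rw [sum_sum_prod_eq_prod_sum_sum]; exact prod_eq_one fun e _ => hκ1 e
  have hv : ∀ v, ∑ x : E → Bool, ∑ y : E → Bool,
      (∏ e, κ e (x e) (y e)) * b ^ #{e ∈ I v | x e ≠ y e} ≤ 3 := fun v => by
    have h1 : ∀ x y : E → Bool, (∏ e, κ e (x e) (y e)) * b ^ #{e ∈ I v | x e ≠ y e}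
        = ∏ e, κ e (x e) (y e) * (if e ∈ I v then if x e ≠ y e then b else 1 else 1) :=
      fun x y => by
        rw [prod_mul_distrib, prod_ite_mem, univ_inter, prod_ite, prod_const, prod_const_one,
          mul_one]
    simp only [h1]
    rw [sum_sum_prod_eq_prod_sum_sum
      (fun e i j => κ e i j * (if e ∈ I v then if i ≠ j then b else 1 else 1))]
    have h2 : ∀ e, ∑ i, ∑ j, κ e i j * (if e ∈ I v then if i ≠ j then b else 1 else 1)
        ≤ if e ∈ I v then Real.exp (1 / b ^ 4) else 1 := fun e => by
      have h3 := hκ1 e; have h4 := hκ e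
      simp only [Fintype.sum_bool] at *
      by_cases h : e ∈ I v
      · have h5 := Real.add_one_le_exp (1 / b ^ 4)
        have h6 : (b - 1) * (κ e true false + κ e false true) ≤ 1 / b ^ 4 := by
          calc _ ≤ b * (1 / b ^ 5) := by
                apply mul_le_mul (by linarith) h4 (add_nonneg (hκ0 _ _ _) (hκ0 _ _ _)) hb0.le
            _ = _ := by field_simp
        simp only [h, if_true, ne_eq, not_true_eq_false, if_false, reduceCtorEq, not_false_eq_true]
        linarith
      · simp only [h, if_false]; linarith
    calc _ ≤ ∏ e, (if e ∈ I v then Real.exp (1 / b ^ 4) else 1) := by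
          refine prod_le_prod (fun e _ => ?_) fun e _ => h2 e
          refine sum_nonneg fun i _ => sum_nonneg fun j _ => mul_nonneg (hκ0 _ _ _) ?_
          split_ifs <;> linarith
      _ = Real.exp (#(I v) * (1 / b ^ 4)) := by
          rw [prod_ite_mem, univ_inter, prod_const, ← Real.exp_nat_mul]
      _ ≤ Real.exp 1 := by
          gcongr
          rw [mul_one_div, div_le_one (by positivity)]
          exact hI v
      _ ≤ 3 := by linarith [Real.exp_one_lt_d9]
  calc _ ≤ ∑ x : E → Bool, ∑ y : E → Bool, (∏ e, κ e (x e) (y e))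
        * (4 + (∑ v, b ^ #{e ∈ I v | x e ≠ y e}) / b ^ 4) :=
        sum_le_sum fun x _ => sum_le_sum fun y _ => mul_le_mul_of_nonneg_left (hdist x y) (hw x y)
    _ = 4 + (∑ v, ∑ x : E → Bool, ∑ y : E → Bool,
          (∏ e, κ e (x e) (y e)) * b ^ #{e ∈ I v | x e ≠ y e}) / b ^ 4 := by
        rw [sum_comm (s := (univ : Finset V))]
        simp only [sum_comm (s := (univ : Finset V)), ← mul_sum, mul_add, sum_add_distrib,
          ← sum_mul, htot, ← mul_div_assoc, ← sum_div]
        ring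
    _ ≤ 4 + (∑ v : V, 3) / b ^ 4 := by gcongr with v; exact hv v
    _ ≤ 7 := by
        rw [sum_const, Finset.card_univ, nsmul_eq_mul]
        have : (Fintype.card V * 3 : ℝ) / b ^ 4 ≤ 3 := by
          rw [div_le_iff₀ (by positivity)]; linarith
        linarith

end Noise

section Gradient

variable {E : Type*} [Fintype E] [DecidableEq E]

/-- A coupling of the noise around `x` with its tilt by `1 + θ τ score`, where `τ = ±1`. -/
noncomputable def tiltCoupling (θ : ℝ) (P : E → Prop) [DecidablePred P] (x : E → Bool) (e : E)
    (i j : Bool) : ℝ :=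
  if i = j then
    if i = x e then 3 / 4 - (if P e then 0 else θ / 4) else 1 / 4 - (if P e then θ / 4 else 0)
  else if i = x e then (if P e then 0 else θ / 4) else (if P e then θ / 4 else 0)

lemma sum_abs_noisyGrad_le {V : Type*} [Fintype V] (I : V → Finset E) {b T : ℝ} (hb : 2 ≤ b)
    (hV : (Fintype.card V : ℝ) ≤ b ^ 4) (hI : ∀ v, (#(I v) : ℝ) ≤ b ^ 4)
    (hE : (Fintype.card E : ℝ) ≤ b ^ 8) (hT : 0 < T) {f : (E → Bool) → ℝ}
    (hf0 : ∀ x, 0 ≤ f x) (hf1 : ∀ x, f x ≤ 1)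
    (hf : ∀ x y, |f x - f y| ≤ starDist I x y / T) (x : E → Bool) :
    ∑ e, |noisyGrad f e x| ≤ b ^ 5 * (7 / T + 1 / b ^ 2) := by
  classical
  have hb0 : 0 < b := by linarith
  set θ : ℝ := 1 / b ^ 5 with hθ
  have hθ0 : 0 < θ := by positivity
  have hθ1 : θ ≤ 1 := by
    rw [hθ, div_le_one (by positivity)]; exact one_le_pow₀ (by linarith)
  obtain ⟨P, hP⟩ : ∃ P : E → Prop, ∀ e,
      |noisyGrad f e x| = (if P e then 1 else -1) * noisyGrad f e x := by
    refine ⟨fun e => 0 ≤ noisyGrad f e x, fun e => ?_⟩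
    split_ifs with h
    · rw [one_mul, abs_of_nonneg h]
    · rw [abs_of_neg (not_le.1 h)]; ring
  set κ := tiltCoupling θ P x with hκ
  set r : E → Bool → ℝ := fun e b => θ * (if P e then 1 else -1) * score x e b with hr
  set A : E → ℝ := fun _ => θ ^ 2 / 3 with hA
  have hp1 : ∀ e, ∑ b, noise x e b = 1 := fun e => by
    simp only [Fintype.sum_bool, noise]
    cases x e <;> norm_num [sgn]
  have hp0 : ∀ e b, 0 ≤ noise x e b := fun e b => by
    simp only [noise]
    cases x e <;> cases b <;> norm_num [sgn]
  have hr1 : ∀ e, ∑ b, noise x e b * r e b = 0 := fun e => by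
    simp only [Fintype.sum_bool, noise, hr, score]
    cases x e <;> norm_num [sgn] <;> ring_nf
  have hr2 : ∀ e, ∑ b, noise x e b * r e b ^ 2 = A e := fun e => by
    simp only [Fintype.sum_bool, noise, hr, score, hA]
    cases x e <;> by_cases h : P e <;> simp only [h, if_true, if_false] <;> norm_num [sgn] <;> ring
  have hAs : ∑ e, A e ≤ 1 / b ^ 2 := by
    simp only [hA, sum_const, Finset.card_univ, nsmul_eq_mul]
    calc _ ≤ b ^ 8 * (θ ^ 2 / 3) := by gcongr
      _ = 1 / b ^ 2 / 3 := by rw [hθ]; field_simp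
      _ ≤ 1 / b ^ 2 := div_le_self (by positivity) (by norm_num)
  have hAs1 : ∑ e, A e ≤ 1 := hAs.trans (by
    rw [div_le_one (by positivity)]; exact one_le_pow₀ (by linarith))
  have hlin := sum_weight_linearization hp1 hp0 hr1 hr2 hAs1 hf0 hf1
  have hgrad : ∑ y, weight (noise x) y * ((∑ e, r e (y e)) * f y)
      = θ * ∑ e, |noisyGrad f e x| := by
    simp only [sum_mul, mul_sum]
    rw [sum_comm]
    refine sum_congr rfl fun e _ => ?_
    rw [hP, noisyGrad_eq, mul_sum, mul_sum]
    exact sum_congr rfl fun y _ => by simp only [hr]; ring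
  have hκ0 : ∀ e i j, 0 ≤ κ e i j := fun e i j => by
    simp only [hκ, tiltCoupling]
    split_ifs <;> linarith
  have hκl : ∀ e i, ∑ j, κ e i j = noise x e i := fun e i => by
    simp only [hκ, tiltCoupling, noise, Fintype.sum_bool]
    cases x e <;> cases i <;> by_cases h : P e <;> simp [h, sgn] <;> ring
  have hκr : ∀ e j, ∑ i, κ e i j = noise x e j * (1 + r e j) := fun e j => by
    simp only [hκ, tiltCoupling, noise, hr, score, Fintype.sum_bool]
    cases x e <;> cases j <;> by_cases h : P e <;> simp [h, sgn] <;> ring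
  have hκ1 : ∀ e, ∑ i, ∑ j, κ e i j = 1 := fun e => by simp only [hκl, hp1]
  have hκd : ∀ e, κ e true false + κ e false true ≤ 1 / b ^ 5 := fun e => by
    rw [← hθ]
    simp only [hκ, tiltCoupling]
    cases x e <;> by_cases h : P e <;> simp [h] <;> linarith
  have hw : ∀ y z : E → Bool, 0 ≤ ∏ e, κ e (y e) (z e) :=
    fun y z => prod_nonneg fun e _ => hκ0 _ _ _
  have hcoup := sum_coupling_starDist_le I hb hV hI hκ0 hκ1 hκd
  have hml : ∑ y : E → Bool, ∑ z : E → Bool, (∏ e, κ e (y e) (z e)) * f y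
      = ∑ y, weight (noise x) y * f y := by
    refine sum_congr rfl fun y _ => ?_
    rw [← sum_mul, sum_prod_eq_prod_sum fun e j => κ e (y e) j]
    simp only [hκl, weight]
  have hmr : ∑ y : E → Bool, ∑ z : E → Bool, (∏ e, κ e (y e) (z e)) * f z
      = ∑ y, weight (noise x) y * ((∏ e, (1 + r e (y e))) * f y) := by
    rw [sum_comm]
    refine sum_congr rfl fun z _ => ?_
    rw [← sum_mul, sum_prod_eq_prod_sum fun e i => κ e i (z e)]
    simp only [hκr, weight, prod_mul_distrib]
    ring
  have hdiff : ∑ y : E → Bool, ∑ z : E → Bool, (∏ e, κ e (y e) (z e)) * f z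
      - ∑ y : E → Bool, ∑ z : E → Bool, (∏ e, κ e (y e) (z e)) * f y ≤ 7 / T := by
    rw [← sum_sub_distrib]
    simp only [← sum_sub_distrib, ← mul_sub]
    calc _ ≤ ∑ y : E → Bool, ∑ z : E → Bool, (∏ e, κ e (y e) (z e)) * (starDist I y z / T) :=
          sum_le_sum fun y _ => sum_le_sum fun z _ => mul_le_mul_of_nonneg_left
            ((neg_le_abs _).trans' (by linarith) |>.trans (hf y z)) (hw y z)
      _ = (∑ y : E → Bool, ∑ z : E → Bool, (∏ e, κ e (y e) (z e)) * (starDist I y z : ℝ)) / T := by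
          simp only [← mul_div_assoc, ← sum_div]
      _ ≤ 7 / T := by gcongr
  have hexp : ∑ y, weight (noise x) y * ((∏ e, (1 + r e (y e)) - 1 - ∑ e, r e (y e)) * f y)
      = ∑ y, weight (noise x) y * ((∏ e, (1 + r e (y e))) * f y) - ∑ y, weight (noise x) y * f y
        - ∑ y, weight (noise x) y * ((∑ e, r e (y e)) * f y) := by
    simp only [← sum_sub_distrib]
    exact sum_congr rfl fun y _ => by ring
  rw [hexp, hgrad, ← hml, ← hmr] at hlin
  have h1 : θ * ∑ e, |noisyGrad f e x| ≤ 7 / T + 1 / b ^ 2 := by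
    linarith [(abs_le.1 hlin).1]
  rw [hθ, one_div, inv_mul_le_iff₀ (by positivity)] at h1
  exact h1

end Gradient

section Low

variable {E : Type*} [Fintype E] [DecidableEq E]

lemma sum_comp_perm (π : Equiv.Perm E) (g : (E → Bool) → ℝ) :
    ∑ x : E → Bool, g (x ∘ π) = ∑ x, g x :=
  (π.symm.arrowCongr (Equiv.refl Bool)).sum_comp g

lemma avg_comp_perm (π : Equiv.Perm E) (g : (E → Bool) → ℝ) :
    avg (fun x => g (x ∘ π)) = avg g := by
  rw [avg, sum_comp_perm, avg]

lemma noisyGrad_comp_perm {f : (E → Bool) → ℝ} {π : Equiv.Perm E}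
    (hf : ∀ x : E → Bool, f (x ∘ π) = f x) (e : E) (x : E → Bool) :
    noisyGrad f e (x ∘ π) = noisyGrad f (π e) x := by
  rw [noisyGrad_eq, noisyGrad_eq, ← sum_comp_perm π]
  refine sum_congr rfl fun y _ => ?_
  rw [hf]
  congr 1
  simp only [weight, Function.comp_apply]
  exact Equiv.prod_comp π fun i => noise x i (y i)

lemma sum_low_coeff_sq_le [Nonempty E] {f : (E → Bool) → ℝ} (hf0 : ∀ x, 0 ≤ f x)
    (hf1 : ∀ x, f x ≤ 1)
    (hsymm : ∀ e e', ∃ π : Equiv.Perm E, π e = e' ∧ ∀ x : E → Bool, f (x ∘ π) = f x)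
    {B : ℝ} (hB : ∀ x, ∑ e, |noisyGrad f e x| ≤ B) (k : ℕ) :
    ∑ S with 1 ≤ #S ∧ #S < k, coeff f S ^ 2 ≤ 16 ^ k * (B / √(Fintype.card E)) := by
  set N : ℝ := (Fintype.card E : ℝ) with hN
  have hN0 : 0 < N := by rw [hN]; exact_mod_cast Fintype.card_pos
  set X : E → ℝ := fun e => ∑ S, (if e ∈ S then coeff f S * (1 / 2) ^ #S else 0) ^ 2 with hX
  have hX0 : ∀ e, 0 ≤ X e := fun e => sum_nonneg fun S _ => sq_nonneg _
  have hswap : ∀ c : Finset E → ℝ, ∑ e, ∑ S, (if e ∈ S then c S else 0) = ∑ S, #S * c S :=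
    fun c => by
      rw [sum_comm]
      refine sum_congr rfl fun S _ => ?_
      rw [sum_ite_mem, univ_inter, sum_const, nsmul_eq_mul]
  have hXs : ∑ e, X e ≤ 1 := by
    have h1 : ∀ e, X e = ∑ S, if e ∈ S then coeff f S ^ 2 * (1 / 4) ^ #S else 0 := fun e =>
      sum_congr rfl fun S _ => by
        split_ifs
        · rw [mul_pow, ← pow_mul, mul_comm _ 2, pow_mul]; norm_num
        · simp
    simp only [h1]
    rw [hswap fun S => coeff f S ^ 2 * (1 / 4) ^ #S]
    calc _ ≤ ∑ S, coeff f S ^ 2 := sum_le_sum fun S _ => by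
          have h2 : (#S : ℝ) * (1 / 4) ^ #S ≤ 1 := by
            rw [one_div, inv_pow, ← div_eq_mul_inv, div_le_one (by positivity)]
            have h3 : #S < 4 ^ #S := Nat.lt_pow_self (by norm_num)
            exact_mod_cast h3.le
          nlinarith [sq_nonneg (coeff f S)]
      _ = avg fun x => f x ^ 2 := sum_coeff_sq f
      _ ≤ avg fun _ => 1 := avg_mono fun x => pow_le_one₀ (hf0 x) (hf1 x)
      _ = 1 := avg_const 1
  have hsqrt : ∑ e, √(X e) ≤ √N := by
    have hs : 0 < √N := Real.sqrt_pos.2 hN0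
    have h1 : ∀ e, √(X e) ≤ (X e * √N + 1 / √N) / 2 := fun e => by
      have h2 := two_mul_le_add_sq (√(X e) * √N) 1
      have h3 := Real.sq_sqrt (hX0 e)
      have h4 := Real.sq_sqrt hN0.le
      rw [mul_pow, h3] at h2
      have : (X e * √N + 1 / √N) / 2 = (X e * √N ^ 2 + 1 ^ 2) / (2 * √N) := by field_simp
      rw [this, le_div_iff₀ (by positivity)]
      linarith
    calc _ ≤ ∑ e, (X e * √N + 1 / √N) / 2 := sum_le_sum fun e _ => h1 e
      _ = ((∑ e, X e) * √N + N / √N) / 2 := by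
          rw [← sum_div, sum_add_distrib, sum_mul, sum_const, Finset.card_univ, nsmul_eq_mul, hN]
          ring
      _ ≤ (1 * √N + N / √N) / 2 := by gcongr
      _ = √N := by rw [Real.div_sqrt]; ring
  have hg : ∀ e e', avg (fun x => |noisyGrad f e x|) = avg fun x => |noisyGrad f e' x| :=
    fun e e' => by
      obtain ⟨π, rfl, hπ⟩ := hsymm e e'
      simp only [← noisyGrad_comp_perm hπ]
      exact (avg_comp_perm π _).symm
  have hgB : ∀ e, avg (fun x => |noisyGrad f e x|) ≤ B / N := fun e => by
    rw [le_div_iff₀ hN0]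
    calc _ = ∑ e', avg (fun x => |noisyGrad f e' x|) := by
          rw [sum_congr rfl fun e' _ => hg e' e, sum_const, Finset.card_univ, nsmul_eq_mul,
            mul_comm]
      _ = avg fun x => ∑ e', |noisyGrad f e' x| := (avg_sum _ _).symm
      _ ≤ avg fun _ => B := avg_mono hB
      _ = B := avg_const B
  have hB0 : 0 ≤ B := (sum_nonneg fun e _ => abs_nonneg _).trans (hB fun _ => true)
  have hmain : ∑ S, #S * (coeff f S ^ 2 * (1 / 16) ^ #S) ≤ B / √N := by
    rw [← hswap fun S => coeff f S ^ 2 * (1 / 16) ^ #S]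
    calc _ ≤ ∑ e, B / N * √(X e) := sum_le_sum fun e _ => by
          refine le_trans (le_of_eq ?_) ((sum_sq_mul_pow_le
            fun S => if e ∈ S then coeff f S * (1 / 2) ^ #S else 0).trans
              (mul_le_mul_of_nonneg_right (hgB e) (Real.sqrt_nonneg _)))
          refine sum_congr rfl fun S _ => ?_
          split_ifs
          · rw [mul_pow, ← pow_mul, mul_comm _ 2, pow_mul, mul_assoc, ← mul_pow]; norm_num
          · simp
      _ = B / N * ∑ e, √(X e) := (mul_sum _ _ _).symm
      _ ≤ B / N * √N := by gcongr
      _ = B / √N := by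
          rw [div_mul_eq_mul_div, div_eq_div_iff hN0.ne' (Real.sqrt_pos.2 hN0).ne', mul_assoc,
            Real.mul_self_sqrt hN0.le]
  calc _ ≤ ∑ S with 1 ≤ #S ∧ #S < k, 16 ^ k * (#S * (coeff f S ^ 2 * (1 / 16) ^ #S)) := by
        refine sum_le_sum fun S hS => ?_
        obtain ⟨h1, h2⟩ := (mem_filter.1 hS).2
        have h3 : (1 : ℝ) ≤ 16 ^ k * (#S * (1 / 16) ^ #S) := by
          rw [one_div, inv_pow, mul_left_comm, ← div_eq_mul_inv]
          have h4 : (1 : ℝ) ≤ 16 ^ k / 16 ^ #S :=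
            (one_le_div (by positivity)).2 (pow_le_pow_right₀ (by norm_num) h2.le)
          have h5 : (1 : ℝ) ≤ #S := by exact_mod_cast h1
          nlinarith
        nlinarith [sq_nonneg (coeff f S)]
    _ ≤ ∑ S, 16 ^ k * (#S * (coeff f S ^ 2 * (1 / 16) ^ #S)) :=
        sum_le_sum_of_subset_of_nonneg (subset_univ _) fun S _ _ => by positivity
    _ ≤ 16 ^ k * (B / √N) := by rw [← mul_sum]; gcongr

end Low

section High

variable {E V : Type*} [Fintype E] [DecidableEq E] [Fintype V]

lemma sum_coeff_sq_meeting_le (I : V → Finset E) {M : Finset E} (hM : ∀ v, #{e ∈ I v | e ∈ M} ≤ 1)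
    {f g : (E → Bool) → ℝ} (hfg : ∀ x y, starDist I x y ≤ 1 → (f x - f y) ^ 2 ≤ g x + g y) :
    ∑ S, coeff f S ^ 2 * (if ∃ e ∈ S, e ∈ M then 1 else 0) ≤ avg g := by
  set t : E → ℝ := fun e => if e ∈ M then 0 else 1 with ht
  set K : (E → Bool) → (E → Bool) → ℝ := fun x y => ∏ e, (1 + t e * (sgn (x e) * sgn (y e)))
    with hK
  have hKsymm : ∀ x y, K x y = K y x := fun x y => by simp only [hK, mul_comm (sgn (x _))]
  have hK0 : ∀ x y, 0 ≤ K x y := fun x y => prod_nonneg fun e _ => by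
    simp only [ht]
    generalize x e = b; generalize y e = b'
    split_ifs <;> cases b <;> cases b' <;> norm_num [sgn]
  have hKdist : ∀ x y, K x y ≠ 0 → starDist I x y ≤ 1 := fun x y hxy => by
    refine Finset.sup_le fun v _ => (card_le_card fun e he => ?_).trans (hM v)
    rw [mem_filter] at he ⊢
    refine ⟨he.1, ?_⟩
    by_contra h
    refine prod_ne_zero_iff.1 hxy e (mem_univ e) ?_
    have h2 := he.2
    simp only [ht, if_neg h]
    generalize x e = b at *; generalize y e = b' at *
    cases b <;> cases b' <;> simp_all [sgn]
  have hK1 : ∀ x, avg (K x) = 1 := fun x => by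
    rw [avg, hK]
    simp only
    rw [sum_prod_eq_prod_sum fun e b => 1 + t e * (sgn (x e) * sgn b), ← Finset.card_univ,
      ← prod_const, ← prod_div_distrib]
    refine prod_eq_one fun e _ => ?_
    simp only [Fintype.sum_bool, sgn]
    norm_num
    ring
  have hcomm : ∀ h : (E → Bool) → (E → Bool) → ℝ,
      avg (fun x => avg fun y => h x y) = avg fun y => avg fun x => h x y := fun h => by
    simp only [avg, ← sum_div]; rw [sum_comm]
  have h1 : ∀ S, coeff f S ^ 2 * (if ∃ e ∈ S, e ∈ M then 1 else 0)
      = coeff f S ^ 2 - coeff f S ^ 2 * ∏ e ∈ S, t e := fun S => by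
    split_ifs with h
    · obtain ⟨e, he, heM⟩ := h
      rw [prod_eq_zero he (by simp [ht, heM])]; ring
    · rw [prod_eq_one fun e he => ?_]
      · ring
      · simp only [ht]
        exact if_neg fun h' => h ⟨e, he, h'⟩
  have hx2 : ∀ u : (E → Bool) → ℝ, avg (fun x => avg fun y => K x y * u x) = avg u := fun u => by
    refine congrArg avg (funext fun x => ?_)
    simp only [mul_comm (K x _)]
    rw [avg_const_mul, hK1, mul_one]
  have hy2 : ∀ u : (E → Bool) → ℝ, avg (fun x => avg fun y => K x y * u y) = avg u := fun u => by
    rw [hcomm, ← hx2 u]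
    exact congrArg avg (funext fun x => congrArg avg (funext fun y => by rw [hKsymm]))
  simp only [h1, sum_sub_distrib]
  rw [sum_coeff_sq, ← avg_mul_avg_mul_prod]
  have hxy : avg (fun x => f x * avg fun y => f y * K x y)
      = avg fun x => avg fun y => K x y * (f x * f y) := by
    refine congrArg avg (funext fun x => ?_)
    rw [← avg_const_mul]
    exact congrArg avg (funext fun y => by ring)
  change _ - avg (fun x => f x * avg fun y => f y * K x y) ≤ _
  have hle : avg (fun x => avg fun y => K x y * (f x ^ 2 + f y ^ 2 + (-2) * (f x * f y)))
      ≤ avg fun x => avg fun y => K x y * (g x + g y) := by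
    refine avg_mono fun x => avg_mono fun y => ?_
    rcases eq_or_ne (K x y) 0 with h | h
    · simp [h]
    · refine mul_le_mul_of_nonneg_left ?_ (hK0 x y)
      linarith [hfg x y (hKdist x y h)]
  simp only [mul_add, avg_add, mul_left_comm (K _ _) (-2), avg_const_mul] at hle
  rw [hx2 fun x => f x ^ 2, hy2 fun x => f x ^ 2, hx2 g, hy2 g] at hle
  rw [hxy]
  linarith

/-- The edges of `R` sharing no vertex with another edge of `R`. -/
def isolated (I : V → Finset E) [DecidableRel fun e e' => ∃ v, e ∈ I v ∧ e' ∈ I v]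
    (R : E → Bool) : Finset E :=
  {e | R e ∧ ∀ e', e' ≠ e → (∃ v, e ∈ I v ∧ e' ∈ I v) → R e' = false}

omit [Fintype V] in
lemma card_filter_isolated_le (I : V → Finset E)
    [DecidableRel fun e e' => ∃ v, e ∈ I v ∧ e' ∈ I v] (R : E → Bool) (v : V) :
    #{e ∈ I v | e ∈ isolated I R} ≤ 1 := by
  refine card_le_one.2 fun e he e' he' => ?_
  simp only [isolated, mem_filter, mem_univ, true_and] at he he'
  by_contra h
  have := he.2.2 e' (Ne.symm h) ⟨v, he.1, he'.1⟩
  simp_all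

omit [Fintype V] in
lemma le_sum_weight_isolated (I : V → Finset E)
    [DecidableRel fun e e' => ∃ v, e ∈ I v ∧ e' ∈ I v] {D : ℕ} (hD0 : 0 < D)
    (hD : ∀ e, #{e' | e' ≠ e ∧ ∃ v, e ∈ I v ∧ e' ∈ I v} ≤ D) {S : Finset E} (hS : 2 * #S ≤ D) :
    (#S : ℝ) / (8 * D) ≤ ∑ R, weight (fun (_ : E) b => if b then 1 / (2 * D : ℝ) else 1 - 1 / (2 * D)) R
      * (if ∃ e ∈ S, e ∈ isolated I R then 1 else 0) := by
  set s : ℝ := 1 / (2 * D) with hs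
  have hDr : (1 : ℝ) ≤ D := by exact_mod_cast hD0
  have hs0 : 0 < s := by positivity
  have hs1 : s ≤ 1 := by rw [hs, div_le_one (by positivity)]; linarith
  set p : E → Bool → ℝ := fun _ b => if b then s else 1 - s with hp
  have hp1 : ∀ e, ∑ b, p e b = 1 := fun e => by simp [hp]
  have hp0 : ∀ e b, 0 ≤ p e b := fun e b => by simp only [hp]; split_ifs <;> linarith
  have hw := weight_nonneg hp0
  set u : Bool → ℝ := fun b => if b then 1 else 0 with hu
  have hu0 : ∀ b, 0 ≤ u b := fun b => by simp only [hu]; split_ifs <;> norm_num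
  have hE1 : ∀ e, ∑ R, weight p R * u (R e) = s := fun e => by
    rw [sum_weight_mul hp1]; simp [hp, hu]
  have hE2 : ∀ e e', e' ≠ e → ∑ R, weight p R * (u (R e) * u (R e')) = s * s := fun e e' h => by
    rw [sum_weight_mul_mul hp1 h.symm fun _ => u]; simp [hp, hu]
  set F : E → Finset E := fun e => {e' | e' ≠ e ∧ ∃ v, e ∈ I v ∧ e' ∈ I v} with hF
  have hpt : ∀ R : E → Bool, ∑ e ∈ S, u (R e) - ∑ e ∈ S, ∑ e' ∈ F e, u (R e) * u (R e')
      - ∑ e ∈ S, ∑ e' ∈ S.erase e, u (R e) * u (R e')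
      ≤ if ∃ e ∈ S, e ∈ isolated I R then 1 else 0 := fun R => by
    have hF0 : ∀ e, 0 ≤ ∑ e' ∈ F e, u (R e) * u (R e') :=
      fun e => sum_nonneg fun e' _ => mul_nonneg (hu0 _) (hu0 _)
    have hS0 : 0 ≤ ∑ e ∈ S, ∑ e' ∈ S.erase e, u (R e) * u (R e') :=
      sum_nonneg fun e _ => sum_nonneg fun e' _ => mul_nonneg (hu0 _) (hu0 _)
    split_ifs with h
    · have h1 : ∑ e ∈ S, ∑ e' ∈ S.erase e, u (R e) * u (R e')
          = (∑ e ∈ S, u (R e)) ^ 2 - ∑ e ∈ S, u (R e) := by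
        rw [sq, sum_mul_sum, ← sum_sub_distrib]
        refine sum_congr rfl fun e he => ?_
        rw [← add_sum_erase _ _ he]
        have : u (R e) * u (R e) = u (R e) := by cases R e <;> simp [hu]
        linarith
      have h2 : 0 ≤ ∑ e ∈ S, ∑ e' ∈ F e, u (R e) * u (R e') := sum_nonneg fun e _ => hF0 e
      rw [h1]
      nlinarith [sq_nonneg (∑ e ∈ S, u (R e) - 1)]
    · have h1 : ∑ e ∈ S, u (R e) ≤ ∑ e ∈ S, ∑ e' ∈ F e, u (R e) * u (R e') := by
        refine sum_le_sum fun e he => ?_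
        by_cases hR : R e = true
        · have h2 : ¬ e ∈ isolated I R := fun h' => h ⟨e, he, h'⟩
          simp only [isolated, mem_filter, mem_univ, true_and, hR, not_forall] at h2
          obtain ⟨e', h3, h4, h5⟩ := h2
          refine le_trans ?_ (single_le_sum (f := fun e' => u (R e) * u (R e'))
            (fun e' _ => mul_nonneg (hu0 _) (hu0 _))
            (show e' ∈ F e by simp only [hF, mem_filter, mem_univ, true_and]; exact ⟨h3, h4⟩))
          simp [hu, hR, h5]
        · refine le_trans (le_of_eq ?_) (hF0 e)
          simp [hu, hR]
      linarith
  calc (#S : ℝ) / (8 * D) ≤ #S * s - #S * D * (s * s) - #S * #S * (s * s) := by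
        have h1 : (2 * #S : ℝ) ≤ D := by exact_mod_cast hS
        have h2 : (#S : ℝ) * s ≤ 1 / 4 := by
          rw [hs, mul_one_div, div_le_iff₀ (by positivity)]; linarith
        have h3 : (D : ℝ) * s = 1 / 2 := by rw [hs]; field_simp
        have h4 : (#S : ℝ) / (8 * D) = #S * s / 4 := by rw [hs]; field_simp; ring
        have h5 : (0 : ℝ) ≤ #S * s := by positivity
        rw [h4]
        calc #S * s / 4 = #S * s * (1 - 1 / 2 - 1 / 4) := by ring
          _ ≤ #S * s * (1 - D * s - #S * s) := by
            refine mul_le_mul_of_nonneg_left ?_ h5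
            linarith
          _ = _ := by ring
    _ ≤ ∑ R, weight p R * (∑ e ∈ S, u (R e) - ∑ e ∈ S, ∑ e' ∈ F e, u (R e) * u (R e')
      - ∑ e ∈ S, ∑ e' ∈ S.erase e, u (R e) * u (R e')) := by
        have h1 : ∑ R, weight p R * ∑ e ∈ S, u (R e) = #S * s := by
          simp only [mul_sum]
          rw [sum_comm, sum_congr rfl fun e _ => hE1 e, sum_const, nsmul_eq_mul]
        have h2 : ∀ G : E → Finset E, (∀ e, ∀ e' ∈ G e, e' ≠ e) →
            ∑ R, weight p R * ∑ e ∈ S, ∑ e' ∈ G e, u (R e) * u (R e')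
              = ∑ e ∈ S, #(G e) * (s * s) := fun G hG => by
          simp only [mul_sum]
          rw [sum_comm]
          refine sum_congr rfl fun e _ => ?_
          rw [sum_comm, sum_congr rfl fun e' he' => hE2 e e' (hG e e' he'), sum_const,
            nsmul_eq_mul]
        simp only [mul_sub, sum_sub_distrib]
        rw [h1, h2 F fun e e' he' => ((mem_filter.1 he').2).1,
          h2 (fun e => S.erase e) fun e e' he' => ne_of_mem_erase he']
        have h3 : ∑ e ∈ S, (#(F e) : ℝ) * (s * s) ≤ #S * D * (s * s) := by
          rw [mul_assoc, ← nsmul_eq_mul]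
          refine sum_le_card_nsmul _ _ _ fun e _ => ?_
          gcongr
          exact hD e
        have h4 : ∑ e ∈ S, (#(S.erase e) : ℝ) * (s * s) ≤ #S * #S * (s * s) := by
          rw [mul_assoc, ← nsmul_eq_mul]
          refine sum_le_card_nsmul _ _ _ fun e _ => ?_
          gcongr
          exact erase_subset _ _
        linarith
    _ ≤ _ := sum_le_sum fun R _ => mul_le_mul_of_nonneg_left (hpt R) (hw R)

lemma sum_high_coeff_sq_le (I : V → Finset E) {D k : ℕ} (hk : 0 < k) (hkD : 2 * k ≤ D)
    (hD : ∀ e, {e' | e' ≠ e ∧ ∃ v, e ∈ I v ∧ e' ∈ I v}.ncard ≤ D)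
    {f g : (E → Bool) → ℝ} (hfg : ∀ x y, starDist I x y ≤ 1 → (f x - f y) ^ 2 ≤ g x + g y) :
    ∑ S with k ≤ #S, coeff f S ^ 2 ≤ 8 * D / k * avg g := by
  classical
  have hD' : ∀ e, #{e' | e' ≠ e ∧ ∃ v, e ∈ I v ∧ e' ∈ I v} ≤ D := fun e => by
    have := hD e
    rwa [Set.ncard_eq_toFinset_card', Set.toFinset_ofPred] at this
  have hDr : (2 : ℝ) ≤ D := by exact_mod_cast (show 2 ≤ D by omega)
  have hkr : (0 : ℝ) < k := by exact_mod_cast hk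
  set w := weight (fun (_ : E) b => if b then 1 / (2 * D : ℝ) else 1 - 1 / (2 * D)) with hw
  have hp1 : ∑ R, w R = 1 := sum_weight fun e => by simp
  have hw0 : ∀ R, 0 ≤ w R := weight_nonneg fun e b => by
    have : (1 : ℝ) / (2 * D) ≤ 1 := by rw [div_le_one (by positivity)]; linarith
    split_ifs
    · positivity
    · linarith
  have h1 : ∑ S, coeff f S ^ 2 * ∑ R, w R * (if ∃ e ∈ S, e ∈ isolated I R then 1 else 0)
      ≤ avg g := by
    calc _ = ∑ R, w R * ∑ S, coeff f S ^ 2 * (if ∃ e ∈ S, e ∈ isolated I R then 1 else 0) := by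
          simp only [mul_sum]
          rw [sum_comm]
          exact sum_congr rfl fun R _ => sum_congr rfl fun S _ => by ring
      _ ≤ ∑ R, w R * avg g := sum_le_sum fun R _ => mul_le_mul_of_nonneg_left
          (sum_coeff_sq_meeting_le I (card_filter_isolated_le I R) hfg) (hw0 R)
      _ = avg g := by rw [← sum_mul, hp1, one_mul]
  have h2 : ∀ S : Finset E, k ≤ #S →
      (k : ℝ) / (8 * D) ≤ ∑ R, w R * (if ∃ e ∈ S, e ∈ isolated I R then 1 else 0) := fun S hS => by
    obtain ⟨S', hS', hc⟩ := exists_subset_card_eq hS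
    have h3 := le_sum_weight_isolated I (by omega) hD' (S := S') (by omega)
    rw [hc] at h3
    refine h3.trans (sum_le_sum fun R _ => mul_le_mul_of_nonneg_left ?_ (hw0 R))
    by_cases h4 : ∃ e ∈ S', e ∈ isolated I R
    · obtain ⟨e, he, he'⟩ := h4
      rw [if_pos ⟨e, he, he'⟩, if_pos ⟨e, hS' he, he'⟩]
    · rw [if_neg h4]; split_ifs <;> norm_num
  have h3 : (k : ℝ) / (8 * D) * ∑ S with k ≤ #S, coeff f S ^ 2 ≤ avg g := by
    refine le_trans ?_ h1
    rw [mul_sum]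
    refine le_trans (sum_le_sum fun S hS => ?_) (sum_le_sum_of_subset_of_nonneg
      (filter_subset (fun S : Finset E => k ≤ #S) univ) fun S _ _ => ?_)
    · rw [mul_comm]
      exact mul_le_mul_of_nonneg_left (h2 S (mem_filter.1 hS).2) (sq_nonneg _)
    · refine mul_nonneg (sq_nonneg _) (sum_nonneg fun R _ => mul_nonneg (hw0 R) ?_)
      split_ifs <;> norm_num
  rw [div_mul_eq_mul_div, div_le_iff₀ (by positivity)] at h3
  rw [div_mul_eq_mul_div, le_div_iff₀ hkr]
  linarith

end High

section Expansion

variable {E V : Type*} [Fintype E] [DecidableEq E] [Fintype V]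

omit [Fintype E] [DecidableEq E] in
lemma starDist_self (I : V → Finset E) (x : E → Bool) : starDist I x x = 0 := by
  simp [starDist]

omit [Fintype E] [DecidableEq E] in
lemma starDist_comm (I : V → Finset E) (x y : E → Bool) : starDist I x y = starDist I y x := by
  simp only [starDist, ne_comm]

omit [Fintype E] in
lemma starDist_triangle (I : V → Finset E) (x y z : E → Bool) :
    starDist I x z ≤ starDist I x y + starDist I y z := by
  refine Finset.sup_le fun v _ => ?_
  refine le_trans ?_ (add_le_add (card_le_starDist I x y v) (card_le_starDist I y z v))
  refine (card_le_card fun e he => ?_).trans (card_union_le _ _)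
  simp only [mem_union, mem_filter] at he ⊢
  by_cases h : x e = y e
  · exact Or.inr ⟨he.1, h ▸ he.2⟩
  · exact Or.inl ⟨he.1, h⟩

/-- The uniform probability of a subset of the cube. -/
noncomputable def mass (A : Set (E → Bool)) : ℝ := avg (A.indicator 1)

/-- The `T`-neighbourhood of a subset of the cube. -/
def nbhd (I : V → Finset E) (A : Set (E → Bool)) (T : ℕ) : Set (E → Bool) :=
  {y | ∃ x ∈ A, starDist I x y ≤ T}

/-- The subset is invariant under a family of isometric coordinate permutations acting transitively
on the coordinates. -/
def IsSymmetric (I : V → Finset E) (A : Set (E → Bool)) : Prop :=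
  ∀ e e', ∃ π : Equiv.Perm E, π e = e' ∧ (∀ x : E → Bool, x ∘ π ∈ A ↔ x ∈ A) ∧
    ∀ x y : E → Bool, starDist I (x ∘ π) (y ∘ π) = starDist I x y

omit [Fintype E] [DecidableEq E] in
lemma mem_nbhd_comp_perm {I : V → Finset E} {A : Set (E → Bool)} {π : Equiv.Perm E}
    (hA : ∀ x : E → Bool, x ∘ π ∈ A ↔ x ∈ A)
    (hI : ∀ x y : E → Bool, starDist I (x ∘ π) (y ∘ π) = starDist I x y) (T : ℕ) (x : E → Bool) :
    x ∘ π ∈ nbhd I A T ↔ x ∈ nbhd I A T := by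
  constructor
  · rintro ⟨a, ha, h⟩
    have h1 : a = (a ∘ π.symm) ∘ π := by ext; simp
    rw [h1, hA] at ha
    rw [h1, hI] at h
    exact ⟨_, ha, h⟩
  · rintro ⟨a, ha, h⟩
    exact ⟨a ∘ π, (hA a).2 ha, by rwa [hI]⟩

omit [Fintype E] [DecidableEq E] in
lemma IsSymmetric.nbhd {I : V → Finset E} {A : Set (E → Bool)} (h : IsSymmetric I A) (T : ℕ) :
    IsSymmetric I (nbhd I A T) := fun e e' => by
  obtain ⟨π, h1, h2, h3⟩ := h e e'
  exact ⟨π, h1, mem_nbhd_comp_perm h2 h3 T, h3⟩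

omit [Fintype E] [DecidableEq E] in
lemma IsSymmetric.compl {I : V → Finset E} {A : Set (E → Bool)} (h : IsSymmetric I A) :
    IsSymmetric I Aᶜ := fun e e' => by
  obtain ⟨π, h1, h2, h3⟩ := h e e'
  exact ⟨π, h1, fun x => not_congr (h2 x), h3⟩

omit [Fintype E] in
lemma nbhd_nbhd_subset (I : V → Finset E) (A : Set (E → Bool)) (S T : ℕ) :
    nbhd I (nbhd I A S) T ⊆ nbhd I A (S + T) := by
  rintro z ⟨y, ⟨x, hx, h1⟩, h2⟩
  exact ⟨x, hx, (starDist_triangle I x y z).trans (add_le_add h1 h2)⟩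

lemma mass_mono {A B : Set (E → Bool)} (h : A ⊆ B) : mass A ≤ mass B :=
  avg_mono fun _ => Set.indicator_le_indicator_of_subset h (fun _ => zero_le_one) _

lemma mass_nonneg (A : Set (E → Bool)) : 0 ≤ mass A :=
  avg_nonneg fun _ => Set.indicator_nonneg (fun _ _ => zero_le_one) _

lemma mass_compl (A : Set (E → Bool)) : mass Aᶜ = 1 - mass A := by
  have h : mass A + mass Aᶜ = 1 := by
    rw [mass, mass, ← avg_add]
    refine (congrArg avg (funext fun x => ?_)).trans (avg_const 1)
    by_cases hx : x ∈ A <;> simp [hx]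
  linarith

lemma sub_sq_le_of_isSymmetric [Nonempty E] (I : V → Finset E) {b : ℝ} (hb : 2 ≤ b)
    (hV : (Fintype.card V : ℝ) ≤ b ^ 4) (hI : ∀ v, (#(I v) : ℝ) ≤ b ^ 4)
    (hE : (Fintype.card E : ℝ) ≤ b ^ 8) {D k T : ℕ} (hk : 0 < k) (hkD : 2 * k ≤ D) (hT : 0 < T)
    (hD : ∀ e, {e' | e' ≠ e ∧ ∃ v, e ∈ I v ∧ e' ∈ I v}.ncard ≤ D)
    {A : Set (E → Bool)} (hA : IsSymmetric I A) (hne : A.Nonempty) :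
    mass A - mass (nbhd I A T) ^ 2 ≤
      16 ^ k * (b ^ 5 * (7 / T + 1 / b ^ 2) / √(Fintype.card E))
        + 8 * D / k * (mass (nbhd I A T) / T ^ 2) := by
  have hTr : (0 : ℝ) < T := by exact_mod_cast hT
  set δ : (E → Bool) → ℕ := fun x => sInf {d | ∃ a ∈ A, starDist I a x = d} with hδ
  have hδmem : ∀ x, ∃ a ∈ A, starDist I a x = δ x := fun x => by
    obtain ⟨a, ha⟩ := hne
    exact Nat.sInf_mem (s := {d | ∃ a ∈ A, starDist I a x = d}) ⟨_, a, ha, rfl⟩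
  have hδle : ∀ a ∈ A, ∀ x, δ x ≤ starDist I a x := fun a ha x => Nat.sInf_le ⟨a, ha, rfl⟩
  have hδlip : ∀ x y, δ y ≤ δ x + starDist I x y := fun x y => by
    obtain ⟨a, ha, h⟩ := hδmem x
    rw [← h]
    exact (hδle a ha y).trans (starDist_triangle I a x y)
  set f : (E → Bool) → ℝ := fun x => ((T - δ x : ℕ) : ℝ) / T with hf
  have hf0 : ∀ x, 0 ≤ f x := fun x => by positivity
  have hf1 : ∀ x, f x ≤ 1 := fun x => by
    rw [hf]; simp only
    rw [div_le_one hTr]; exact_mod_cast Nat.sub_le _ _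
  have hlip1 : ∀ x y, f x - f y ≤ starDist I x y / T := fun x y => by
    rw [hf]; simp only
    rw [← sub_div]
    gcongr
    rw [sub_le_iff_le_add]
    have := hδlip x y
    exact_mod_cast (show T - δ x ≤ starDist I x y + (T - δ y) by omega)
  have hlip : ∀ x y, |f x - f y| ≤ starDist I x y / T := fun x y => by
    rw [abs_le]
    have h1 := hlip1 x y
    have h2 := hlip1 y x
    rw [starDist_comm] at h2
    constructor <;> linarith
  have hfA : ∀ x ∈ A, f x = 1 := fun x hx => by
    have := hδle x hx x
    rw [starDist_self, Nat.le_zero] at this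
    rw [hf]; simp only
    rw [this, Nat.sub_zero, div_self hTr.ne']
  have hfN : ∀ x, x ∉ nbhd I A T → f x = 0 := fun x hx => by
    have : T ≤ δ x := by
      by_contra h
      obtain ⟨a, ha, h'⟩ := hδmem x
      exact hx ⟨a, ha, by omega⟩
    rw [hf]; simp only
    rw [Nat.sub_eq_zero_of_le this]; simp
  have hsymm : ∀ e e', ∃ π : Equiv.Perm E, π e = e' ∧ ∀ x : E → Bool, f (x ∘ π) = f x :=
    fun e e' => by
      obtain ⟨π, h1, h2, h3⟩ := hA e e'
      refine ⟨π, h1, fun x => ?_⟩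
      have : δ (x ∘ π) = δ x := by
        apply le_antisymm
        · obtain ⟨a, ha, h⟩ := hδmem x
          rw [← h, ← h3]
          exact hδle _ ((h2 a).2 ha) _
        · obtain ⟨a, ha, h⟩ := hδmem (x ∘ π)
          have h4 : a = (a ∘ π.symm) ∘ π := by ext; simp
          rw [h4, h2] at ha
          rw [← h, h4, h3]
          exact hδle _ ha _
      simp only [hf, this]
  have hlow := sum_low_coeff_sq_le hf0 hf1 hsymm
    (sum_abs_noisyGrad_le I hb hV hI hE hTr hf0 hf1 hlip) k
  have hhigh := sum_high_coeff_sq_le I hk hkD hD (f := f)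
    (g := fun x => 1 / T ^ 2 * (nbhd I A T).indicator 1 x) fun x y hxy => by
      have h1 : (f x - f y) ^ 2 ≤ 1 / T ^ 2 := by
        rw [← sq_abs, one_div, ← inv_pow, ← one_div]
        refine pow_le_pow_left₀ (abs_nonneg _) ((hlip x y).trans ?_) 2
        gcongr
        exact_mod_cast hxy
      have h2 : (0 : ℝ) ≤ 1 / T ^ 2 := by positivity
      by_cases hx : x ∈ nbhd I A T <;> by_cases hy : y ∈ nbhd I A T
      · simp only [hx, hy, Set.indicator_of_mem, Pi.one_apply]; linarith
      · simp only [hx, hy, Set.indicator_of_mem, Pi.one_apply, Set.indicator_of_notMem,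
          not_false_eq_true]; linarith
      · simp only [hx, hy, Set.indicator_of_mem, Pi.one_apply, Set.indicator_of_notMem,
          not_false_eq_true]; linarith
      · rw [hfN x hx, hfN y hy]; simp [hx, hy]
  rw [avg_const_mul] at hhigh
  have hsplit : ∑ S, coeff f S ^ 2 ≤ coeff f ∅ ^ 2
      + ∑ S with 1 ≤ #S ∧ #S < k, coeff f S ^ 2 + ∑ S with k ≤ #S, coeff f S ^ 2 := by
    rw [← sum_singleton (fun S => coeff f S ^ 2) ∅]
    rw [← sum_filter_add_sum_filter_not univ (fun S : Finset E => k ≤ #S)]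
    rw [add_comm, add_le_add_iff_right]
    rw [← sum_union (by
      rw [disjoint_singleton_left]; simp)]
    refine sum_le_sum_of_subset_of_nonneg (fun S hS => ?_) fun _ _ _ => sq_nonneg _
    simp only [mem_filter, mem_univ, true_and, not_le, mem_union, mem_singleton] at hS ⊢
    rcases S.eq_empty_or_nonempty with h | h
    · exact Or.inl h
    · exact Or.inr ⟨h.card_pos, hS⟩
  rw [sum_coeff_sq, coeff_empty] at hsplit
  have h1 : mass A ≤ avg fun x => f x ^ 2 := avg_mono fun x => by
    by_cases hx : x ∈ A
    · rw [hfA x hx]; simp [hx]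
    · simp only [hx, Set.indicator_of_notMem, not_false_eq_true]; positivity
  have h2 : avg f ≤ mass (nbhd I A T) := avg_mono fun x => by
    by_cases hx : x ∈ nbhd I A T
    · simpa [hx] using hf1 x
    · rw [hfN x hx]; simp [hx]
  have h3 : avg f ^ 2 ≤ mass (nbhd I A T) ^ 2 := pow_le_pow_left₀ (avg_nonneg hf0) h2 2
  have h4 : 8 * D / k * (1 / (T : ℝ) ^ 2 * mass (nbhd I A T))
      = 8 * D / k * (mass (nbhd I A T) / T ^ 2) := by ring
  change _ ≤ 8 * D / k * (1 / (T : ℝ) ^ 2 * mass (nbhd I A T)) at hhigh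
  linarith

end Expansion

section Growth

variable {E V : Type*} [Fintype E] [DecidableEq E] [Fintype V]

lemma mul_mass_le_mass_nbhd (I : V → Finset E) {n : ℕ} (hn : 10 ^ 5 ≤ Real.log n)
    (hV : Fintype.card V ≤ n) (hI : ∀ v, #(I v) ≤ n)
    (hE : Fintype.card E ≤ n ^ 2) (hE' : n ^ 2 ≤ 4 * Fintype.card E)
    (hD : ∀ e, {e' | e' ≠ e ∧ ∃ v, e ∈ I v ∧ e' ∈ I v}.ncard ≤ 2 * n)
    {T : ℕ} (hT : 200 * √(n / Real.log n) ≤ T)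
    {A : Set (E → Bool)} (hA : IsSymmetric I A)
    (hA0 : Real.exp (-(1 / 10 * Real.log n)) ≤ mass A) (hA1 : mass A ≤ 1 / 2) :
    6 / 5 * mass A ≤ mass (nbhd I A T) := by
  set L := Real.log n with hL
  have hL0 : 0 < L := by linarith
  have hn0 : 0 < n := by
    rcases n.eq_zero_or_pos with h | h
    · rw [hL, h] at hL0; simp at hL0
    · exact h
  have hnr : (0 : ℝ) < n := by exact_mod_cast hn0
  have hnexp : (n : ℝ) = Real.exp L := (Real.exp_log hnr).symm
  have ha0 : 0 < mass A := (Real.exp_pos _).trans_le hA0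
  have hne : A.Nonempty := by
    by_contra h
    rw [Set.not_nonempty_iff_eq_empty] at h
    rw [h] at ha0
    simp [mass, avg] at ha0
  have hEr' : (n : ℝ) ^ 2 ≤ 4 * Fintype.card E := by exact_mod_cast hE'
  have hEpos : 0 < Fintype.card E := by
    have : 0 < n ^ 2 := by positivity
    omega
  have : Nonempty E := Fintype.card_pos_iff.1 hEpos
  have hTr : (0 : ℝ) < T := lt_of_lt_of_le (by positivity) hT
  have hT0 : 0 < T := by exact_mod_cast hTr
  set b := Real.exp (L / 4) with hb
  have hb4 : b ^ 4 = n := by rw [hb, ← Real.exp_nat_mul, hnexp]; congr 1; push_cast; ring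
  have hb2 : 2 ≤ b := by
    have := Real.add_one_le_exp (L / 4)
    linarith
  set k := ⌊L / 100⌋₊ with hk
  have hkle : (k : ℝ) ≤ L / 100 := Nat.floor_le (by positivity)
  have hkge : L / 200 ≤ k := by
    have := Nat.lt_floor_add_one (L / 100)
    linarith
  have hk0r : (0 : ℝ) < k := lt_of_lt_of_le (by positivity) hkge
  have hk0 : 0 < k := by exact_mod_cast hk0r
  have hkn : k ≤ n := by
    have h1 := Real.add_one_le_exp L
    rw [← hnexp] at h1
    exact_mod_cast (show (k : ℝ) ≤ n by linarith)
  have hmain := sub_sq_le_of_isSymmetric I hb2 (by rw [hb4]; exact_mod_cast hV)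
    (fun v => by rw [hb4]; exact_mod_cast hI v)
    (by rw [show b ^ 8 = (b ^ 4) ^ 2 by ring, hb4]; exact_mod_cast hE) hk0
    (show 2 * k ≤ 2 * n by omega) hT0 hD hA hne
  set m := mass (nbhd I A T) with hm
  by_contra hlt
  push Not at hlt
  have hm0 : 0 ≤ m := mass_nonneg _
  have hT2 : 40000 * n / L ≤ (T : ℝ) ^ 2 := by
    calc 40000 * n / L = (200 * √(n / L)) ^ 2 := by
          rw [mul_pow, Real.sq_sqrt (by positivity)]; ring
      _ ≤ _ := pow_le_pow_left₀ (by positivity) hT 2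
  have hhigh : 8 * ((2 * n : ℕ) : ℝ) / k * (m / T ^ 2) ≤ 0.096 * mass A := by
    push_cast
    calc 8 * (2 * (n : ℝ)) / k * (m / T ^ 2)
        ≤ 8 * (2 * (n : ℝ)) / (L / 200) * (6 / 5 * mass A / (40000 * n / L)) := by gcongr
      _ = 0.096 * mass A := by field_simp; norm_num
  have hsqrtE : b ^ 2 / 2 * b ^ 2 ≤ √(Fintype.card E) := by
    apply Real.le_sqrt_of_sq_le
    rw [show (b ^ 2 / 2 * b ^ 2) ^ 2 = (b ^ 4) ^ 2 / 4 by ring, hb4]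
    linarith
  have h7T : 7 / (T : ℝ) + 1 / b ^ 2 ≤ 2 * L / b ^ 2 := by
    calc 7 / (T : ℝ) + 1 / b ^ 2 ≤ 7 / (200 * (b ^ 2 / L)) + L / b ^ 2 := by
          gcongr
          · refine le_trans ?_ hT
            have h2 : b ^ 2 / L ≤ √(n / L) := by
              apply Real.le_sqrt_of_sq_le
              rw [div_pow, ← pow_mul, hb4]
              gcongr
              nlinarith
            linarith
          · linarith
      _ ≤ 2 * L / b ^ 2 := by
          have : 7 / (200 * (b ^ 2 / L)) = 7 / 200 * (L / b ^ 2) := by field_simp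
          rw [this, mul_div_assoc]
          have : 0 < L / b ^ 2 := by positivity
          linarith
  have h16 : (16 : ℝ) ^ k ≤ Real.exp (3 / 100 * L) := by
    have h1 : (16 : ℝ) ≤ Real.exp 3 := by
      have := Real.exp_one_gt_d9
      rw [show (3 : ℝ) = (3 : ℕ) * 1 by norm_num, Real.exp_nat_mul]
      calc (16 : ℝ) ≤ 2.7 ^ 3 := by norm_num
        _ ≤ _ := by gcongr; linarith
    calc (16 : ℝ) ^ k ≤ Real.exp 3 ^ k := by gcongr
      _ = Real.exp (k * 3) := (Real.exp_nat_mul _ _).symm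
      _ ≤ _ := Real.exp_le_exp.2 (by linarith)
  have hlow : 16 ^ k * (b ^ 5 * (7 / T + 1 / b ^ 2) / √(Fintype.card E)) ≤ 0.1 * mass A := by
    calc _ ≤ Real.exp (3 / 100 * L) * (b ^ 5 * (2 * L / b ^ 2) / (b ^ 2 / 2 * b ^ 2)) := by
          gcongr
      _ = Real.exp (3 / 100 * L) * (4 * L / b) := by field_simp; norm_num
      _ = 4 * L * Real.exp (-(22 / 100 * L)) := by
          rw [hb, mul_div_left_comm, ← Real.exp_sub]; congr 2; ring
      _ ≤ 0.1 * Real.exp (12 / 100 * L) * Real.exp (-(22 / 100 * L)) := by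
          refine mul_le_mul_of_nonneg_right ?_ (Real.exp_pos _).le
          have := Real.quadratic_le_exp_of_nonneg (x := 12 / 100 * L) (by positivity)
          nlinarith
      _ = 0.1 * Real.exp (-(1 / 10 * L)) := by
          rw [mul_assoc, ← Real.exp_add]; congr 2; ring
      _ ≤ _ := by gcongr
  have hm2 : m ^ 2 ≤ (6 / 5 * mass A) ^ 2 := by gcongr
  have ha2 : mass A * mass A ≤ 1 / 2 * mass A := mul_le_mul_of_nonneg_right hA1 ha0.le
  linarith

end Growth

section Iterate

variable {E V : Type*} [Fintype E] [DecidableEq E] [Fintype V]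

omit [Fintype E] [DecidableEq E] in
lemma subset_nbhd (I : V → Finset E) (A : Set (E → Bool)) (T : ℕ) : A ⊆ nbhd I A T :=
  fun x hx => ⟨x, hx, by simp [starDist_self]⟩

lemma exists_mem_of_half_lt_mass {A B : Set (E → Bool)} (hA : 1 / 2 < mass A)
    (hB : 1 / 2 < mass B) : ∃ x, x ∈ A ∧ x ∈ B := by
  by_contra! h
  have h1 := mass_mono (show B ⊆ Aᶜ from fun x hB hA => h x hA hB)
  rw [mass_compl] at h1
  linarith

lemma half_lt_mass_nbhd (I : V → Finset E) {n : ℕ} (hn : 10 ^ 5 ≤ Real.log n)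
    (hV : Fintype.card V ≤ n) (hI : ∀ v, #(I v) ≤ n)
    (hE : Fintype.card E ≤ n ^ 2) (hE' : n ^ 2 ≤ 4 * Fintype.card E)
    (hD : ∀ e, {e' | e' ≠ e ∧ ∃ v, e ∈ I v ∧ e' ∈ I v}.ncard ≤ 2 * n)
    {T : ℕ} (hT : 200 * √(n / Real.log n) ≤ T)
    {A : Set (E → Bool)} (hA : IsSymmetric I A) {ε : ℝ}
    (hε : Real.exp (-(1 / 10 * Real.log n)) ≤ ε) (hAε : ε ≤ mass A)
    {J : ℕ} (hJ : 1 / 2 < (6 / 5) ^ J * ε) : 1 / 2 < mass (nbhd I A (J * T)) := by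
  have key : ∀ j : ℕ, 1 / 2 < mass (nbhd I A (j * T)) ∨
      (6 / 5) ^ j * ε ≤ mass (nbhd I A (j * T)) := fun j => by
    induction j with
    | zero => right; rw [pow_zero, one_mul]; exact hAε.trans (mass_mono (subset_nbhd I A _))
    | succ j ih =>
      have h1 : nbhd I (nbhd I A (j * T)) T ⊆ nbhd I A ((j + 1) * T) := by
        rw [add_mul, one_mul]; exact nbhd_nbhd_subset I A _ _
      have h2 := mass_mono h1
      rcases lt_or_ge (1 / 2) (mass (nbhd I A (j * T))) with h | h
      · exact Or.inl ((h.trans_le (mass_mono (subset_nbhd I _ T))).trans_le h2)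
      · right
        have h3 := mul_mass_le_mass_nbhd I hn hV hI hE hE' hD hT (hA.nbhd (j * T))
          ((hε.trans hAε).trans (mass_mono (subset_nbhd I A _))) h
        have h4 := ih.resolve_left (not_lt.2 h)
        rw [pow_succ]
        linarith
  rcases key J with h | h
  · exact h
  · exact hJ.trans_le h

lemma one_sub_le_mass_nbhd (I : V → Finset E) {n : ℕ} (hn : 10 ^ 5 ≤ Real.log n)
    (hV : Fintype.card V ≤ n) (hI : ∀ v, #(I v) ≤ n)
    (hE : Fintype.card E ≤ n ^ 2) (hE' : n ^ 2 ≤ 4 * Fintype.card E)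
    (hD : ∀ e, {e' | e' ≠ e ∧ ∃ v, e ∈ I v ∧ e' ∈ I v}.ncard ≤ 2 * n)
    {T : ℕ} (hT : 200 * √(n / Real.log n) ≤ T)
    {A : Set (E → Bool)} (hA : IsSymmetric I A) {ε : ℝ}
    (hε : Real.exp (-(1 / 10 * Real.log n)) ≤ ε) (hAε : ε ≤ mass A)
    {J : ℕ} (hJ : 1 / 2 < (6 / 5) ^ J * ε) : 1 - ε ≤ mass (nbhd I A (2 * (J * T))) := by
  by_contra! h
  have h1 : ε ≤ mass (nbhd I A (2 * (J * T)))ᶜ := by rw [mass_compl]; linarith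
  obtain ⟨z, ⟨x, hx, hxz⟩, ⟨y, hy, hyz⟩⟩ := exists_mem_of_half_lt_mass
    (half_lt_mass_nbhd I hn hV hI hE hE' hD hT hA hε hAε hJ)
    (half_lt_mass_nbhd I hn hV hI hE hE' hD hT (hA.nbhd _).compl hε h1 hJ)
  refine hy ⟨x, hx, ?_⟩
  rw [starDist_comm] at hyz
  have := starDist_triangle I x z y
  omega

end Iterate

section Separation

variable {E V : Type*} [DecidableEq E] [Fintype V]

lemma one_le_mul_or_le_mul {r σ l d : ℝ} (hr : 0 ≤ r) (hσ : 0 ≤ σ) (hσ1 : σ ≤ 1)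
    (hd : d ≤ 2 * l) :
    1 ≤ (1 - r ^ 2) * (1 + l ^ 2 * σ) ∨ 1 + d * σ ≤ (1 + r) ^ 2 * (1 + l ^ 2 * σ) := by
  rcases le_or_gt 1 ((1 - r ^ 2) * (1 + l ^ 2 * σ)) with h | h
  · exact Or.inl h
  · right
    have hc : 0 ≤ l ^ 2 * σ := by positivity
    have h1 : l * σ ≤ r * (1 + l ^ 2 * σ) := by
      refine le_of_sq_le_sq ?_ (by positivity)
      calc (l * σ) ^ 2 = l ^ 2 * σ * σ := by ring
        _ ≤ l ^ 2 * σ * (1 + l ^ 2 * σ) := mul_le_mul_of_nonneg_left (by linarith) hc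
        _ ≤ r ^ 2 * (1 + l ^ 2 * σ) * (1 + l ^ 2 * σ) :=
          mul_le_mul_of_nonneg_right (by linarith) (by linarith)
        _ = _ := by ring
    have h2 : d * σ ≤ 2 * l * σ := mul_le_mul_of_nonneg_right hd hσ
    have h3 : 0 ≤ r ^ 2 * (1 + l ^ 2 * σ) := by positivity
    nlinarith

lemma signed_alternatives {p q σ l d : ℝ} (hp1 : 0 ≤ 1 + p) (hp0 : 0 ≤ 1 - p) (hq1 : 0 ≤ 1 + q)
    (hq0 : 0 ≤ 1 - q) (hσ : 0 ≤ σ) (hσ1 : σ ≤ 1) (hd : d ≤ 2 * l) :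
    1 ≤ (1 + p) * (1 + q) * (1 + l ^ 2 * σ) ∨ 1 ≤ (1 - p) * (1 - q) * (1 + l ^ 2 * σ) ∨
      1 + d * σ ≤ (1 + p) * (1 - q) * (1 + l ^ 2 * σ) ∨
      1 + d * σ ≤ (1 - p) * (1 + q) * (1 + l ^ 2 * σ) := by
  have hc : 0 ≤ l ^ 2 * σ := by positivity
  have mono : ∀ {k u w : ℝ}, u ≤ w → k ≤ u * (1 + l ^ 2 * σ) → k ≤ w * (1 + l ^ 2 * σ) :=
    fun h1 h2 => h2.trans (mul_le_mul_of_nonneg_right h1 (by linarith))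
  have h1 : (1 : ℝ) ≤ 1 * (1 + l ^ 2 * σ) := by linarith
  rcases le_total 0 p with hp | hp <;> rcases le_total 0 q with hq | hq
  · exact Or.inl (mono (by linarith [mul_nonneg hp hq]) h1)
  · rcases le_total p (-q) with h | h
    · have h3 := mul_nonneg hp0 (sub_nonneg.2 h)
      have h4 := mul_nonneg hp1 (sub_nonneg.2 h)
      rcases one_le_mul_or_le_mul hp hσ hσ1 hd with h2 | h2
      · exact Or.inr (Or.inl (mono (by linarith) h2))
      · exact Or.inr (Or.inr (Or.inl (mono (by linarith) h2)))
    · have h3 := mul_nonneg hq0 (sub_nonneg.2 h)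
      have h4 := mul_nonneg hq1 (sub_nonneg.2 h)
      rcases one_le_mul_or_le_mul (r := -q) (by linarith) hσ hσ1 hd with h2 | h2
      · exact Or.inl (mono (by linarith) h2)
      · exact Or.inr (Or.inr (Or.inl (mono (by linarith) h2)))
  · rcases le_total q (-p) with h | h
    · have h3 := mul_nonneg hq0 (sub_nonneg.2 h)
      have h4 := mul_nonneg hq1 (sub_nonneg.2 h)
      rcases one_le_mul_or_le_mul hq hσ hσ1 hd with h2 | h2
      · exact Or.inr (Or.inl (mono (by linarith) h2))
      · exact Or.inr (Or.inr (Or.inr (mono (by linarith) h2)))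
    · have h3 := mul_nonneg hp0 (sub_nonneg.2 h)
      have h4 := mul_nonneg hp1 (sub_nonneg.2 h)
      rcases one_le_mul_or_le_mul (r := -p) (by linarith) hσ hσ1 hd with h2 | h2
      · exact Or.inl (mono (by linarith) h2)
      · exact Or.inr (Or.inr (Or.inr (mono (by linarith) h2)))
  · exact Or.inr (Or.inl (mono (by linarith [mul_nonneg_of_nonpos_of_nonpos hp hq]) h1))

lemma split_alternatives {x₁ x₀ y₁ y₀ U U' l d : ℝ} (hx₁ : 0 ≤ x₁) (hx₀ : 0 ≤ x₀) (hy₁ : 0 ≤ y₁)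
    (hy₀ : 0 ≤ y₀) (hx : 0 < x₁ + x₀) (hy : 0 < y₁ + y₀) (hU : 0 < U) (hU' : 0 ≤ U')
    (hUU : U' ≤ U) (hd : d ≤ 2 * l) :
    (x₁ + x₀) * (y₁ + y₀) * U ≤ 4 * (x₁ * y₁) * (U + l ^ 2 * U') ∨
    (x₁ + x₀) * (y₁ + y₀) * U ≤ 4 * (x₀ * y₀) * (U + l ^ 2 * U') ∨
    (x₁ + x₀) * (y₁ + y₀) * (U + d * U') ≤ 4 * (x₁ * y₀) * (U + l ^ 2 * U') ∨
    (x₁ + x₀) * (y₁ + y₀) * (U + d * U') ≤ 4 * (x₀ * y₁) * (U + l ^ 2 * U') := by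
  obtain ⟨σ, rfl⟩ : ∃ σ, U' = σ * U := ⟨U' / U, by field_simp⟩
  have hσ : 0 ≤ σ := nonneg_of_mul_nonneg_left hU' hU
  have hσ1 : σ ≤ 1 := by
    by_contra! h
    nlinarith
  have hc : 0 ≤ l ^ 2 * σ := by positivity
  obtain ⟨p, hp⟩ : ∃ p, x₁ - x₀ = p * (x₁ + x₀) := ⟨(x₁ - x₀) / (x₁ + x₀), by field_simp⟩
  obtain ⟨q, hq⟩ : ∃ q, y₁ - y₀ = q * (y₁ + y₀) := ⟨(y₁ - y₀) / (y₁ + y₀), by field_simp⟩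
  set X := x₁ + x₀ with hX
  set Y := y₁ + y₀ with hY
  have e1 : x₁ = (1 + p) * X / 2 := by linarith
  have e2 : x₀ = (1 - p) * X / 2 := by linarith
  have e3 : y₁ = (1 + q) * Y / 2 := by linarith
  have e4 : y₀ = (1 - q) * Y / 2 := by linarith
  have hp1 : 0 ≤ 1 + p := by by_contra! h; nlinarith
  have hp0 : 0 ≤ 1 - p := by by_contra! h; nlinarith
  have hq1 : 0 ≤ 1 + q := by by_contra! h; nlinarith
  have hq0 : 0 ≤ 1 - q := by by_contra! h; nlinarith
  have hXYU : 0 < X * Y * U := by positivity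
  have fin : ∀ s t k : ℝ, k ≤ s * t * (1 + l ^ 2 * σ) →
      X * Y * U * k ≤ 4 * (s * X / 2 * (t * Y / 2)) * (U + l ^ 2 * (σ * U)) := fun s t k h => by
    have := mul_le_mul_of_nonneg_left h hXYU.le
    linarith
  have main := signed_alternatives hp1 hp0 hq1 hq0 hσ hσ1 hd
  rw [e1, e2, e3, e4, show X * Y * U = X * Y * U * 1 by ring,
    show X * Y * (U + d * (σ * U)) = X * Y * U * (1 + d * σ) by ring]
  rcases main with h | h | h | h
  · exact Or.inl (fin _ _ _ h)
  · exact Or.inr (Or.inl (fin _ _ _ h))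
  · exact Or.inr (Or.inr (Or.inl (fin _ _ _ h)))
  · exact Or.inr (Or.inr (Or.inr (fin _ _ _ h)))

lemma exists_sum_exp_mul_card_le [Nonempty V] (I : V → Finset E) {l : ℝ} (hl : 0 ≤ l) (hl1 : l ≤ 1)
    (s : Finset E) : ∀ (w : V → ℝ), (∀ v, 0 < w v) → ∀ X Y : Finset (E → Bool),
    X.Nonempty → Y.Nonempty → (∀ x ∈ X, ∀ x' ∈ X, ∀ e ∉ s, x e = x' e) →
    (∀ y ∈ Y, ∀ y' ∈ Y, ∀ e ∉ s, y e = y' e) →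
    ∃ x ∈ X, ∃ y ∈ Y,
      (#X * #Y : ℝ) * ∑ v, w v * Real.exp l ^ #{e ∈ s | e ∈ I v ∧ x e ≠ y e}
        ≤ 4 ^ #s * ∑ v, w v * (1 + l ^ 2) ^ #{e ∈ s | e ∈ I v} := by
  induction s using Finset.induction_on with
  | empty =>
    intro w hw X Y ⟨x, hx⟩ ⟨y, hy⟩ hX hY
    refine ⟨x, hx, y, hy, ?_⟩
    have h1 : #X = 1 := card_eq_one.2 ⟨x, eq_singleton_iff_unique_mem.2
      ⟨hx, fun x' hx' => funext fun e => hX x' hx' x hx e (notMem_empty e)⟩⟩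
    have h2 : #Y = 1 := card_eq_one.2 ⟨y, eq_singleton_iff_unique_mem.2
      ⟨hy, fun y' hy' => funext fun e => hY y' hy' y hy e (notMem_empty e)⟩⟩
    simp [h1, h2]
  | insert e s he ih =>
    intro w hw X Y hXne hYne hX hY
    set u : V → ℝ := fun v => w v * (1 + l ^ 2) ^ #{e ∈ s | e ∈ I v} with hu
    have hu0 : ∀ v, 0 < u v := fun v => mul_pos (hw v) (by positivity)
    set U := ∑ v, u v with hU
    set U' := ∑ v, if e ∈ I v then u v else 0 with hU'
    have hU0 : 0 < U := sum_pos (fun v _ => hu0 v) univ_nonempty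
    have hU'0 : 0 ≤ U' := sum_nonneg fun v _ => by split_ifs; exacts [(hu0 v).le, le_rfl]
    have hU'U : U' ≤ U := sum_le_sum fun v _ => by split_ifs; exacts [le_rfl, (hu0 v).le]
    have hd : Real.exp l - 1 ≤ 2 * l := by
      have h1 := (abs_le.1 (Real.abs_exp_sub_one_sub_id_le (x := l) (by rwa [abs_of_nonneg hl]))).2
      nlinarith
    have hR : ∑ v, w v * (1 + l ^ 2) ^ #{e' ∈ insert e s | e' ∈ I v} = U + l ^ 2 * U' := by
      rw [hU, hU', mul_sum, ← sum_add_distrib]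
      refine sum_congr rfl fun v _ => ?_
      rw [filter_insert]
      split_ifs with h
      · rw [card_insert_of_notMem (by simp [he]), pow_succ]; simp only [hu]; ring
      · simp [hu]
    have hsl : ∀ (Z : Finset (E → Bool)) (i : Bool),
        (∀ x ∈ Z, ∀ x' ∈ Z, ∀ e' ∉ insert e s, x e' = x' e') →
        ∀ x ∈ Z.filter (fun x => x e = i), ∀ x' ∈ Z.filter (fun x => x e = i), ∀ e' ∉ s,
          x e' = x' e' := fun Z i hZ x hx x' hx' e' he' => by
      rw [mem_filter] at hx hx'
      by_cases h : e' = e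
      · rw [h, hx.2, hx'.2]
      · exact hZ x hx.1 x' hx'.1 e' (by simp [h, he'])
    have hsplit : ∀ Z : Finset (E → Bool), #(Z.filter fun x => x e = true)
        + #(Z.filter fun x => x e = false) = #Z := fun Z => by
      rw [← card_filter_add_card_filter_not (s := Z) fun x => x e = true]
      simp
    have step : ∀ i j : Bool, (#X * #Y : ℝ) * (if i = j then U else U + (Real.exp l - 1) * U')
        ≤ 4 * (#(X.filter fun x => x e = i) * #(Y.filter fun x => x e = j)) * (U + l ^ 2 * U') →
        ∃ x ∈ X, ∃ y ∈ Y,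
          (#X * #Y : ℝ) * ∑ v, w v * Real.exp l ^ #{e' ∈ insert e s | e' ∈ I v ∧ x e' ≠ y e'}
            ≤ 4 ^ #(insert e s) * ∑ v, w v * (1 + l ^ 2) ^ #{e' ∈ insert e s | e' ∈ I v} := by
      intro i j hij
      set X' := X.filter fun x => x e = i with hX'
      set Y' := Y.filter fun x => x e = j with hY'
      have hcX : (0 : ℝ) < #X := by exact_mod_cast hXne.card_pos
      have hcY : (0 : ℝ) < #Y := by exact_mod_cast hYne.card_pos
      have hW0 : 0 < (if i = j then U else U + (Real.exp l - 1) * U') := by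
        have := Real.add_one_le_exp l
        split_ifs
        · exact hU0
        · nlinarith
      have hpos : (0 : ℝ) < #X' * #Y' := by
        by_contra! h
        have h1 : 0 < (#X * #Y : ℝ) * (if i = j then U else U + (Real.exp l - 1) * U') := by
          positivity
        have h2 : 0 < U + l ^ 2 * U' := by positivity
        nlinarith
      have hX'0 : X'.Nonempty := by
        rw [nonempty_iff_ne_empty]; rintro h; rw [h] at hpos; simp at hpos
      have hY'0 : Y'.Nonempty := by
        rw [nonempty_iff_ne_empty]; rintro h; rw [h] at hpos; simp at hpos
      set w' : V → ℝ := fun v => w v * if i ≠ j ∧ e ∈ I v then Real.exp l else 1 with hw'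
      obtain ⟨x, hx, y, hy, hxy⟩ := ih w' (fun v => mul_pos (hw v) (by
        split_ifs; exacts [Real.exp_pos _, one_pos])) X' Y' hX'0 hY'0 (hsl X i hX) (hsl Y j hY)
      rw [mem_filter] at hx hy
      refine ⟨x, hx.1, y, hy.1, ?_⟩
      have h1 : ∑ v, w v * Real.exp l ^ #{e' ∈ insert e s | e' ∈ I v ∧ x e' ≠ y e'}
          = ∑ v, w' v * Real.exp l ^ #{e' ∈ s | e' ∈ I v ∧ x e' ≠ y e'} := by
        refine sum_congr rfl fun v _ => ?_
        rw [filter_insert, hx.2, hy.2]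
        simp only [hw', and_comm (a := i ≠ j)]
        split_ifs with h
        · rw [card_insert_of_notMem (by simp [he]), pow_succ]; ring
        · ring
      have h2 : ∑ v, w' v * (1 + l ^ 2) ^ #{e ∈ s | e ∈ I v}
          = if i = j then U else U + (Real.exp l - 1) * U' := by
        split_ifs with h
        · simp [hw', h, hU, hu]
        · rw [hU, hU', mul_sum, ← sum_add_distrib]
          refine sum_congr rfl fun v _ => ?_
          simp only [hw', hu, ne_eq, h, not_false_eq_true, true_and]
          split_ifs <;> ring
      rw [h1, hR, card_insert_of_notMem he]
      rw [h2] at hxy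
      set W := ∑ v, w' v * Real.exp l ^ #{e' ∈ s | e' ∈ I v ∧ x e' ≠ y e'} with hS
      have hS0 : 0 ≤ W := sum_nonneg fun v _ => mul_nonneg (mul_pos (hw v) (by
        split_ifs; exacts [Real.exp_pos _, one_pos])).le (by positivity)
      refine le_of_mul_le_mul_left ?_ hpos
      calc (#X' * #Y' : ℝ) * (#X * #Y * W) = (#X * #Y) * (#X' * #Y' * W) := by ring
        _ ≤ (#X * #Y) * (4 ^ #s * if i = j then U else U + (Real.exp l - 1) * U') := by gcongr
        _ = 4 ^ #s * ((#X * #Y) * if i = j then U else U + (Real.exp l - 1) * U') := by ring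
        _ ≤ 4 ^ #s * (4 * (#X' * #Y') * (U + l ^ 2 * U')) := by gcongr
        _ = _ := by rw [pow_succ]; ring
    have hXs : (#X : ℝ) = #(X.filter fun x => x e = true) + #(X.filter fun x => x e = false) := by
      rw [← hsplit X]; push_cast; rfl
    have hYs : (#Y : ℝ) = #(Y.filter fun x => x e = true) + #(Y.filter fun x => x e = false) := by
      rw [← hsplit Y]; push_cast; rfl
    have hcX : (0 : ℝ) < #X := by exact_mod_cast hXne.card_pos
    have hcY : (0 : ℝ) < #Y := by exact_mod_cast hYne.card_pos
    rcases split_alternatives (Nat.cast_nonneg _) (Nat.cast_nonneg _) (Nat.cast_nonneg _)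
      (Nat.cast_nonneg _) (hXs ▸ hcX) (hYs ▸ hcY) hU0 hU'0 hU'U hd with h | h | h | h
    · exact step true true (by rw [← hXs, ← hYs] at h; simpa using h)
    · exact step false false (by rw [← hXs, ← hYs] at h; simpa using h)
    · exact step true false (by rw [← hXs, ← hYs] at h; simpa using h)
    · exact step false true (by rw [← hXs, ← hYs] at h; simpa using h)

end Separation

section Main

variable {E V : Type*} [Fintype E] [DecidableEq E] [Fintype V]

lemma mass_eq_card_div (A : Set (E → Bool)) [DecidablePred (· ∈ A)] :
    mass A = (#{x | x ∈ A} : ℝ) / 2 ^ Fintype.card E := by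
  simp [mass, avg, Set.indicator_apply]

omit [Fintype E] [DecidableEq E] in
lemma starDist_le (I : V → Finset E) {n : ℕ} (hI : ∀ v, #(I v) ≤ n) (x y : E → Bool) :
    starDist I x y ≤ n :=
  Finset.sup_le fun v _ => (card_filter_le _ _).trans (hI v)

lemma exists_exp_mul_starDist_le [Nonempty V] (I : V → Finset E) {n : ℕ} (hV : Fintype.card V = n)
    (hI : ∀ v, #(I v) ≤ n) {A B : Set (E → Bool)} (hA : 0 < mass A) (hB : 0 < mass B) {l : ℝ}
    (hl : 0 ≤ l) (hl1 : l ≤ 1) :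
    ∃ x ∈ A, ∃ y ∈ B, mass A * mass B * Real.exp (l * starDist I x y)
      ≤ n * Real.exp (l ^ 2 * n) := by
  classical
  have hne : ∀ {A : Set (E → Bool)}, 0 < mass A → (Finset.univ.filter (· ∈ A)).Nonempty :=
    fun {A} h => by
      rw [nonempty_iff_ne_empty]
      intro h'
      rw [mass_eq_card_div, h'] at h
      simp at h
  obtain ⟨x, hx, y, hy, h⟩ := exists_sum_exp_mul_card_le I hl hl1 univ (fun _ => 1)
    (fun _ => one_pos) _ _ (hne hA) (hne hB) (by simp) (by simp)
  refine ⟨x, (mem_filter.1 hx).2, y, (mem_filter.1 hy).2, ?_⟩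
  obtain ⟨v, -, hv⟩ := exists_mem_eq_sup univ univ_nonempty fun v => #{e ∈ I v | x e ≠ y e}
  have h1 : Real.exp (l * starDist I x y)
      ≤ ∑ v, 1 * Real.exp l ^ #{e | e ∈ I v ∧ x e ≠ y e} := by
    have h2 : #{e | e ∈ I v ∧ x e ≠ y e} = starDist I x y := by
      rw [starDist, hv]; congr 1; ext e; simp
    rw [mul_comm l, Real.exp_nat_mul, ← h2, ← one_mul (Real.exp l ^ _)]
    exact single_le_sum (f := fun v => 1 * Real.exp l ^ #{e | e ∈ I v ∧ x e ≠ y e})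
      (fun v _ => by positivity) (mem_univ v)
  have h3 : ∑ v, 1 * (1 + l ^ 2) ^ #{e | e ∈ I v} ≤ n * Real.exp (l ^ 2 * n) := by
    rw [← hV, ← nsmul_eq_mul, ← Finset.card_univ]
    refine sum_le_card_nsmul _ _ _ fun v _ => ?_
    rw [one_mul, Finset.card_univ, hV, mul_comm, Real.exp_nat_mul]
    calc (1 + l ^ 2) ^ #{e | e ∈ I v} ≤ (1 + l ^ 2) ^ n := by
          refine pow_le_pow_right₀ (by nlinarith) ?_
          simpa using hI v
      _ ≤ _ := by gcongr; linarith [Real.add_one_le_exp (l ^ 2)]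
  have h4 : (0 : ℝ) < 4 ^ Fintype.card E := by positivity
  have h5 : (4 : ℝ) ^ Fintype.card E = 2 ^ Fintype.card E * 2 ^ Fintype.card E := by
    rw [← mul_pow]; norm_num
  rw [Finset.card_univ] at h
  rw [mass_eq_card_div, mass_eq_card_div, div_mul_div_comm, ← h5, div_mul_eq_mul_div,
    div_le_iff₀ h4]
  calc _ ≤ _ := mul_le_mul_of_nonneg_left h1 (by positivity)
    _ ≤ _ := h
    _ ≤ 4 ^ Fintype.card E * (n * Real.exp (l ^ 2 * n)) := by gcongr
    _ = _ := mul_comm _ _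

lemma exists_starDist_le (I : V → Finset E) {n : ℕ} (hn : 0 < n) (hV : Fintype.card V = n)
    (hI : ∀ v, #(I v) ≤ n) {A B : Set (E → Bool)} {t : ℝ} (ht : 0 < t)
    (hnt : Real.log n ≤ 10 * t) (hA : Real.exp (-t) ≤ mass A) (hB : Real.exp (-t) ≤ mass B) :
    ∃ x ∈ A, ∃ y ∈ B, (starDist I x y : ℝ) ≤ 13 * √(t * n) := by
  have hnr : (0 : ℝ) < n := by exact_mod_cast hn
  have : Nonempty V := Fintype.card_pos_iff.1 (by omega)
  have hA0 := (Real.exp_pos (-t)).trans_le hA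
  have hB0 := (Real.exp_pos (-t)).trans_le hB
  rcases le_or_gt t n with htn | htn
  · set l := √(t / n) with hl
    have hl0 : 0 < l := Real.sqrt_pos.2 (by positivity)
    have hl1 : l ≤ 1 := by rw [hl, Real.sqrt_le_one]; exact (div_le_one hnr).2 htn
    have hl2 : l ^ 2 = t / n := Real.sq_sqrt (by positivity)
    have hln : √(t * n) = l * n := by
      rw [hl, Real.sqrt_eq_iff_mul_self_eq (by positivity) (by positivity), mul_mul_mul_comm,
        Real.mul_self_sqrt (by positivity)]
      field_simp
    obtain ⟨x, hx, y, hy, h⟩ := exists_exp_mul_starDist_le I hV hI hA0 hB0 hl0.le hl1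
    refine ⟨x, hx, y, hy, ?_⟩
    have h1 : Real.exp (-t + -t + l * starDist I x y) ≤ Real.exp (Real.log n + l ^ 2 * n) := by
      rw [Real.exp_add, Real.exp_add, Real.exp_add _ (l ^ 2 * n), Real.exp_log hnr]
      refine le_trans ?_ h
      gcongr
    rw [Real.exp_le_exp] at h1
    have h2 : l ^ 2 * n = t := by rw [hl2]; field_simp
    have h3 : l * starDist I x y ≤ l * (13 * (l * n)) := by
      rw [show l * (13 * (l * n)) = 13 * (l ^ 2 * n) by ring, h2]; linarith
    rw [hln]
    exact le_of_mul_le_mul_left h3 hl0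
  · obtain ⟨x, hx, y, hy, -⟩ := exists_exp_mul_starDist_le I hV hI hA0 hB0 zero_le_one le_rfl
    refine ⟨x, hx, y, hy, ?_⟩
    have h1 : (starDist I x y : ℝ) ≤ n := by exact_mod_cast starDist_le I hI x y
    have h2 : (n : ℝ) ≤ √(t * n) := by
      apply Real.le_sqrt_of_sq_le
      nlinarith
    linarith

lemma mass_univ : mass (Set.univ : Set (E → Bool)) = 1 := by
  rw [mass, Set.indicator_univ]
  exact avg_const 1

theorem one_sub_le_mass (I : V → Finset E) {n : ℕ} (hn : 3 ≤ n) (hV : Fintype.card V = n)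
    (hI : ∀ v, #(I v) ≤ n) (hE : Fintype.card E ≤ n ^ 2) (hE' : n ^ 2 ≤ 4 * Fintype.card E)
    (hD : ∀ e, {e' | e' ≠ e ∧ ∃ v, e ∈ I v ∧ e' ∈ I v}.ncard ≤ 2 * n)
    {A : Set (E → Bool)} (hA : IsSymmetric I A) {ε : ℝ} (hε0 : 0 < ε) (hε1 : ε < 1)
    (hAε : ε ≤ mass A) :
    1 - ε ≤ mass {y | ∃ x ∈ A, (starDist I x y : ℝ)
      ≤ (10 ^ 4 + 2 * Real.exp (10 ^ 5)) * Real.log (1 / ε) * √(n / Real.log n)} := by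
  have hnr : (3 : ℝ) ≤ n := by exact_mod_cast hn
  set L := Real.log n with hL
  set t := Real.log (1 / ε) with ht
  set s := √(n / L) with hs
  have hL0 : 0 < L := Real.log_pos (by linarith)
  have hLn : L ≤ n := (Real.log_le_sub_one_of_pos (by linarith)).trans (by linarith)
  have hs1 : 1 ≤ s := by rw [hs, Real.one_le_sqrt, one_le_div hL0]; exact hLn
  have ht0 : 0 < t := Real.log_pos (by rw [one_div]; exact (one_lt_inv₀ hε0).2 hε1)
  have hεt : ε = Real.exp (-t) := by rw [ht, one_div, Real.log_inv, neg_neg, Real.exp_log hε0]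
  have hX := Real.exp_pos (10 ^ 5)
  have hmono : ∀ d : ℝ, d ≤ (10 ^ 4 + 2 * Real.exp (10 ^ 5)) * t * s →
      ∀ B : Set (E → Bool), B ⊆ {y | ∃ x ∈ A, (starDist I x y : ℝ) ≤ d} →
      1 - ε ≤ mass B → 1 - ε ≤ mass {y | ∃ x ∈ A, (starDist I x y : ℝ)
        ≤ (10 ^ 4 + 2 * Real.exp (10 ^ 5)) * t * s} := fun d hd B hB h => by
    refine h.trans (mass_mono fun y hy => ?_)
    obtain ⟨x, hx, hxy⟩ := hB hy
    exact ⟨x, hx, hxy.trans hd⟩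
  rcases le_or_gt (1 / 2) ε with hε | hε
  · refine hmono 0 (by positivity) A (fun x hx => ⟨x, hx, by simp [starDist_self]⟩) ?_
    linarith
  have ht2 : 1 / 2 ≤ t := by
    have h1 : Real.log 2 ≤ t := by
      apply Real.log_le_log (by norm_num)
      rw [le_div_iff₀ hε0]; linarith
    linarith [Real.log_two_gt_d9]
  have hts : 1 / 2 ≤ t * s := by nlinarith
  rcases lt_or_ge L (10 ^ 5) with hLs | hLb
  · refine hmono n ?_ Set.univ (fun y _ => ?_) (by rw [mass_univ]; linarith)
    · have h1 : (n : ℝ) ≤ Real.exp (10 ^ 5) := by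
        rw [← Real.exp_log (show (0 : ℝ) < n by linarith)]
        exact Real.exp_le_exp.2 hLs.le
      rw [mul_assoc]
      nlinarith
    · have hne : A.Nonempty := by
        by_contra h
        rw [Set.not_nonempty_iff_eq_empty] at h
        rw [h] at hAε
        simp [mass, avg] at hAε
        linarith
      obtain ⟨x, hx⟩ := hne
      exact ⟨x, hx, by exact_mod_cast starDist_le I hI x y⟩
  rcases le_or_gt t (1 / 10 * L) with htL | htL
  · set T := ⌈200 * s⌉₊ with hT
    set J := ⌈6 * t⌉₊ with hJ
    have hTle : (T : ℝ) ≤ 201 * s := by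
      have := Nat.ceil_lt_add_one (show 0 ≤ 200 * s by linarith)
      linarith
    have hJle : (J : ℝ) ≤ 8 * t := by
      have := Nat.ceil_lt_add_one (show 0 ≤ 6 * t by linarith)
      linarith
    have hJ2 : 1 / 2 < (6 / 5) ^ J * ε := by
      have h1 : Real.exp (1 / 6) ≤ 6 / 5 := by
        have h2 := Real.add_one_le_exp (-(1 / 6) : ℝ)
        rw [Real.exp_neg] at h2
        have h3 := Real.exp_pos (1 / 6)
        rw [show (6 / 5 : ℝ) = (5 / 6)⁻¹ by norm_num]
        refine le_inv_of_le_inv₀ (by norm_num) (le_trans (by norm_num) h2)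
      have h2 : Real.exp t ≤ (6 / 5) ^ J := by
        calc Real.exp t ≤ Real.exp (J * (1 / 6)) := by
              apply Real.exp_le_exp.2
              have := Nat.le_ceil (6 * t)
              linarith
          _ = Real.exp (1 / 6) ^ J := Real.exp_nat_mul _ _
          _ ≤ _ := by gcongr
      calc (1 / 2 : ℝ) < 1 := by norm_num
        _ = Real.exp t * ε := by rw [hεt, ← Real.exp_add]; simp
        _ ≤ _ := by gcongr
    refine hmono (2 * (J * T) : ℕ) ?_ (nbhd I A (2 * (J * T))) ?_
      (one_sub_le_mass_nbhd I hLb hV.le hI hE hE' hD (Nat.le_ceil _) hA ?_ hAε hJ2)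
    · push_cast
      have h1 : (J * T : ℝ) ≤ 8 * t * (201 * s) := by gcongr
      have h2 : 0 ≤ t * s := by positivity
      have h3 : (10 ^ 4 + 2 * Real.exp (10 ^ 5)) * t * s
        = 10 ^ 4 * (t * s) + 2 * (Real.exp (10 ^ 5) * (t * s)) := by ring
      have h4 : 0 ≤ Real.exp (10 ^ 5) * (t * s) := by positivity
      rw [h3]
      linarith
    · rintro y ⟨x, hx, hxy⟩
      exact ⟨x, hx, by exact_mod_cast hxy⟩
    · rw [hεt]; exact Real.exp_le_exp.2 (by linarith)
  · by_contra! h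
    set N : Set (E → Bool) := {y | ∃ x ∈ A, (starDist I x y : ℝ)
      ≤ (10 ^ 4 + 2 * Real.exp (10 ^ 5)) * t * s} with hN
    have h1 : ε ≤ mass Nᶜ := by rw [mass_compl]; linarith
    obtain ⟨x, hx, y, hy, hxy⟩ := exists_starDist_le I (by omega) hV hI ht0 (by linarith)
      (hεt ▸ hAε) (hεt ▸ h1)
    refine hy ⟨x, hx, hxy.trans ?_⟩
    have h2 : √(t * n) ≤ 4 * (t * s) := by
      apply Real.sqrt_le_iff.2
      refine ⟨by positivity, ?_⟩
      rw [mul_pow, mul_pow, hs, Real.sq_sqrt (by positivity)]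
      have h3 : t * n * 1 ≤ t * n * (16 * (t / L)) := by
        refine mul_le_mul_of_nonneg_left ?_ (by positivity)
        rw [← mul_div_assoc, le_div_iff₀ hL0]
        linarith
      calc t * n = t * n * 1 := by ring
        _ ≤ _ := h3
        _ = _ := by ring
    have h4 : 0 ≤ t * s := by positivity
    have h5 : 0 ≤ Real.exp (10 ^ 5) * (t * s) := by positivity
    have h3 : (10 ^ 4 + 2 * Real.exp (10 ^ 5)) * t * s
        = 10 ^ 4 * (t * s) + 2 * (Real.exp (10 ^ 5) * (t * s)) := by ring
    rw [h3]
    linarith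

end Main

section Graphs

variable {n : ℕ}

/-- The potential edges of a graph on `Fin n`. -/
abbrev Pair (n : ℕ) := {e : Sym2 (Fin n) // ¬ e.IsDiag}

/-- The potential edges at a vertex. -/
def pairsAt (v : Fin n) : Finset (Pair n) := {e | v ∈ e.1}

lemma mem_pairsAt {v : Fin n} {e : Pair n} : e ∈ pairsAt v ↔ v ∈ e.1 := by simp [pairsAt]

lemma card_pairsAt_le (v : Fin n) : #(pairsAt v) ≤ n := by
  rw [← card_map (Function.Embedding.subtype _)]
  calc _ ≤ #(univ.image fun w => s(v, w)) := card_le_card fun e he => by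
        obtain ⟨e, he', rfl⟩ := mem_map.1 he
        obtain ⟨w, hw⟩ := mem_pairsAt.1 he'
        exact mem_image.2 ⟨w, mem_univ _, hw.symm⟩
    _ ≤ n := card_image_le.trans (by simp)

lemma ncard_adjacent_le (e : Pair n) :
    {e' | e' ≠ e ∧ ∃ v, e ∈ pairsAt v ∧ e' ∈ pairsAt v}.ncard ≤ 2 * n := by
  obtain ⟨e, he⟩ := e
  induction e using Sym2.ind with | _ a b =>
  refine (Set.ncard_le_ncard (t := ↑(pairsAt a ∪ pairsAt b)) ?_ (finite_toSet _)).trans ?_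
  · rintro e' ⟨-, v, hv, hv'⟩
    rcases Sym2.mem_iff.1 (mem_pairsAt.1 hv) with rfl | rfl
    · exact mem_coe.2 (mem_union_left _ hv')
    · exact mem_coe.2 (mem_union_right _ hv')
  · rw [Set.ncard_coe_finset]
    linarith [card_union_le (pairsAt a) (pairsAt b), card_pairsAt_le a, card_pairsAt_le b]

lemma card_pair : Fintype.card (Pair n) = n.choose 2 := by
  rw [Sym2.card_subtype_not_diag, Fintype.card_fin]

/-- The graph whose edges are the pairs at which `x` is true. -/
def graphOf (x : Pair n → Bool) : SimpleGraph (Fin n) where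
  Adj v w := ∃ h : ¬ s(v, w).IsDiag, x ⟨s(v, w), h⟩ = true
  symm := ⟨fun v w ⟨h, hx⟩ => by
    have : s(w, v) = s(v, w) := Sym2.eq_swap
    exact ⟨this ▸ h, by simpa only [this] using hx⟩⟩
  loopless := ⟨fun v ⟨h, _⟩ => h rfl⟩

lemma graphOf_adj_iff (x : Pair n → Bool) {v w : Fin n} (h : ¬ s(v, w).IsDiag) :
    (graphOf x).Adj v w ↔ x ⟨s(v, w), h⟩ = true :=
  ⟨fun ⟨_, hx⟩ => hx, fun hx => ⟨h, hx⟩⟩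

lemma graphOf_bijective : Function.Bijective (graphOf (n := n)) := by
  classical
  constructor
  · intro x y hxy
    ext ⟨e, he⟩
    induction e using Sym2.ind with | _ a b =>
    rw [Bool.eq_iff_iff, ← graphOf_adj_iff x he, hxy, graphOf_adj_iff y he]
  · intro G
    refine ⟨fun e => decide (e.1 ∈ G.edgeSet), ?_⟩
    ext v w
    constructor
    · rintro ⟨h, hx⟩
      simpa using hx
    · intro h
      exact ⟨fun h' => h.ne h', by simpa using h⟩

lemma graphProb_eq_mass (P : SimpleGraph (Fin n) → Prop) :
    graphProb n P = mass {x | P (graphOf x)} := by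
  classical
  rw [mass_eq_card_div, card_pair, graphProb]
  congr 2
  rw [← Fintype.card_subtype, ← Nat.card_eq_fintype_card]
  exact Nat.card_congr
    ((Equiv.ofBijective _ graphOf_bijective).subtypeEquiv fun _ => Iff.rfl).symm

lemma maxDegSD_graphOf_le (x y : Pair n → Bool) :
    maxDegSD (graphOf x) (graphOf y) ≤ starDist pairsAt x y := by
  refine Finset.sup_le fun v _ => le_trans ?_ (card_le_starDist pairsAt x y v)
  classical
  rw [Nat.card_eq_fintype_card, Fintype.card_subtype]
  have hne : ∀ w ∈ ({w | ¬ ((graphOf x).Adj v w ↔ (graphOf y).Adj v w)} : Finset (Fin n)),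
      ¬ s(v, w).IsDiag := fun w hw h => by
    obtain rfl : v = w := h
    simp at hw
  rw [← card_map (Function.Embedding.subtype _)]
  refine card_le_card_of_injOn (fun w => s(v, w)) (fun w hw => ?_)
    fun w _ w' _ h => Sym2.congr_right.1 h
  have h := hne w hw
  refine mem_coe.2 (mem_map.2 ⟨⟨_, h⟩, mem_filter.2 ⟨mem_pairsAt.2 (Sym2.mem_mk_left v w), ?_⟩, rfl⟩)
  have h1 := (mem_filter.1 hw).2
  rwa [graphOf_adj_iff x h, graphOf_adj_iff y h, ← Bool.eq_iff_iff] at h1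

/-- The permutation of the pairs induced by a permutation of the vertices. -/
def pairPerm (σ : Equiv.Perm (Fin n)) : Equiv.Perm (Pair n) where
  toFun e := ⟨e.1.map σ, by rw [Sym2.isDiag_map σ.injective]; exact e.2⟩
  invFun e := ⟨e.1.map σ.symm, by rw [Sym2.isDiag_map σ.symm.injective]; exact e.2⟩
  left_inv e := by ext1; simp [Sym2.map_map]
  right_inv e := by ext1; simp [Sym2.map_map]

lemma graphOf_comp_pairPerm (σ : Equiv.Perm (Fin n)) (x : Pair n → Bool) :
    graphOf (x ∘ pairPerm σ) = (graphOf x).map σ.symm.toEmbedding := by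
  rw [SimpleGraph.map_symm]
  ext v w
  constructor
  · rintro ⟨h, hx⟩
    exact ⟨(pairPerm σ ⟨_, h⟩).2, hx⟩
  · rintro ⟨h, hx⟩
    exact ⟨fun h' => h (congrArg σ h'), hx⟩

lemma starDist_comp_pairPerm (σ : Equiv.Perm (Fin n)) (x y : Pair n → Bool) :
    starDist pairsAt (x ∘ pairPerm σ) (y ∘ pairPerm σ) = starDist pairsAt x y := by
  rw [starDist, starDist]
  conv_rhs => rw [← map_univ_equiv σ, sup_map]
  congr 1
  ext v
  refine card_equiv (pairPerm σ) fun e => ?_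
  simp only [mem_filter, mem_pairsAt, Function.comp_apply, Equiv.coe_toEmbedding]
  refine and_congr_left fun _ => ?_
  simp [pairPerm, Sym2.mem_map]

lemma exists_pairPerm_eq (e e' : Pair n) : ∃ σ : Equiv.Perm (Fin n), pairPerm σ e = e' := by
  obtain ⟨e, he⟩ := e
  obtain ⟨e', he'⟩ := e'
  induction e using Sym2.ind with | _ a b =>
  induction e' using Sym2.ind with | _ c d =>
  have hab : a ≠ b := he
  have hcd : c ≠ d := he'
  have hc : c ≠ Equiv.swap a c b := fun h => hab <| by
    rw [← Equiv.swap_apply_left a c] at h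
    exact (Equiv.swap a c).injective (by simpa using h)
  refine ⟨(Equiv.swap a c).trans (Equiv.swap (Equiv.swap a c b) d), Subtype.ext ?_⟩
  simp [pairPerm, Equiv.swap_apply_of_ne_of_ne hc hcd]

lemma isSymmetric_graphOf {𝒢 : Set (SimpleGraph (Fin n))}
    (h𝒢 : ∀ σ : Equiv.Perm (Fin n), ∀ G ∈ 𝒢, G.map σ.toEmbedding ∈ 𝒢) :
    IsSymmetric pairsAt {x | graphOf x ∈ 𝒢} := by
  intro e e'
  obtain ⟨σ, hσ⟩ := exists_pairPerm_eq e e'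
  refine ⟨pairPerm σ, hσ, fun x => ⟨fun hx => ?_, fun hx => ?_⟩, starDist_comp_pairPerm σ⟩
  · have h := h𝒢 σ _ hx
    rw [graphOf_comp_pairPerm, SimpleGraph.map_map] at h
    have h1 : σ.toEmbedding ∘ σ.symm.toEmbedding = id := by ext; simp
    rwa [h1, SimpleGraph.map_id] at h
  · rw [Set.mem_ofPred_eq, graphOf_comp_pairPerm]
    exact h𝒢 σ.symm _ hx

end Graphs

end CubeExpansion

open CubeExpansion

/-- There is an absolute constant `C > 0` such that for all `n ≥ 3` and
`ε ∈ (0,1)`: if `𝒢` is an `Sₙ`-invariant family of graphs on `[n]` with `μ(𝒢) ≥ ε`, then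
`μ(𝒢_T) ≥ 1 − ε` where `T = C · log(1/ε) · √(n / log n)`. -/
theorem symmetric_family_expansion :
    ∃ C : ℝ, 0 < C ∧
      ∀ n : ℕ, 3 ≤ n → ∀ ε : ℝ, 0 < ε → ε < 1 →
        ∀ 𝒢 : Set (SimpleGraph (Fin n)),
          (∀ σ : Equiv.Perm (Fin n), ∀ G ∈ 𝒢, G.map σ.toEmbedding ∈ 𝒢) →
          ε ≤ graphProb n (fun G => G ∈ 𝒢) →
          1 - ε ≤ graphProb n (fun H => ∃ G ∈ 𝒢,
            (maxDegSD G H : ℝ) ≤ C * Real.log (1 / ε) * Real.sqrt (n / Real.log n)) := by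
  refine ⟨10 ^ 4 + 2 * Real.exp (10 ^ 5), by positivity, fun n hn ε hε0 hε1 𝒢 h𝒢 h => ?_⟩
  have h2 : n.choose 2 * 2 = n * (n - 1) := by
    rw [Nat.choose_two_right]
    exact Nat.div_mul_cancel (Nat.even_mul_pred_self n).two_dvd
  obtain ⟨m, rfl⟩ : ∃ m, n = m + 3 := ⟨n - 3, by omega⟩
  rw [show m + 3 - 1 = m + 2 by omega] at h2
  rw [graphProb_eq_mass] at h ⊢
  refine (one_sub_le_mass pairsAt hn (Fintype.card_fin _) card_pairsAt_le
    (by rw [card_pair]; nlinarith) (by rw [card_pair]; nlinarith) ncard_adjacent_le (isSymmetric_graphOf h𝒢) hε0 hε1 h).trans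
    (mass_mono ?_)
  rintro y ⟨x, hx, hxy⟩
  exact ⟨graphOf x, hx, le_trans (by exact_mod_cast maxDegSD_graphOf_le x y) hxy⟩
end
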